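/- arXiv:1912.04600 — 2 statements merged into one kernel-verified Lean document; each statement's English description precedes it below -/
import Mathlib

section
/- Let n ≥ 5 be an odd integer, p an odd prime number, P = p or 2p, ι = 1 or 2, and let b_1, …, b_{(n−3)/2}, c_1, …, c_{(n−3)/2}, L be integers satisfying: (1) P^ι b_j³ + c_j³ ≡ 2 (mod 3) is a prime number not dividing P, for every j; (2) every prime factor l of L satisfies l ≡ 2 (mod 3) and v_l(L) < n; (3) gcd(L, b_j c_j) = 1 for every j; (4) if P is even, then L ≡ ∏_j b_j² ≡ 1 (mod 2); (5) if P ≢ ±1 (mod 9), then L ≡ ∏_j b_j² ≢ 0 (mod 3) and Σ_j b_j^{−1}c_j ≢ 0 (mod 3), where b_j^{−1} denotes an inverse of b_j modulo 3; (6) if p ≡ 2 (mod 3), then L ≡ ∏_j b_j² ≢ 0 (mod p) and Σ_j b_j^{−1}c_j ≢ 0 (mod p), where b_j^{−1} denotes an inverse of b_j modulo p; (7) for every primitive triple (x,y,z) ∈ ℤ³ with x³ + P^ι y³ = L z^n, there exists a prime divisor l of L with x ≡ y ≡ 0 (mod l). Then the equation (X³ + P^ι Y³)·∏_{j=1}^{(n−3)/2}(b_j²X²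 + b_j c_j XY + c_j²Y²) = L Z^n violates the local-global principle. -/
/-- The equation `(X³+aY³) ∏_j (b_j²X² + b_j c_j XY + c_j² Y²) = L Z^n`, evaluated
in a commutative ring `K`. -/
def EqnHolds {K : Type} [CommRing K] (a L : ℤ) (n : ℕ) {m : ℕ} (b c : Fin m → ℤ)
    (X Y Z : K) : Prop :=
  (X ^ 3 + (a : K) * Y ^ 3) *
      ∏ j : Fin m, ((b j : K) ^ 2 * X ^ 2 + (b j : K) * (c j : K) * X * Y
        + (c j : K) ^ 2 * Y ^ 2)
    = (L : K) * Z ^ n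

/-- The homogeneous equation `(X³+aY³) ∏_j (b_j²X² + b_j c_j XY + c_j² Y²) = L Z^n`
violates the local-global principle: it has nontrivial solutions over `ℝ` and over `ℚ_l`
for every prime `l`, but only the trivial solution over `ℚ`. -/
def ViolatesLGP (a L : ℤ) (n : ℕ) {m : ℕ} (b c : Fin m → ℤ) : Prop :=
  (∃ X Y Z : ℝ, (X, Y, Z) ≠ (0, 0, 0) ∧ EqnHolds a L n b c X Y Z) ∧
  (∀ (l : ℕ) [Fact l.Prime], ∃ X Y Z : ℚ_[l], (X, Y, Z) ≠ (0, 0, 0) ∧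
    EqnHolds a L n b c X Y Z) ∧
  (∀ X Y Z : ℚ, EqnHolds a L n b c X Y Z → (X, Y, Z) = (0, 0, 0))

open Polynomial in
/-- Hensel's lemma for integer polynomials at an integer approximate root. -/
lemma exists_padic_root {l : ℕ} [Fact l.Prime] (F : ℤ[X]) (x : ℤ) (k : ℕ)
    (h0 : (l : ℤ) ^ (2 * k + 1) ∣ F.eval x)
    (h1 : ¬ (l : ℤ) ^ (k + 1) ∣ (derivative F).eval x) :
    ∃ z : ℚ_[l], aeval z F = 0 := by
  have hl : (1 : ℝ) < l := by exact_mod_cast (Fact.out : l.Prime).one_lt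
  have e (G : ℤ[X]) : aeval (x : ℤ_[l]) G = ((G.eval x : ℤ) : ℤ_[l]) := by
    simpa using aeval_algebraMap_apply_eq_algebraMap_eval (A := ℤ_[l]) x G
  have hF : ‖aeval (x : ℤ_[l]) F‖ < ‖aeval (x : ℤ_[l]) (derivative F)‖ ^ 2 := by
    rw [e, e]
    have a0 : ‖((F.eval x : ℤ) : ℤ_[l])‖ ≤ (l : ℝ) ^ (-((2 * k + 1 : ℕ) : ℤ)) :=
      PadicInt.norm_int_le_pow_iff_dvd.2 (by exact_mod_cast h0)
    have a1 : (l : ℝ) ^ (-(k : ℤ)) ≤ ‖(((derivative F).eval x : ℤ) : ℤ_[l])‖ := by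
      by_contra hlt
      apply h1
      have := PadicInt.norm_int_le_pow_iff_dvd (p := l) (k := (derivative F).eval x) (n := k + 1)
      refine this.1 ?_
      rw [PadicInt.norm_le_pow_iff_norm_lt_pow_add_one]
      push_cast
      simpa using hlt
    calc _ ≤ _ := a0
      _ < ((l : ℝ) ^ (-(k : ℤ))) ^ 2 := by
        rw [← zpow_natCast, ← zpow_mul]
        exact zpow_lt_zpow_right₀ hl (by push_cast; linarith)
      _ ≤ _ := by gcongr
  obtain ⟨z, hz, -⟩ := hensels_lemma hF
  refine ⟨z, ?_⟩
  have := aeval_algebraMap_apply ℚ_[l] z F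
  rw [hz] at this
  simpa using this

open Polynomial in
/-- Hensel's lemma at a simple root modulo a prime. -/
lemma exists_padic_root_of_simple {l : ℕ} [Fact l.Prime] (F : ℤ[X]) (x : ℤ)
    (h0 : ((F.eval x : ℤ) : ZMod l) = 0)
    (h1 : (((derivative F).eval x : ℤ) : ZMod l) ≠ 0) :
    ∃ z : ℚ_[l], aeval z F = 0 :=
  exists_padic_root F x 0 (by simpa using (ZMod.intCast_zmod_eq_zero_iff_dvd _ _).1 h0)
    (fun h => h1 ((ZMod.intCast_zmod_eq_zero_iff_dvd _ _).2 (by simpa using h)))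

lemma ZMod.three_ne_zero {l : ℕ} [Fact l.Prime] (hl : l ≠ 3) : (3 : ZMod l) ≠ 0 := by
  intro h
  have hl3 : l ∣ 3 := (ZMod.natCast_eq_zero_iff 3 l).1 (by exact_mod_cast h)
  exact hl ((Nat.prime_dvd_prime_iff_eq Fact.out Nat.prime_three).1 hl3)

/-- Modulo a prime `3t + 2`, the map `x ↦ x ^ (2t+1)` inverts cubing. -/
lemma ZMod.pow_three_pow_eq_self {l : ℕ} [Fact l.Prime] {t : ℕ} (ht : l = 3 * t + 2) (x : ZMod l) :
    (x ^ 3) ^ (2 * t + 1) = x := by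
  rcases eq_or_ne x 0 with rfl | hx
  · simp
  have h := ZMod.pow_card_sub_one_eq_one hx
  have e : l - 1 = 3 * t + 1 := by omega
  rw [e] at h
  calc (x ^ 3) ^ (2 * t + 1) = (x ^ (3 * t + 1)) ^ 2 * x := by ring
    _ = x := by rw [h]; ring

lemma exists_padic_cube_root {l : ℕ} [Fact l.Prime] (hl : l % 3 = 2) {a : ℤ}
    (ha : ¬ (l : ℤ) ∣ a) : ∃ z : ℚ_[l], z ^ 3 = a := by
  have ha' : (a : ZMod l) ≠ 0 := fun h => ha ((ZMod.intCast_zmod_eq_zero_iff_dvd _ _).1 h)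
  obtain ⟨t, ht⟩ : ∃ t, l = 3 * t + 2 := ⟨l / 3, by omega⟩
  have h3 : (3 : ZMod l) ≠ 0 := ZMod.three_ne_zero (by omega)
  obtain ⟨z, hz⟩ := exists_padic_root_of_simple (l := l)
    (Polynomial.X ^ 3 - Polynomial.C a) (a ^ (2 * t + 1))
    (by
      have := ZMod.pow_three_pow_eq_self ht (a : ZMod l)
      simp only [Polynomial.eval_sub, Polynomial.eval_pow, Polynomial.eval_X, Polynomial.eval_C]
      push_cast
      rw [← pow_mul, mul_comm, pow_mul, this, sub_self])
    (by simp [h3, ha'])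
  exact ⟨z, by simpa [sub_eq_zero] using hz⟩

lemma exists_padic_omega {l : ℕ} [Fact l.Prime] (hl : l % 3 = 1) :
    ∃ w : ℚ_[l], w ^ 2 + w + 1 = 0 := by
  have : Fact (Nat.Prime 3) := ⟨Nat.prime_three⟩
  obtain ⟨u, hu⟩ := exists_prime_orderOf_dvd_card (G := (ZMod l)ˣ) 3 (by
    rw [ZMod.card_units l]; omega)
  have h3 : (3 : ZMod l) ≠ 0 := ZMod.three_ne_zero (by omega)
  have hu1 : (u : ZMod l) ≠ 1 := by
    intro h
    rw [Units.val_eq_one] at h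
    simp [h] at hu
  have hu3 : (u : ZMod l) ^ 3 = 1 := by
    rw [← Units.val_pow_eq_pow_val, ← hu, pow_orderOf_eq_one, Units.val_one]
  have huq : (u : ZMod l) ^ 2 + u + 1 = 0 :=
    (mul_eq_zero.1 (by linear_combination hu3 :
      ((u : ZMod l) - 1) * ((u : ZMod l) ^ 2 + u + 1) = 0)).resolve_left (sub_ne_zero.2 hu1)
  obtain ⟨k, hk⟩ := ZMod.intCast_surjective (u : ZMod l)
  obtain ⟨z, hz⟩ := exists_padic_root_of_simple (l := l)
    (Polynomial.X ^ 2 + Polynomial.X + 1) k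
    (by simpa [hk] using huq)
    (by
      simp only [Polynomial.derivative_add, Polynomial.derivative_X_pow, Polynomial.derivative_X,
        Polynomial.derivative_one]
      simp only [Polynomial.eval_add, Polynomial.eval_mul, Polynomial.eval_pow, Polynomial.eval_X,
        Polynomial.eval_C, Polynomial.eval_one, Polynomial.eval_zero]
      push_cast
      rw [hk]
      intro h
      norm_num at h
      exact h3 (by linear_combination 4 * huq - (2 * (u : ZMod l) + 1) * h))
  exact ⟨z, by simpa using hz⟩

/-- If `u² + uv + v² ≡ 0` modulo a prime `l ≡ 2 (mod 3)`, then `u ≡ v ≡ 0`. -/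
lemma dvd_of_dvd_sq_add_mul_add_sq {l : ℕ} (hp : l.Prime) (hl : l % 3 = 2) {u v : ℤ}
    (h : (l : ℤ) ∣ u ^ 2 + u * v + v ^ 2) : (l : ℤ) ∣ u ∧ (l : ℤ) ∣ v := by
  have : Fact l.Prime := ⟨hp⟩
  obtain ⟨t, ht⟩ : ∃ t, l = 3 * t + 2 := ⟨l / 3, by omega⟩
  have h3 : (3 : ZMod l) ≠ 0 := ZMod.three_ne_zero (by omega)
  simp only [← ZMod.intCast_zmod_eq_zero_iff_dvd] at h ⊢
  push_cast at h
  have hc : (u : ZMod l) ^ 3 = (v : ZMod l) ^ 3 := by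
    linear_combination ((u : ZMod l) - v) * h
  have huv : (u : ZMod l) = v := by
    rw [← ZMod.pow_three_pow_eq_self ht (u : ZMod l), hc, ZMod.pow_three_pow_eq_self ht]
  have hu : (v : ZMod l) = 0 := by
    have : 3 * (v : ZMod l) ^ 2 = 0 := by rw [huv] at h; linear_combination h
    simpa [h3] using this
  exact ⟨huv.trans hu, hu⟩

open Polynomial in
lemma eval_zero_prod_quadratic {K : Type*} [Field K] {m : ℕ} (b c : Fin m → K)
    (hb : ∀ j, b j ≠ 0) (s : Finset (Fin m)) :
    (∏ j ∈ s, (C (b j ^ 2) + C (b j * c j) * X + C (c j ^ 2) * X ^ 2)).eval 0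
        = ∏ j ∈ s, b j ^ 2 ∧
      (derivative (∏ j ∈ s, (C (b j ^ 2) + C (b j * c j) * X + C (c j ^ 2) * X ^ 2))).eval 0
        = (∏ j ∈ s, b j ^ 2) * ∑ j ∈ s, (b j)⁻¹ * c j := by
  classical
  induction s using Finset.induction_on with
  | empty => simp
  | insert i s hi ih =>
    rw [Finset.prod_insert hi, Finset.prod_insert hi, Finset.sum_insert hi, derivative_mul,
      eval_add, eval_mul, eval_mul, eval_mul, ih.1, ih.2]
    have := hb i
    refine ⟨by simp, ?_⟩
    simp [-map_pow, -map_mul]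
    field_simp

open Polynomial in
/-- Solvability over `ℚ_l` by deforming the point `(1 : 0 : 1)` modulo `l`. -/
lemma exists_padic_eqnHolds {l : ℕ} [Fact l.Prime] (a L : ℤ) (n : ℕ) {m : ℕ} (b c : Fin m → ℤ)
    (hL : (L : ZMod l) = ∏ j, (b j : ZMod l) ^ 2) (hb : (∏ j, (b j : ZMod l) ^ 2) ≠ 0)
    (hs : (∑ j, (b j : ZMod l)⁻¹ * (c j : ZMod l)) ≠ 0) :
    ∃ X Y Z : ℚ_[l], (X, Y, Z) ≠ (0, 0, 0) ∧ EqnHolds a L n b c X Y Z := by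
  have hb' : ∀ j, (b j : ZMod l) ≠ 0 := fun j h =>
    hb (Finset.prod_eq_zero (Finset.mem_univ j) (by simp [h]))
  have key := eval_zero_prod_quadratic (fun j => (b j : ZMod l)) (fun j => (c j : ZMod l)) hb'
    Finset.univ
  set G : ℤ[X] := ∏ j, (C (b j ^ 2) + C (b j * c j) * X + C (c j ^ 2) * X ^ 2) with hG
  have hmap : G.map (Int.castRingHom (ZMod l)) = ∏ j, (C ((b j : ZMod l) ^ 2)
      + C ((b j : ZMod l) * (c j : ZMod l)) * X + C ((c j : ZMod l) ^ 2) * X ^ 2) := by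
    simp [hG, Polynomial.map_prod]
  have hev (H : ℤ[X]) : ((H.eval 0 : ℤ) : ZMod l)
      = (H.map (Int.castRingHom (ZMod l))).eval 0 := by
    simp
  have k1 : ((G.eval 0 : ℤ) : ZMod l) = ∏ j, (b j : ZMod l) ^ 2 := by
    rw [hev, hmap, key.1]
  have k2 : (((derivative G).eval 0 : ℤ) : ZMod l)
      = (∏ j, (b j : ZMod l) ^ 2) * ∑ j, (b j : ZMod l)⁻¹ * c j := by
    rw [hev, ← derivative_map, hmap, key.2]
  obtain ⟨z, hz⟩ := exists_padic_root_of_simple (l := l) ((1 + C a * X ^ 3) * G - C L) 0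
    (by simp [k1, hL]) (by simp [k2, hb, hs])
  refine ⟨1, z, 1, by simp, ?_⟩
  unfold EqnHolds
  simp [hG, map_prod] at hz
  rw [sub_eq_zero] at hz
  simp only [one_pow, mul_one]
  rw [← hz]

lemma eqnHolds_of_cube {K : Type} [Field K] (a L : ℤ) {n : ℕ} (hn : n ≠ 0) {m : ℕ}
    (b c : Fin m → ℤ) (z : K) (hz : z ^ 3 = a) : EqnHolds a L n b c (-z) 1 0 := by
  unfold EqnHolds
  have : (-z) ^ 3 + (a : K) * 1 ^ 3 = 0 := by rw [← hz]; ring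
  rw [this, zero_pow hn]
  ring

lemma exists_padic_eqnHolds_of_mod_three_eq_one {l : ℕ} [Fact l.Prime] (hl : l % 3 = 1)
    (a L : ℤ) {n : ℕ} (hn : n ≠ 0) {m : ℕ} (b c : Fin m → ℤ) (j : Fin m)
    (hbc : b j ≠ 0 ∨ c j ≠ 0) :
    ∃ X Y Z : ℚ_[l], (X, Y, Z) ≠ (0, 0, 0) ∧ EqnHolds a L n b c X Y Z := by
  obtain ⟨w, hw⟩ := exists_padic_omega hl
  have hw0 : w ≠ 0 := by rintro rfl; simp at hw
  refine ⟨w * c j, b j, 0, ?_, ?_⟩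
  · rcases hbc with h | h <;> simp [h, hw0]
  · unfold EqnHolds
    rw [Finset.prod_eq_zero (Finset.mem_univ j), zero_pow hn]
    · ring
    · linear_combination (b j : ℚ_[l]) ^ 2 * (c j : ℚ_[l]) ^ 2 * hw

open Polynomial in
lemma exists_two_adic_eqnHolds [Fact (Nat.Prime 2)] (a L : ℤ) {n : ℕ} (hn : Odd n) {m : ℕ}
    (b c : Fin m → ℤ) (hL : (L : ZMod 2) = ∏ j, (b j : ZMod 2) ^ 2)
    (hb : (∏ j, (b j : ZMod 2) ^ 2) = 1) :
    ∃ X Y Z : ℚ_[2], (X, Y, Z) ≠ (0, 0, 0) ∧ EqnHolds a L n b c X Y Z := by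
  obtain ⟨B, hB⟩ : ∃ B : ℤ, B = ∏ j, b j ^ 2 := ⟨_, rfl⟩
  have hB' : (B : ZMod 2) = 1 := by rw [← hb, hB]; push_cast; rfl
  have hL' : (L : ZMod 2) = 1 := hL.trans hb
  have hn' : (n : ZMod 2) = 1 := ZMod.natCast_eq_one_iff_odd.2 hn
  obtain ⟨z, hz⟩ := exists_padic_root_of_simple (l := 2)
    (C L * X ^ n - C B) 1 (by simp [hL', hB']) (by simp [derivative_X_pow, hL', hn'])
  refine ⟨1, 0, z, by simp, ?_⟩
  unfold EqnHolds
  simp [sub_eq_zero, hB] at hz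
  simp [hz]

open Polynomial in
lemma exists_three_adic_cube_root [Fact (Nat.Prime 3)] {P : ℕ} (hP : P % 9 = 1 ∨ P % 9 = 8)
    (k : ℕ) : ∃ z : ℚ_[3], z ^ 3 = (((P : ℤ) ^ k : ℤ) : ℚ_[3]) := by
  obtain ⟨x, hx, hx3⟩ : ∃ x : ℤ, (27 : ℤ) ∣ x ^ 3 - P ∧ ¬ (3 : ℤ) ∣ x := by
    have : P % 27 = 1 ∨ P % 27 = 10 ∨ P % 27 = 19 ∨ P % 27 = 8 ∨ P % 27 = 17 ∨ P % 27 = 26 := by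
      omega
    rcases this with h | h | h | h | h | h
    · exact ⟨1, by omega, by omega⟩
    · exact ⟨4, by omega, by omega⟩
    · exact ⟨7, by omega, by omega⟩
    · exact ⟨2, by omega, by omega⟩
    · exact ⟨-4, by omega, by omega⟩
    · exact ⟨-1, by omega, by omega⟩
  obtain ⟨a, ha⟩ : ∃ a : ℤ, a = (P : ℤ) ^ k := ⟨_, rfl⟩
  have hp3 : Prime (3 : ℤ) := Int.prime_three
  obtain ⟨z, hz⟩ := exists_padic_root (l := 3) (X ^ 3 - C a) (x ^ k) 1
    (by
      have := hx.trans (sub_dvd_pow_sub_pow (x ^ 3) (P : ℤ) k)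
      rw [← pow_mul, mul_comm, pow_mul] at this
      simpa [ha] using this)
    (by
      intro h
      have h' : (9 : ℤ) ∣ 3 * (x ^ k) ^ 2 := by simpa using h
      have : (3 : ℤ) ∣ (x ^ k) ^ 2 := by omega
      exact hx3 (hp3.dvd_of_dvd_pow (hp3.dvd_of_dvd_pow this)))
  refine ⟨z, ?_⟩
  simpa [sub_eq_zero, ha] using hz

/-- Homogeneity of the equation. -/
lemma eqnHolds_smul {K : Type} [Field K] {a L : ℤ} {m : ℕ} {b c : Fin m → ℤ} {r X Y Z : K}
    (hr : r ≠ 0) (h : EqnHolds a L (2 * m + 3) b c (r * X) (r * Y) (r * Z)) :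
    EqnHolds a L (2 * m + 3) b c X Y Z := by
  unfold EqnHolds at *
  have e : ∏ j : Fin m, ((b j : K) ^ 2 * (r * X) ^ 2 + (b j : K) * (c j : K) * (r * X) * (r * Y)
        + (c j : K) ^ 2 * (r * Y) ^ 2) = (r ^ 2) ^ m *
      ∏ j : Fin m, ((b j : K) ^ 2 * X ^ 2 + (b j : K) * (c j : K) * X * Y
        + (c j : K) ^ 2 * Y ^ 2) := by
    rw [show (r ^ 2) ^ m = ∏ _j : Fin m, r ^ 2 by simp, ← Finset.prod_mul_distrib]
    exact Finset.prod_congr rfl fun j _ => by ring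
  rw [e] at h
  apply mul_left_cancel₀ (pow_ne_zero (2 * m + 3) hr)
  linear_combination h

/-- A rational number `t` with `L t^n` integral is integral when `L` is `n`-th power free. -/
lemma exists_int_of_mul_pow_eq {L N : ℤ} {n : ℕ}
    (hL : ∀ l : ℕ, l.Prime → ¬ (l : ℤ) ^ n ∣ L) {t : ℚ} (h : (L : ℚ) * t ^ n = N) :
    ∃ z : ℤ, t = z := by
  have hd : (t.den : ℚ) ≠ 0 := by exact_mod_cast t.den_ne_zero
  have e : L * t.num ^ n = N * (t.den : ℤ) ^ n := by
    have : (L : ℚ) * t.num ^ n = N * (t.den : ℚ) ^ n := by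
      rw [← h, mul_assoc, ← mul_pow, Rat.mul_den_eq_num]
    exact_mod_cast this
  have hdvd : (t.den : ℤ) ^ n ∣ L := by
    have hc : IsCoprime (t.den : ℤ) t.num := by
      rw [Int.isCoprime_iff_nat_coprime]
      simpa using t.reduced.symm
    exact (hc.pow (m := n) (n := n)).dvd_of_dvd_mul_right (e ▸ dvd_mul_left _ _)
  have h1 : t.den = 1 := by
    by_contra hne
    obtain ⟨l, hl, hld⟩ := Nat.exists_prime_and_dvd hne
    exact hL l hl ((pow_dvd_pow_of_dvd (by exact_mod_cast hld) n).trans hdvd)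
  exact ⟨t.num, by rw [← Rat.num_div_den t, h1]; simp⟩

/-- A rational point with `(X, Y) ≠ (0, 0)` yields an integral point with coprime `X`, `Y`. -/
lemma exists_coprime_int_eqnHolds {a L : ℤ} {m : ℕ} {b c : Fin m → ℤ}
    (hL : ∀ l : ℕ, l.Prime → ¬ (l : ℤ) ^ (2 * m + 3) ∣ L) {X Y Z : ℚ}
    (hXY : X ≠ 0 ∨ Y ≠ 0) (h : EqnHolds a L (2 * m + 3) b c X Y Z) :
    ∃ x y z : ℤ, IsCoprime x y ∧ EqnHolds a L (2 * m + 3) b c x y z := by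
  obtain ⟨r, x, y, hr, hc, hx, hy⟩ : ∃ (r : ℚ) (x y : ℤ), r ≠ 0 ∧ IsCoprime x y ∧
      X = r * x ∧ Y = r * y := by
    by_cases hY : Y = 0
    · exact ⟨X, 1, 0, hXY.resolve_right (by simp [hY]), isCoprime_one_left, by simp, by simp [hY]⟩
    · have hd : ((X / Y).den : ℚ) ≠ 0 := by exact_mod_cast (X / Y).den_ne_zero
      refine ⟨Y / (X / Y).den, (X / Y).num, (X / Y).den, div_ne_zero hY hd, ?_, ?_, ?_⟩
      · rw [Int.isCoprime_iff_nat_coprime]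
        simpa using (X / Y).reduced
      · rw [← Rat.mul_den_eq_num]
        field_simp
      · push_cast
        field_simp
  have h' : EqnHolds a L (2 * m + 3) b c (x : ℚ) (y : ℚ) (Z / r) := by
    apply eqnHolds_smul hr
    rwa [← hx, ← hy, mul_div_cancel₀ _ hr]
  unfold EqnHolds at h'
  obtain ⟨z, hz⟩ := exists_int_of_mul_pow_eq hL (N := (x ^ 3 + a * y ^ 3) *
      ∏ j : Fin m, (b j ^ 2 * x ^ 2 + b j * c j * x * y + c j ^ 2 * y ^ 2))
    (by push_cast; exact h'.symm)
  refine ⟨x, y, z, hc, ?_⟩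
  rw [hz] at h'
  unfold EqnHolds
  exact_mod_cast h'

lemma Int.isCoprime_of_natPrime_dvd {u v : ℤ}
    (h : ∀ l : ℕ, l.Prime → (l : ℤ) ∣ u → (l : ℤ) ∣ v → False) : IsCoprime u v := by
  rw [Int.isCoprime_iff_gcd_eq_one]
  by_contra hne
  obtain ⟨l, hl, hld⟩ := Nat.exists_prime_and_dvd hne
  have hld' : (l : ℤ) ∣ (u.gcd v : ℤ) := by exact_mod_cast hld
  exact h l hl (hld'.trans (Int.gcd_dvd_left _ _)) (hld'.trans (Int.gcd_dvd_right _ _))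

/-- Each quadratic factor takes values coprime to `x³ + a y³`. -/
lemma isCoprime_cubic_quadratic {a b c x y : ℤ} {q : ℕ} (hq : q.Prime) (hq3 : q % 3 = 2)
    (hqa : ¬ (q : ℤ) ∣ a) (hqe : (q : ℤ) = a * b ^ 3 + c ^ 3) (hxy : IsCoprime x y) :
    IsCoprime (x ^ 3 + a * y ^ 3) (b ^ 2 * x ^ 2 + b * c * x * y + c ^ 2 * y ^ 2) := by
  have hqp : Prime (q : ℤ) := Nat.prime_iff_prime_int.1 hq
  have hnot (u : ℤ) (h : (q : ℤ) = (q : ℤ) ^ 3 * u) : False := by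
    have h1 : (q : ℤ) * ((q : ℤ) * u) = 1 := by
      apply mul_left_cancel₀ hqp.ne_zero
      linear_combination -h
    exact hqp.not_isUnit (IsUnit.of_mul_eq_one _ h1)
  have hbc : (q : ℤ) ∣ b → (q : ℤ) ∣ c → False := by
    rintro ⟨b', rfl⟩ ⟨c', rfl⟩
    exact hnot (a * b' ^ 3 + c' ^ 3) (by linear_combination hqe)
  have hb : ¬ (q : ℤ) ∣ b := fun h => hbc h <| hqp.dvd_of_dvd_pow (n := 3) <| by
    rw [show c ^ 3 = (q : ℤ) - a * b ^ 3 by linear_combination -hqe]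
    exact dvd_sub dvd_rfl ((dvd_pow h (by norm_num)).mul_left a)
  have hc : ¬ (q : ℤ) ∣ c := fun h => by
    have : (q : ℤ) ∣ a * b ^ 3 := by
      rw [show a * b ^ 3 = (q : ℤ) - c ^ 3 by linear_combination -hqe]
      exact dvd_sub dvd_rfl (dvd_pow h (by norm_num))
    rcases hqp.dvd_or_dvd this with h' | h'
    · exact hqa h'
    · exact hb (hqp.dvd_of_dvd_pow h')
  have hxy' {l : ℤ} (hl : Prime l) (hx : l ∣ x) (hy : l ∣ y) : False :=
    hl.not_isUnit (hxy.isUnit_of_dvd' hx hy)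
  refine Int.isCoprime_of_natPrime_dvd fun l hl h1 h2 => ?_
  have hlp : Prime (l : ℤ) := Nat.prime_iff_prime_int.1 hl
  by_cases hlq : l = q
  · subst hlq
    obtain ⟨hu, hv⟩ := dvd_of_dvd_sq_add_mul_add_sq hq hq3 (u := b * x) (v := c * y)
      (by convert h2 using 1; ring)
    exact hxy' hlp ((hlp.dvd_or_dvd hu).resolve_left hb) ((hlp.dvd_or_dvd hv).resolve_left hc)
  · have hlq' : ¬ (l : ℤ) ∣ q := fun h =>
      hlq ((Nat.prime_dvd_prime_iff_eq hl hq).1 (by exact_mod_cast h))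
    have hy : (l : ℤ) ∣ q * y ^ 3 := by
      rw [show (q : ℤ) * y ^ 3 = (x ^ 3 + a * y ^ 3) * b ^ 3
        - (b ^ 2 * x ^ 2 + b * c * x * y + c ^ 2 * y ^ 2) * (b * x - c * y) by
          rw [hqe]; ring]
      exact dvd_sub (h1.mul_right _) (h2.mul_right _)
    have hx : (l : ℤ) ∣ q * x ^ 3 := by
      rw [show (q : ℤ) * x ^ 3 = (x ^ 3 + a * y ^ 3) * c ^ 3
        + (b ^ 2 * x ^ 2 + b * c * x * y + c ^ 2 * y ^ 2) * (a * (b * x - c * y)) by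
          rw [hqe]; ring]
      exact dvd_add (h1.mul_right _) (h2.mul_right _)
    exact hxy' hlp (hlp.dvd_of_dvd_pow ((hlp.dvd_or_dvd hx).resolve_left hlq'))
      (hlp.dvd_of_dvd_pow ((hlp.dvd_or_dvd hy).resolve_left hlq'))

/-- Each quadratic factor takes values coprime to `L`. -/
lemma isCoprime_quadratic_of_prime_mod_three {L b c x y : ℤ}
    (hL : ∀ l : ℕ, l.Prime → (l : ℤ) ∣ L → l % 3 = 2) (hbc : IsCoprime L (b * c))
    (hxy : IsCoprime x y) :
    IsCoprime L (b ^ 2 * x ^ 2 + b * c * x * y + c ^ 2 * y ^ 2) := by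
  refine Int.isCoprime_of_natPrime_dvd fun l hl h1 h2 => ?_
  have hlp : Prime (l : ℤ) := Nat.prime_iff_prime_int.1 hl
  obtain ⟨hu, hv⟩ := dvd_of_dvd_sq_add_mul_add_sq hl (hL l hl h1) (u := b * x) (v := c * y)
    (by convert h2 using 1; ring)
  have hlbc : ¬ (l : ℤ) ∣ b * c := fun h => hlp.not_isUnit (hbc.isUnit_of_dvd' h1 h)
  exact hlp.not_isUnit (hxy.isUnit_of_dvd'
    ((hlp.dvd_or_dvd hu).resolve_left fun h => hlbc (h.mul_right c))
    ((hlp.dvd_or_dvd hv).resolve_left fun h => hlbc (h.mul_left b)))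

/-- Coprimality of the factors splits an integral point of the product equation into an integral
point of the cubic equation. -/
lemma exists_mul_pow_of_coprime {L A B z : ℤ} {n : ℕ} (hn : Odd n) (hL : L ≠ 0)
    (hAB : IsCoprime A B) (hLB : IsCoprime L B) (h : A * B = L * z ^ n) :
    ∃ w : ℤ, A = L * w ^ n := by
  obtain ⟨A', rfl⟩ : L ∣ A := hLB.dvd_of_dvd_mul_right (h ▸ dvd_mul_right L (z ^ n))
  obtain ⟨w, hw⟩ := Int.eq_pow_of_mul_eq_pow_odd_left (a := A') (b := B) (c := z)
    hAB.of_mul_left_right hn (mul_left_cancel₀ hL (by rw [← mul_assoc, h]))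
  exact ⟨w, by rw [hw]⟩

/-- The absence of nontrivial rational points. -/
lemma eqnHolds_rat_trivial {a L : ℤ} {m : ℕ} {b c : Fin m → ℤ}
    (hbc : ∀ j, ∃ q : ℕ, q.Prime ∧ q % 3 = 2 ∧ ¬ (q : ℤ) ∣ a ∧ (q : ℤ) = a * b j ^ 3 + c j ^ 3)
    (hL : ∀ l : ℕ, l.Prime → (l : ℤ) ∣ L → l % 3 = 2 ∧ ¬ (l : ℤ) ^ (2 * m + 3) ∣ L)
    (hLbc : ∀ j, IsCoprime L (b j * c j))
    (hcub : ∀ x y z : ℤ, IsCoprime x y → x ^ 3 + a * y ^ 3 ≠ L * z ^ (2 * m + 3))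
    {X Y Z : ℚ} (h : EqnHolds a L (2 * m + 3) b c X Y Z) : (X, Y, Z) = (0, 0, 0) := by
  have hL0 : L ≠ 0 := by
    rintro rfl
    have := (hL 3 Nat.prime_three (dvd_zero _)).1
    omega
  by_cases hXY : X ≠ 0 ∨ Y ≠ 0
  · exfalso
    obtain ⟨x, y, z, hxy, hz⟩ := exists_coprime_int_eqnHolds
      (fun l hl hd => (hL l hl ((dvd_pow_self _ (by omega)).trans hd)).2 hd) hXY h
    obtain ⟨w, hw⟩ := exists_mul_pow_of_coprime (n := 2 * m + 3) ⟨m + 1, by ring⟩ hL0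
      (IsCoprime.prod_right fun j _ => by
        obtain ⟨q, hq, hq3, hqa, hqe⟩ := hbc j
        exact isCoprime_cubic_quadratic hq hq3 hqa hqe hxy)
      (IsCoprime.prod_right fun j _ => isCoprime_quadratic_of_prime_mod_three
        (fun l hl hd => (hL l hl hd).1) (hLbc j) hxy)
      hz
    exact hcub x y w hxy hw
  · push Not at hXY
    obtain ⟨rfl, rfl⟩ := hXY
    unfold EqnHolds at h
    have hLq : (L : ℚ) ≠ 0 := by exact_mod_cast hL0
    have : (L : ℚ) * Z ^ (2 * m + 3) = 0 := by rw [← h]; ring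
    simp [hLq] at this
    simp [this]

/-- **Proposition 2.1**: the recipe for odd-degree counterexamples to the
local-global principle. -/
theorem recipe_odd
    (n : ℕ) (hn5 : 5 ≤ n) (hnodd : Odd n)
    (p : ℕ) (hp : p.Prime) (hpodd : Odd p)
    (P : ℕ) (hP : P = p ∨ P = 2 * p)
    (ι : ℕ) (hι : ι = 1 ∨ ι = 2)
    (b c : Fin ((n - 3) / 2) → ℤ) (L : ℤ)
    -- (1) `P^ι b_j³ + c_j³ ≡ 2 (mod 3)` is a prime number not dividing `P`
    (h1 : ∀ j, ∃ q : ℕ, q.Prime ∧ q % 3 = 2 ∧ ¬ q ∣ P ∧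
      (q : ℤ) = (P : ℤ) ^ ι * b j ^ 3 + c j ^ 3)
    -- (2) `L = ∏_{l ≡ 2 (mod 3)} l^{v_l(L)}` with `v_l(L) < n`
    (h2 : ∀ l : ℕ, l.Prime → (l : ℤ) ∣ L → l % 3 = 2 ∧ ¬ (l : ℤ) ^ n ∣ L)
    -- (3) `gcd(L, b_j c_j) = 1`
    (h3 : ∀ j, IsCoprime L (b j * c j))
    -- (4) if `P` is even then `L ≡ ∏_j b_j² ≡ 1 (mod 2)`
    (h4 : 2 ∣ P → (L : ZMod 2) = ∏ j, (b j : ZMod 2) ^ 2 ∧ (∏ j, (b j : ZMod 2) ^ 2) = 1)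
    -- (5) if `P ≢ ±1 (mod 9)` then `L ≡ ∏_j b_j² ≢ 0 (mod 3)` and `∑_j b_j⁻¹ c_j ≢ 0 (mod 3)`
    (h5 : ¬ (P % 9 = 1 ∨ P % 9 = 8) →
      (L : ZMod 3) = ∏ j, (b j : ZMod 3) ^ 2 ∧ (∏ j, (b j : ZMod 3) ^ 2) ≠ 0 ∧
      (∑ j, (b j : ZMod 3)⁻¹ * (c j : ZMod 3)) ≠ 0)
    -- (6) if `p ≡ 2 (mod 3)` then `L ≡ ∏_j b_j² ≢ 0 (mod p)` and `∑_j b_j⁻¹ c_j ≢ 0 (mod p)`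
    (h6 : p % 3 = 2 →
      (L : ZMod p) = ∏ j, (b j : ZMod p) ^ 2 ∧ (∏ j, (b j : ZMod p) ^ 2) ≠ 0 ∧
      (∑ j, (b j : ZMod p)⁻¹ * (c j : ZMod p)) ≠ 0)
    -- (7) every primitive solution of `x³ + P^ι y³ = L z^n` has `x ≡ y ≡ 0 (mod l)`
    --     for some prime divisor `l` of `L`
    (h7 : ∀ x y z : ℤ, Int.gcd x (Int.gcd y z) = 1 →
      x ^ 3 + (P : ℤ) ^ ι * y ^ 3 = L * z ^ n →
      ∃ l : ℕ, l.Prime ∧ (l : ℤ) ∣ L ∧ (l : ℤ) ∣ x ∧ (l : ℤ) ∣ y) :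
    ViolatesLGP ((P : ℤ) ^ ι) L n b c := by
  have hn0 : n ≠ 0 := by omega
  refine ⟨?_, ?_, ?_⟩
  · obtain ⟨z, hz⟩ : ∃ z : ℝ, z ^ 3 = (((P : ℤ) ^ ι : ℤ) : ℝ) :=
      ⟨(((P : ℤ) ^ ι : ℤ) : ℝ) ^ ((3 : ℕ) : ℝ)⁻¹, by
        apply Real.rpow_inv_natCast_pow _ (by norm_num)
        push_cast
        positivity⟩
    exact ⟨-z, 1, 0, by simp, eqnHolds_of_cube _ L hn0 b c z hz⟩
  · intro l hl
    have hlp : l.Prime := hl.out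
    obtain hl3 | hl1 | hl2 : l % 3 = 0 ∨ l % 3 = 1 ∨ l % 3 = 2 := by omega
    · obtain rfl : l = 3 :=
        ((Nat.prime_dvd_prime_iff_eq Nat.prime_three hlp).1 (Nat.dvd_of_mod_eq_zero hl3)).symm
      by_cases hP9 : P % 9 = 1 ∨ P % 9 = 8
      · obtain ⟨z, hz⟩ := exists_three_adic_cube_root hP9 ι
        exact ⟨-z, 1, 0, by simp, eqnHolds_of_cube _ L hn0 b c z hz⟩
      · obtain ⟨hLb, hb, hs⟩ := h5 hP9
        exact exists_padic_eqnHolds _ L n b c hLb hb hs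
    · have j : Fin ((n - 3) / 2) := ⟨0, by omega⟩
      refine exists_padic_eqnHolds_of_mod_three_eq_one hl1 _ L hn0 b c j ?_
      obtain ⟨q, hq, -, -, hqe⟩ := h1 j
      by_contra! hbc
      have := hq.ne_zero
      simp [hbc.1, hbc.2] at hqe
      omega
    · by_cases hlP : l ∣ P
      · obtain rfl | rfl : l = 2 ∨ l = p := by
          rcases hP with rfl | rfl
          · exact .inr ((Nat.prime_dvd_prime_iff_eq hlp hp).1 hlP)
          · exact ((Nat.Prime.dvd_mul hlp).1 hlP).imp
              (Nat.prime_dvd_prime_iff_eq hlp Nat.prime_two).1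
              (Nat.prime_dvd_prime_iff_eq hlp hp).1
        · obtain ⟨hLb, hb⟩ := h4 hlP
          exact exists_two_adic_eqnHolds _ L hnodd b c hLb hb
        · obtain ⟨hLb, hb, hs⟩ := h6 hl2
          exact exists_padic_eqnHolds _ L n b c hLb hb hs
      · obtain ⟨z, hz⟩ := exists_padic_cube_root hl2 (a := (P : ℤ) ^ ι) (fun h => hlP (by
          exact_mod_cast (Nat.prime_iff_prime_int.1 hlp).dvd_of_dvd_pow h))
        exact ⟨-z, 1, 0, by simp, eqnHolds_of_cube _ L hn0 b c z hz⟩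
  · intro X Y Z h
    have hn : n = 2 * ((n - 3) / 2) + 3 := by
      obtain ⟨k, rfl⟩ := hnodd
      omega
    refine eqnHolds_rat_trivial (fun j => ?_) (by rwa [← hn]) h3 (fun x y z hxy hxyz => ?_)
      (by rwa [← hn])
    · obtain ⟨q, hq, hq3, hqP, hqe⟩ := h1 j
      exact ⟨q, hq, hq3, fun h => hqP (by
        exact_mod_cast (Nat.prime_iff_prime_int.1 hq).dvd_of_dvd_pow h), hqe⟩
    · rw [← hn] at hxyz
      obtain ⟨l, hl, -, hx, hy⟩ := h7 x y z (by
        rw [← Int.gcd_assoc, Int.isCoprime_iff_gcd_eq_one.1 hxy]; simp) hxyz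
      exact (Nat.prime_iff_prime_int.1 hl).not_isUnit (hxy.isUnit_of_dvd' hx hy)
end

section
/- For every prime number p, the class number of the number field ℚ(p^{1/3}) is strictly smaller than p. -/
section

open MeasureTheory NumberField
open scoped ENNReal

/-- Cauchy–Schwarz for the Lebesgue integral on a set. -/
lemma sq_setLIntegral_le {E : Type*} [MeasurableSpace E] {μ : Measure E} (s : Set E)
    {f : E → ℝ≥0∞} (hf : AEMeasurable f (μ.restrict s)) :
    (∫⁻ x in s, f x ∂μ) ^ 2 ≤ μ s * ∫⁻ x in s, f x ^ 2 ∂μ := by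
  have h := ENNReal.lintegral_mul_le_Lp_mul_Lq (μ.restrict s) Real.HolderConjugate.two_two
    (aemeasurable_const (b := (1 : ℝ≥0∞))) hf
  simp only [Pi.mul_apply, one_mul, ENNReal.one_rpow, lintegral_const, MeasurableSet.univ,
    Measure.restrict_apply, Set.univ_inter] at h
  calc _ ≤ _ := pow_le_pow_left' h 2
    _ = _ := by
      rw [mul_pow, ← ENNReal.rpow_natCast, ← ENNReal.rpow_natCast, ← ENNReal.rpow_mul,
        ← ENNReal.rpow_mul]
      norm_num

/-- Siegel's inequality: a lower bound for lattice sums of autocorrelations. -/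
lemma sq_lintegral_le_covolume_mul_tsum {E : Type*} [NormedAddCommGroup E] [NormedSpace ℝ E]
    [FiniteDimensional ℝ E] [MeasurableSpace E] [BorelSpace E] (μ : Measure E)
    [μ.IsAddHaarMeasure] (L : Submodule ℤ E) [DiscreteTopology L] [IsZLattice ℝ L]
    {g : E → ℝ≥0∞} (hg : Measurable g) :
    (∫⁻ x, g x ∂μ) ^ 2 ≤
      ENNReal.ofReal (ZLattice.covolume L μ) * ∑' l : L, ∫⁻ x, g x * g ((l : E) + x) ∂μ := by
  let b := Module.Free.chooseBasis ℤ L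
  let F := ZSpan.fundamentalDomain (b.ofZLatticeBasis ℝ L)
  have : VAddInvariantMeasure L E μ := ⟨fun c s _ ↦ measure_preimage_add μ (c : E) s⟩
  have hF : IsAddFundamentalDomain L F μ := ZLattice.isAddFundamentalDomain b μ
  have hcov : ENNReal.ofReal (ZLattice.covolume L μ) = μ F := by
    rw [ZLattice.covolume_eq_measure_fundamentalDomain L μ hF, measureReal_def,
      ENNReal.ofReal_toReal]
    exact (ZSpan.fundamentalDomain_isBounded _).measure_lt_top.ne
  have : Countable L := inferInstance
  set S : E → ℝ≥0∞ := fun x ↦ ∑' l : L, g ((l : E) + x) with hS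
  have hSm : Measurable S := Measurable.tsum fun l ↦ hg.comp (measurable_const_add _)
  have h1 : ∫⁻ x, g x ∂μ = ∫⁻ x in F, S x ∂μ := by
    rw [hF.lintegral_eq_tsum'', hS, lintegral_tsum]
    · rfl
    · exact fun l ↦ (hg.comp (measurable_const_add _)).aemeasurable
  have hSinv (l : L) (x : E) : S ((l : E) + x) = S x := by
    simp only [hS]
    rw [← (Equiv.addRight l).tsum_eq (fun m : L ↦ g ((m : E) + x))]
    refine tsum_congr fun m ↦ ?_
    simp [add_assoc]
  have h2 : ∑' l : L, ∫⁻ x, g x * g ((l : E) + x) ∂μ = ∫⁻ x in F, S x ^ 2 ∂μ := by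
    have hm (l : L) : AEMeasurable (fun x ↦ g x * g ((l : E) + x)) μ :=
      (hg.mul (hg.comp (measurable_const_add _))).aemeasurable
    rw [← lintegral_tsum hm]
    simp_rw [ENNReal.tsum_mul_left]
    change ∫⁻ x, g x * S x ∂μ = _
    have hm' (l : L) : AEMeasurable (fun x ↦ g (l +ᵥ x) * S (l +ᵥ x)) (μ.restrict F) :=
      ((hg.mul hSm).comp (measurable_const_add (l : E))).aemeasurable
    rw [hF.lintegral_eq_tsum'', ← lintegral_tsum hm']
    refine lintegral_congr fun x ↦ ?_
    change ∑' l : L, g ((l : E) + x) * S ((l : E) + x) = _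
    simp_rw [hSinv, ENNReal.tsum_mul_right]
    rw [sq]
  rw [hcov, h1, h2]
  exact sq_setLIntegral_le F hSm.aemeasurable

lemma lintegral_gaussian_complex {b : ℝ} (hb : 0 < b) :
    ∫⁻ z : ℂ, ENNReal.ofReal (Real.exp (-b * ‖z‖ ^ 2)) = ENNReal.ofReal (Real.pi / b) := by
  have hi := GaussianFourier.integral_rexp_neg_mul_sq_norm (V := ℂ) hb
  simp only [Complex.finrank_real_complex] at hi
  norm_num at hi
  rw [← ofReal_integral_eq_lintegral_ofReal]
  · simp [hi]
  · by_contra h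
    have := integral_undef h
    simp only [neg_mul] at this
    rw [hi] at this
    have := div_pos Real.pi_pos hb
    linarith
  · exact Filter.Eventually.of_forall fun z ↦ (Real.exp_pos _).le

lemma lintegral_gaussian_complex_mul_shift {b : ℝ} (hb : 0 < b) (w : ℂ) :
    ∫⁻ z : ℂ, ENNReal.ofReal (Real.exp (-(2 * b) * ‖z‖ ^ 2)) *
      ENNReal.ofReal (Real.exp (-(2 * b) * ‖w + z‖ ^ 2)) =
      ENNReal.ofReal (Real.pi / (4 * b) * Real.exp (-b * ‖w‖ ^ 2)) := by
  have key (z : ℂ) : ENNReal.ofReal (Real.exp (-(2 * b) * ‖z‖ ^ 2)) *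
      ENNReal.ofReal (Real.exp (-(2 * b) * ‖w + z‖ ^ 2)) =
      ENNReal.ofReal (Real.exp (-(4 * b) * ‖w / 2 + z‖ ^ 2)) *
        ENNReal.ofReal (Real.exp (-b * ‖w‖ ^ 2)) := by
    rw [← ENNReal.ofReal_mul (Real.exp_pos _).le, ← ENNReal.ofReal_mul (Real.exp_pos _).le,
      ← Real.exp_add, ← Real.exp_add]
    congr 2
    simp only [Complex.sq_norm, Complex.normSq_apply, Complex.add_re, Complex.add_im]
    have h1 : (w / 2).re = w.re / 2 := by simp
    have h2 : (w / 2).im = w.im / 2 := by simp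
    rw [h1, h2]; ring
  simp_rw [key]
  rw [lintegral_mul_const _ (by fun_prop),
    lintegral_add_left_eq_self (fun z : ℂ ↦ ENNReal.ofReal (Real.exp (-(4 * b) * ‖z‖ ^ 2))),
    lintegral_gaussian_complex (by positivity), ← ENNReal.ofReal_mul (by positivity)]

lemma lintegral_indicator_mul_shift (a t : ℝ) :
    ∫⁻ x : ℝ, (Set.Ico 0 a).indicator 1 x * (Set.Ico 0 a).indicator (1 : ℝ → ℝ≥0∞) (t + x) =
      ENNReal.ofReal (a - |t|) := by
  have key (x : ℝ) : (Set.Ico 0 a).indicator 1 x *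
      (Set.Ico 0 a).indicator (1 : ℝ → ℝ≥0∞) (t + x) =
      (Set.Ico (max 0 (-t)) (min a (a - t))).indicator 1 x := by
    simp only [Set.indicator_apply, Set.mem_Ico, Pi.one_apply, max_le_iff, lt_min_iff]
    have e1 : -t ≤ x ↔ 0 ≤ t + x := neg_le_iff_add_nonneg'
    have e2 : x < a - t ↔ t + x < a := lt_sub_iff_add_lt'
    simp only [e1, e2]
    by_cases h1 : 0 ≤ x <;> by_cases h2 : x < a <;> by_cases h3 : 0 ≤ t + x <;>
      by_cases h4 : t + x < a <;> simp [h1, h2, h3, h4]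
  simp_rw [key]
  rw [lintegral_indicator_one measurableSet_Ico, Real.volume_Ico]
  congr 1
  rcases le_total 0 t with h | h
  · rw [abs_of_nonneg h, max_eq_left (by linarith), min_eq_right (by linarith)]; ring
  · rw [abs_of_nonpos h, max_eq_right (by linarith), min_eq_left (by linarith), sub_neg_eq_add]

lemma volume_preserving_eval_of_subsingleton {ι α : Type*} [Fintype ι] [Subsingleton ι]
    [MeasureSpace α] [SigmaFinite (volume : Measure α)] (i : ι) :
    MeasurePreserving (fun x : ι → α ↦ x i) := by
  let u : Unique ι := ⟨⟨i⟩, fun j ↦ Subsingleton.elim j i⟩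
  have h := volume_preserving_funUnique ι α
  have e : (Unique.fintype : Fintype ι) = ‹Fintype ι› := Subsingleton.elim _ _
  rw [e] at h
  exact h

lemma lintegral_prod_pi_mul {ι κ : Type*} [Fintype ι] [Fintype κ] [Subsingleton ι]
    [Subsingleton κ] (v : ι) (w : κ)
    {f : ℝ → ℝ≥0∞} {h : ℂ → ℝ≥0∞} (hf : Measurable f) (hh : Measurable h) :
    ∫⁻ x : (ι → ℝ) × (κ → ℂ), f (x.1 v) * h (x.2 w) = (∫⁻ x, f x) * ∫⁻ z, h z := by
  rw [Measure.volume_eq_prod]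
  rw [lintegral_prod_mul (f := fun x : ι → ℝ ↦ f (x v)) (g := fun x : κ → ℂ ↦ h (x w))
    (hf.comp (measurable_pi_apply _)).aemeasurable (hh.comp (measurable_pi_apply _)).aemeasurable,
    ← (volume_preserving_eval_of_subsingleton v).lintegral_comp hf,
    ← (volume_preserving_eval_of_subsingleton w).lintegral_comp hh]

end

section

open MeasureTheory NumberField NumberField.InfinitePlace
open scoped Classical ENNReal nonZeroDivisors

section

variable {K : Type*} [Field K]

variable [NumberField K] [Subsingleton {w : InfinitePlace K // w.IsReal}]
  [Subsingleton {w : InfinitePlace K // w.IsComplex}]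
  (v : {w : InfinitePlace K // w.IsReal}) (w : {w : InfinitePlace K // w.IsComplex})

lemma real_mul_complex_sq_eq_abs_norm (x : K) :
    v.1 x * w.1 x ^ 2 = |(Algebra.norm ℚ x : ℝ)| := by
  rw [← Rat.cast_abs, ← prod_eq_abs_norm, prod_eq_prod_mul_prod, Fintype.prod_subsingleton _ v,
    Fintype.prod_subsingleton _ w, mult_isReal, mult_isComplex, pow_one]

lemma real_mul_complex_sq_eq_absNorm (x : 𝓞 K) :
    v.1 (x : K) * w.1 (x : K) ^ 2 = Ideal.absNorm (Ideal.span {x}) := by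
  rw [real_mul_complex_sq_eq_abs_norm, Ideal.absNorm_span_singleton, Nat.cast_natAbs,
    ← Algebra.coe_norm_int]
  push_cast
  rfl

lemma lattice_sum_ge (J : (Ideal (𝓞 K))⁰) {A : ℝ} (hA : 0 < A) (τ : ℝ) :
    ENNReal.ofReal (2 * Real.pi * A / √|(discr K : ℝ)|) ≤
      ∑' α : (J : Ideal (𝓞 K)),
        ENNReal.ofReal (1 - v.1 ((α : 𝓞 K) : K) / (A * Ideal.absNorm (J : Ideal (𝓞 K)) * Real.exp τ)) *
        ENNReal.ofReal (Real.exp (-(Real.exp τ * w.1 ((α : 𝓞 K) : K) ^ 2))) := by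
  set N : ℝ := (Ideal.absNorm (J : Ideal (𝓞 K)) : ℝ) with hN
  have hN0 : 0 < N := by
    rw [hN]; exact_mod_cast Nat.pos_of_ne_zero (Ideal.absNorm_ne_zero_of_nonZeroDivisors J)
  set s : ℝ := Real.exp τ with hs
  have hs0 : 0 < s := Real.exp_pos τ
  have hD : (0 : ℝ) < √|(discr K : ℝ)| := by
    apply Real.sqrt_pos.2
    simp [discr_ne_zero]
  set d := √|(discr K : ℝ)| with hd
  set a : ℝ := A * N * s with ha
  have ha0 : 0 < a := by positivity
  set L := mixedEmbedding.idealLattice K (FractionalIdeal.mk0 K J) with hL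
  let f : ℝ → ℝ≥0∞ := (Set.Ico 0 a).indicator 1
  let h : ℂ → ℝ≥0∞ := fun z ↦ ENNReal.ofReal (Real.exp (-(2 * s) * ‖z‖ ^ 2))
  have hf : Measurable f := measurable_one.indicator measurableSet_Ico
  have hh : Measurable h := by fun_prop
  have hg : Measurable fun x : mixedEmbedding.mixedSpace K ↦ f (x.1 v) * h (x.2 w) :=
    (hf.comp (by fun_prop)).mul (hh.comp (by fun_prop))
  have key := sq_lintegral_le_covolume_mul_tsum volume L hg
  have hcov : ZLattice.covolume L = N * d / 2 := by
    rw [hL, mixedEmbedding.covolume_idealLattice, nrComplexPlaces,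
      Fintype.card_eq_one_iff.2 ⟨w, fun y ↦ Subsingleton.elim y w⟩,
      FractionalIdeal.coe_mk0, FractionalIdeal.coeIdeal_absNorm]
    simp only [hN, hd, Rat.cast_natCast]
    ring
  have hauto (l : L) : ∫⁻ x : mixedEmbedding.mixedSpace K, f (x.1 v) * h (x.2 w) *
      (f (((l : mixedEmbedding.mixedSpace K) + x).1 v) *
        h (((l : mixedEmbedding.mixedSpace K) + x).2 w)) =
      ENNReal.ofReal (a * (Real.pi / (4 * s))) *
        (ENNReal.ofReal (1 - |(l : mixedEmbedding.mixedSpace K).1 v| / a) *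
        ENNReal.ofReal (Real.exp (-(s * ‖(l : mixedEmbedding.mixedSpace K).2 w‖ ^ 2)))) := by
    set t := (l : mixedEmbedding.mixedSpace K).1 v
    set z := (l : mixedEmbedding.mixedSpace K).2 w
    have e (x : mixedEmbedding.mixedSpace K) : f (x.1 v) * h (x.2 w) *
      (f (((l : mixedEmbedding.mixedSpace K) + x).1 v) *
        h (((l : mixedEmbedding.mixedSpace K) + x).2 w)) =
        (fun y ↦ f y * f (t + y)) (x.1 v) * (fun y ↦ h y * h (z + y)) (x.2 w) :=
      mul_mul_mul_comm _ _ _ _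
    have hf' : Measurable fun y ↦ f y * f (t + y) := hf.mul (hf.comp (measurable_const_add _))
    have hh' : Measurable fun y ↦ h y * h (z + y) := hh.mul (hh.comp (measurable_const_add _))
    rw [lintegral_congr e, lintegral_prod_pi_mul v w hf' hh', lintegral_indicator_mul_shift,
      lintegral_gaussian_complex_mul_shift hs0]
    rw [show a - |t| = a * (1 - |t| / a) by field_simp, ENNReal.ofReal_mul ha0.le,
      ENNReal.ofReal_mul (p := Real.pi / (4 * s)) (by positivity),
      ENNReal.ofReal_mul (p := a) (q := Real.pi / (4 * s)) ha0.le, neg_mul]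
    exact mul_mul_mul_comm _ _ _ _
  have hsplit : ∫⁻ x : mixedEmbedding.mixedSpace K, f (x.1 v) * h (x.2 w) =
      ENNReal.ofReal (a * (Real.pi / (2 * s))) := by
    rw [lintegral_prod_pi_mul v w hf hh, lintegral_gaussian_complex (by positivity),
      lintegral_indicator_one measurableSet_Ico, Real.volume_Ico, sub_zero,
      ENNReal.ofReal_mul ha0.le]
  simp_rw [hauto, hsplit] at key
  rw [ENNReal.tsum_mul_left, hcov, ← mul_assoc, ← ENNReal.ofReal_mul (by positivity),
    ← ENNReal.ofReal_pow (by positivity)] at key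
  have hconst : (a * (Real.pi / (2 * s))) ^ 2 =
      (N * d / 2 * (a * (Real.pi / (4 * s)))) * (2 * Real.pi * A / d) := by
    rw [ha]; field_simp; ring
  rw [hconst, ENNReal.ofReal_mul (by positivity),
    ENNReal.mul_le_mul_iff_right (by simp; positivity) ENNReal.ofReal_ne_top] at key
  refine key.trans ?_
  have hmem (l : L) : ∃ α : (J : Ideal (𝓞 K)),
      mixedEmbedding K ((α : 𝓞 K) : K) = (l : mixedEmbedding.mixedSpace K) := by
    obtain ⟨y, hy, hyl⟩ := (mixedEmbedding.mem_idealLattice K _).1 l.2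
    rw [FractionalIdeal.coe_mk0] at hy
    obtain ⟨α, hα, rfl⟩ := hy
    exact ⟨⟨α, hα⟩, hyl⟩
  choose φ hφ using hmem
  have hinj : Function.Injective φ := fun l m hlm ↦ Subtype.ext (by rw [← hφ l, hlm, hφ m])
  refine le_trans (le_of_eq ?_) (ENNReal.tsum_comp_le_tsum_of_injective hinj _)
  refine tsum_congr fun l ↦ ?_
  rw [← hφ l]
  rw [mixedEmbedding.mixedEmbedding_apply_isReal, mixedEmbedding.mixedEmbedding_apply_isComplex,
    ← Real.norm_eq_abs, norm_embedding_of_isReal, norm_embedding_eq]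

end

end

section

open MeasureTheory NumberField NumberField.InfinitePlace
open scoped Classical ENNReal nonZeroDivisors

lemma tsum_indicator_comp_le {X Y : Type*} (S : Set X) (f : X → Y) (ψ : Y → ℝ≥0∞)
    (s : X → Bool) (hs : ∀ x ∈ S, ∀ y ∈ S, f x = f y → s x = s y → x = y) :
    ∑' x, S.indicator (fun x ↦ ψ (f x)) x ≤ 2 * ∑' y, ψ y := by
  rw [← tsum_subtype]
  have hinj : Function.Injective fun x : S ↦ (f x, s x) := fun x y hxy ↦
    Subtype.ext (hs x x.2 y y.2 (congrArg Prod.fst hxy) (congrArg Prod.snd hxy))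
  refine (ENNReal.tsum_comp_le_tsum_of_injective hinj fun p : Y × Bool ↦ ψ p.1).trans ?_
  rw [ENNReal.tsum_prod (f := fun y (_ : Bool) ↦ ψ y)]
  simp [tsum_fintype, ENNReal.tsum_mul_left]

section

variable {K : Type*} [Field K] [NumberField K]

instance : Countable (𝓞 K) :=
  (RingOfIntegers.basis K).equivFun.injective.countable

/-- The weight of an ideal of norm `n` at time `τ`. -/
noncomputable def idealWeight (A : ℝ) (I : (Ideal (𝓞 K))⁰) (τ : ℝ) : ℝ≥0∞ :=
  ENNReal.ofReal (1 - Ideal.absNorm (I : Ideal (𝓞 K)) / (A * Real.exp τ)) *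
    ENNReal.ofReal (Real.exp (-Real.exp τ))

lemma measurable_idealWeight (A : ℝ) (I : (Ideal (𝓞 K))⁰) : Measurable (idealWeight A I) := by
  unfold idealWeight
  fun_prop

variable [Subsingleton {w : InfinitePlace K // w.IsReal}]
  [Subsingleton {w : InfinitePlace K // w.IsComplex}]
  (v : {w : InfinitePlace K // w.IsReal}) (w : {w : InfinitePlace K // w.IsComplex})

lemma term_eq_idealWeight {A : ℝ} (I J : (Ideal (𝓞 K))⁰) {α : 𝓞 K} (hα : α ≠ 0)
    (hI : (I * J : Ideal (𝓞 K)) = Ideal.span {α}) (τ : ℝ) :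
    ENNReal.ofReal (1 - v.1 (α : K) / (A * Ideal.absNorm (J : Ideal (𝓞 K)) * Real.exp τ)) *
        ENNReal.ofReal (Real.exp (-(Real.exp τ * w.1 (α : K) ^ 2))) =
      idealWeight A I (τ + 2 * Real.log (w.1 (α : K))) := by
  have hα' : (α : K) ≠ 0 := by exact_mod_cast hα
  have hv := (pos_iff (w := v.1)).2 hα'
  have hw := (pos_iff (w := w.1)).2 hα'
  have hJ : (Ideal.absNorm (J : Ideal (𝓞 K)) : ℝ) ≠ 0 :=
    Nat.cast_ne_zero.2 (Ideal.absNorm_ne_zero_of_nonZeroDivisors J)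
  have hN := real_mul_complex_sq_eq_absNorm v w α
  rw [← hI, map_mul, Nat.cast_mul] at hN
  have hexp : Real.exp (τ + 2 * Real.log (w.1 (α : K))) = Real.exp τ * w.1 (α : K) ^ 2 := by
    rw [Real.exp_add, two_mul, Real.exp_add, Real.exp_log hw, sq]
  have hτ := Real.exp_pos τ
  rw [idealWeight, hexp]
  congr 3
  rw [← mul_div_mul_right _ _ (pow_ne_zero 2 hw.ne'), hN, mul_comm,
    ← mul_div_mul_left _ (A * (Real.exp τ * w.1 (α : K) ^ 2)) hJ]
  congr 1
  ring

lemma eq_of_active {R : ℝ}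
    (hR : ∀ u : (𝓞 K)ˣ, u ≠ 1 → u ≠ -1 → R ≤ |Real.log (v.1 (u : K))|)
    {α β : 𝓞 K} (hα : α ≠ 0) (hspan : Ideal.span {α} = Ideal.span {β})
    (hlog : |2 * Real.log (w.1 (β : K)) - 2 * Real.log (w.1 (α : K))| < R)
    (hsign : 0 < embedding_of_isReal v.2 (α : K) ↔ 0 < embedding_of_isReal v.2 (β : K)) :
    α = β := by
  obtain ⟨u, hu⟩ := Ideal.span_singleton_eq_span_singleton.1 hspan
  have hα' : (α : K) ≠ 0 := by exact_mod_cast hα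
  have hu' : (α : K) * (u : K) = β := by rw [← hu]; simp
  have hu0 : ((u : 𝓞 K) : K) ≠ 0 := by simp
  have hv := (pos_iff (w := v.1)).2 hu0
  have hw := (pos_iff (w := w.1)).2 hu0
  have hN := real_mul_complex_sq_eq_absNorm v w (u : 𝓞 K)
  rw [Ideal.span_singleton_eq_top.2 u.isUnit, Ideal.absNorm_top, Nat.cast_one] at hN
  have hlogN : Real.log (v.1 (u : K)) + 2 * Real.log (w.1 (u : K)) = 0 := by
    rw [← Real.log_one, ← hN, Real.log_mul hv.ne' (pow_ne_zero 2 hw.ne'), Real.log_pow]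
    norm_num
  have hlt : |Real.log (v.1 (u : K))| < R := by
    rw [← hu', map_mul, Real.log_mul (pos_iff.2 hα').ne' hw.ne'] at hlog
    rw [← abs_neg]
    convert hlog using 2
    linarith
  by_cases h1 : u = 1
  · simpa [h1] using hu
  by_cases h2 : u = -1
  · exfalso
    have hβ : (β : K) = -α := by rw [← hu', h2]; simp
    have hne : embedding_of_isReal v.2 (α : K) ≠ 0 := (map_ne_zero _).2 hα'
    rw [hβ, map_neg, Left.neg_pos_iff] at hsign
    rcases hne.lt_or_gt with h | h
    · exact lt_asymm h (hsign.2 h)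
    · exact lt_asymm h (hsign.1 h)
  · exact absurd (hR u h1 h2) (not_le.2 hlt)

include w in
theorem classNumber_mul_le {A R : ℝ} (hA : 0 < A)
    (hR : ∀ u : (𝓞 K)ˣ, u ≠ 1 → u ≠ -1 → R ≤ |Real.log (v.1 (u : K))|) :
    (classNumber K : ℝ≥0∞) *
        (ENNReal.ofReal (2 * Real.pi * A / √|(discr K : ℝ)|) * ENNReal.ofReal R) ≤
      classNumber K * ENNReal.ofReal R +
        2 * ∫⁻ τ : ℝ, ∑' I : (Ideal (𝓞 K))⁰, idealWeight A I τ := by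
  choose J hJ using ClassGroup.mk0_surjective (R := 𝓞 K)
  have hex (x : Σ C, (J C : Ideal (𝓞 K))) : ∃ I : (Ideal (𝓞 K))⁰, (x.2 : 𝓞 K) ≠ 0 →
      (I * J x.1 : Ideal (𝓞 K)) = Ideal.span {(x.2 : 𝓞 K)} := by
    by_cases h0 : (x.2 : 𝓞 K) = 0
    · exact ⟨1, fun h ↦ absurd h0 h⟩
    obtain ⟨I, hI⟩ := Ideal.dvd_iff_le.mpr ((Ideal.span_singleton_le_iff_mem _).mpr x.2.2)
    have hI0 : I ≠ 0 := by
      rintro rfl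
      rw [mul_zero, Ideal.zero_eq_bot, Ideal.span_singleton_eq_bot] at hI
      exact h0 hI
    exact ⟨⟨I, mem_nonZeroDivisors_iff_ne_zero.2 hI0⟩, fun _ ↦ by rw [hI, mul_comm]⟩
  choose I hI using hex
  let c : (Σ C, (J C : Ideal (𝓞 K))) → ℝ := fun x ↦ 2 * Real.log (w.1 ((x.2 : 𝓞 K) : K))
  let S : ℝ → Set (Σ C, (J C : Ideal (𝓞 K))) :=
    fun τ ↦ {x | (x.2 : 𝓞 K) ≠ 0 ∧ τ - c x ∈ Set.Ico 0 R}
  let G : (Σ C, (J C : Ideal (𝓞 K))) → ℝ → ℝ≥0∞ :=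
    fun x τ ↦ (S τ).indicator (fun x ↦ idealWeight A (I x) τ) x
  have hG (x) : Measurable (G x) := by
    have : G x = Set.indicator {τ | (x.2 : 𝓞 K) ≠ 0 ∧ τ - c x ∈ Set.Ico 0 R}
        (idealWeight A (I x)) := by
      ext τ; simp [G, S, Set.indicator_apply]
    rw [this]
    refine (measurable_idealWeight A (I x)).indicator ?_
    exact MeasurableSet.inter (.const _) (measurableSet_Ico.preimage (by fun_prop))
  have hclass (C : ClassGroup (𝓞 K)) :
      ENNReal.ofReal (2 * Real.pi * A / √|(discr K : ℝ)|) * ENNReal.ofReal R ≤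
        ENNReal.ofReal R + ∑' α : (J C : Ideal (𝓞 K)), ∫⁻ τ, G ⟨C, α⟩ τ := by
    calc _ = ∫⁻ τ in Set.Ico 0 R, ENNReal.ofReal (2 * Real.pi * A / √|(discr K : ℝ)|) := by
          simp
      _ ≤ _ := lintegral_mono fun τ ↦ lattice_sum_ge v w (J C) hA τ
      _ = _ := lintegral_tsum fun α ↦ by fun_prop
      _ ≤ ∑' α : (J C : Ideal (𝓞 K)),
          ((if α = 0 then ENNReal.ofReal R else 0) + ∫⁻ τ, G ⟨C, α⟩ τ) := by
        refine ENNReal.tsum_le_tsum fun α ↦ ?_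
        by_cases hα : α = 0
        · subst hα
          refine le_add_right ?_
          rw [if_pos rfl]
          calc _ ≤ ∫⁻ τ in Set.Ico 0 R, 1 := lintegral_mono fun τ ↦ by simp
            _ = _ := by simp
        · have hα' : (α : 𝓞 K) ≠ 0 := by simpa using hα
          rw [if_neg hα, zero_add]
          simp_rw [term_eq_idealWeight v w (I ⟨C, α⟩) (J C) hα' (hI ⟨C, α⟩ hα')]
          rw [← lintegral_indicator measurableSet_Ico,
            ← lintegral_sub_right_eq_self _ (c ⟨C, α⟩)]
          refine le_of_eq (lintegral_congr fun τ ↦ ?_)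
          simp [G, S, Set.indicator_apply, c, hα]
      _ = _ := by rw [ENNReal.tsum_add, tsum_ite_eq]
  have hpoint (τ : ℝ) : ∑' x, G x τ ≤ 2 * ∑' I : (Ideal (𝓞 K))⁰, idealWeight A I τ := by
    refine tsum_indicator_comp_le (S τ) I (fun I ↦ idealWeight A I τ)
      (fun x ↦ decide (0 < embedding_of_isReal v.2 ((x.2 : 𝓞 K) : K))) ?_
    rintro ⟨C, α⟩ ⟨hα, hα1, hα2⟩ ⟨C', β⟩ ⟨hβ, hβ1, hβ2⟩ hIeq hsign
    have hmk (x : Σ C, (J C : Ideal (𝓞 K))) (hx : (x.2 : 𝓞 K) ≠ 0) :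
        ClassGroup.mk0 (I x) = x.1⁻¹ := by
      rw [← hJ x.1]
      exact ClassGroup.mk0_eq_mk0_inv_iff.2 ⟨_, hx, hI x hx⟩
    obtain rfl : C = C' := by
      have := (hmk _ hα).symm.trans ((congrArg _ hIeq).trans (hmk _ hβ))
      simpa using this
    congr 1
    refine Subtype.ext (eq_of_active v w hR hα ?_ ?_ (by simpa using hsign))
    · rw [← hI _ hα, ← hI _ hβ, hIeq]
    · simp only [c] at hα1 hα2 hβ1 hβ2
      rw [abs_lt]
      constructor <;> linarith
  calc _ = ∑ C : ClassGroup (𝓞 K),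
        ENNReal.ofReal (2 * Real.pi * A / √|(discr K : ℝ)|) * ENNReal.ofReal R := by
        simp [classNumber]
    _ ≤ _ := Finset.sum_le_sum fun C _ ↦ hclass C
    _ = classNumber K * ENNReal.ofReal R + ∑' x, ∫⁻ τ, G x τ := by
      rw [Finset.sum_add_distrib, ENNReal.tsum_sigma', tsum_fintype]
      simp [classNumber]
    _ ≤ _ := by
      rw [← lintegral_tsum fun x ↦ (hG x).aemeasurable, ← lintegral_const_mul' _ _ (by simp)]
      gcongr
      exact hpoint _

end

end

section

open NumberField NumberField.InfinitePlace Module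
open scoped Classical ComplexConjugate

lemma disc_polynomial_le {r x y : ℝ} (h : |r| * (x ^ 2 + y ^ 2) = 1) :
    4 * y ^ 2 * ((r - x) ^ 2 + y ^ 2) ^ 2 ≤ 4 * (|r| ^ 3 + (|r| ^ 3)⁻¹ + 6) := by
  wlog hr : 0 ≤ r generalizing r x
  · have := this (r := -r) (x := -x) (by rwa [abs_neg, neg_sq]) (by linarith)
    rw [abs_neg] at this
    convert this using 4
    ring
  rw [abs_of_nonneg hr] at h ⊢
  have hinv : (r ^ 3)⁻¹ = (x ^ 2 + y ^ 2) ^ 3 := by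
    rw [← inv_pow, ← eq_inv_of_mul_eq_one_right h]
  rw [hinv]
  have hid : r ^ 3 + (x ^ 2 + y ^ 2) ^ 3 + 6 - y ^ 2 * ((r - x) ^ 2 + y ^ 2) ^ 2 =
      (x * (r ^ 2 + (x ^ 2 + y ^ 2)) + 2 - 2 * x ^ 2 * r) ^ 2 + 4 * x ^ 2 * r := by
    linear_combination (4 * x * (r ^ 2 + (x ^ 2 + y ^ 2)) - 4 * x ^ 2 * r - r ^ 3 -
      2 * (r * (x ^ 2 + y ^ 2) + 1)) * h
  have : 0 ≤ 4 * x ^ 2 * r := by positivity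
  nlinarith [sq_nonneg (x * (r ^ 2 + (x ^ 2 + y ^ 2)) + 2 - 2 * x ^ 2 * r)]

section

variable {K : Type*} [Field K]

lemma embedding_of_isReal_ne_embedding (v : {w : InfinitePlace K // w.IsReal})
    (w : {w : InfinitePlace K // w.IsComplex}) : v.1.embedding ≠ w.1.embedding := by
  intro h
  have hv := isReal_iff.1 v.2
  rw [h] at hv
  exact isComplex_iff.1 w.2 hv

variable [NumberField K]

lemma trace_eq_of_finrank_eq_three (h3 : finrank ℚ K = 3) (v : {w : InfinitePlace K // w.IsReal})
    (w : {w : InfinitePlace K // w.IsComplex}) (x : K) :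
    (Algebra.trace ℚ K x : ℝ) = embedding_of_isReal v.2 x + 2 * (w.1.embedding x).re := by
  have hc : ComplexEmbedding.conjugate w.1.embedding ≠ w.1.embedding := fun h ↦
    isComplex_iff.1 w.2 (ComplexEmbedding.isReal_iff.2 h)
  have hv : ComplexEmbedding.conjugate v.1.embedding = v.1.embedding :=
    ComplexEmbedding.isReal_iff.1 (isReal_iff.1 v.2)
  have h1 := embedding_of_isReal_ne_embedding v w
  have h2 : v.1.embedding ≠ ComplexEmbedding.conjugate w.1.embedding := by
    intro h
    apply h1
    rw [← hv, h, ComplexEmbedding.involutive_conjugate]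
  have huniv : ({v.1.embedding, w.1.embedding, ComplexEmbedding.conjugate w.1.embedding} :
      Finset (K →+* ℂ)) = Finset.univ := by
    apply Finset.eq_univ_of_card
    rw [Embeddings.card, h3, Finset.card_eq_three]
    exact ⟨_, _, _, h1, h2, hc.symm, rfl⟩
  have ht := trace_eq_sum_embeddings (K := ℚ) (L := K) ℂ (x := x)
  rw [← Fintype.sum_equiv (RingHom.equivRatAlgHom (R := K) (S := ℂ)) (fun σ ↦ σ x) _
    (fun _ ↦ rfl), ← huniv, Finset.sum_insert (by simp [h1, h2]), Finset.sum_pair hc.symm,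
    ComplexEmbedding.conjugate_coe_eq, Complex.add_conj, ← embedding_of_isReal_apply v.2] at ht
  rw [eq_ratCast] at ht
  exact_mod_cast ht

lemma discr_pow_family_eq (h3 : finrank ℚ K = 3) (v : {w : InfinitePlace K // w.IsReal})
    (w : {w : InfinitePlace K // w.IsComplex}) (x : 𝓞 K) :
    (Algebra.discr ℤ (fun i : Fin 3 ↦ x ^ (i : ℕ)) : ℝ) = -(4 * (w.1.embedding x).im ^ 2 *
      ((embedding_of_isReal v.2 (x : K) - (w.1.embedding x).re) ^ 2 +
        (w.1.embedding x).im ^ 2) ^ 2) := by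
  have ht (k : ℕ) : (Algebra.trace ℤ (𝓞 K) (x ^ k) : ℝ) =
      embedding_of_isReal v.2 (x : K) ^ k + 2 * ((w.1.embedding x) ^ k).re := by
    have := trace_eq_of_finrank_eq_three h3 v w ((x ^ k : 𝓞 K) : K)
    rw [← Algebra.coe_trace_int] at this
    simpa using this
  rw [Algebra.discr_def, Matrix.det_fin_three]
  simp only [Algebra.traceMatrix_apply, Algebra.traceForm_apply, ← pow_add]
  push_cast [ht]
  set z := w.1.embedding x
  set r := embedding_of_isReal v.2 (x : K)
  have h2 : (z ^ 2).re = z.re ^ 2 - z.im ^ 2 := by simp [sq]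
  have h3 : (z ^ 3).re = z.re ^ 3 - 3 * z.re * z.im ^ 2 := by simp [pow_succ]; ring
  have h4 : (z ^ 4).re = z.re ^ 4 - 6 * z.re ^ 2 * z.im ^ 2 + z.im ^ 4 := by
    simp [pow_succ]; ring
  simp [h2, h3, h4]
  ring

lemma exists_discr_pow_family_eq (h3 : finrank ℚ K = 3) (x : 𝓞 K) :
    ∃ m : ℤ, Algebra.discr ℤ (fun i : Fin 3 ↦ x ^ (i : ℕ)) = m ^ 2 * discr K := by
  have hcard : Fintype.card (Free.ChooseBasisIndex ℤ (𝓞 K)) = 3 := by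
    rw [← finrank_eq_card_chooseBasisIndex, RingOfIntegers.rank, h3]
  let b := (RingOfIntegers.basis K).reindex (Fintype.equivFinOfCardEq hcard)
  refine ⟨(b.toMatrix (fun i : Fin 3 ↦ x ^ (i : ℕ))).det, ?_⟩
  rw [← discr_eq_discr K b, ← Algebra.discr_of_matrix_vecMul]
  congr 1
  ext i
  simp only [Matrix.vecMul, dotProduct, Matrix.map_apply, mul_comm (b _), ← Algebra.smul_def]
  rw [b.sum_toMatrix_smul_self]

lemma abs_discr_le_of_im_ne_zero (h3 : finrank ℚ K = 3) (v : {w : InfinitePlace K // w.IsReal})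
    (w : {w : InfinitePlace K // w.IsComplex}) (x : 𝓞 K) (hx : (w.1.embedding x).im ≠ 0) :
    |(discr K : ℝ)| ≤ 4 * (w.1.embedding x).im ^ 2 *
      ((embedding_of_isReal v.2 (x : K) - (w.1.embedding x).re) ^ 2 +
        (w.1.embedding x).im ^ 2) ^ 2 := by
  obtain ⟨m, hm⟩ := exists_discr_pow_family_eq h3 x
  have hd := discr_pow_family_eq h3 v w x
  set y := (w.1.embedding x).im
  have hy : 0 < y ^ 2 := by positivity
  set F := 4 * y ^ 2 * ((embedding_of_isReal v.2 (x : K) - (w.1.embedding x).re) ^ 2 +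
        y ^ 2) ^ 2
  have hF : 0 < F := by positivity
  rw [hm] at hd
  push_cast at hd
  have hm0 : m ≠ 0 := by
    rintro rfl
    simp at hd
    linarith
  have hm1 : (1 : ℝ) ≤ (m : ℝ) ^ 2 := by
    have : (1 : ℤ) ≤ m ^ 2 := Int.add_one_le_iff.2 (sq_pos_of_ne_zero hm0)
    exact_mod_cast this
  have : (m : ℝ) ^ 2 * |(discr K : ℝ)| = F := by
    rw [← abs_of_pos hF, ← abs_neg F, ← hd, abs_mul, abs_of_nonneg (sq_nonneg (m : ℝ))]
  nlinarith [abs_nonneg (discr K : ℝ)]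

lemma im_embedding_ne_zero (h3 : finrank ℚ K = 3)
    (w : {w : InfinitePlace K // w.IsComplex}) {x : K} (hx : x ∉ (⊥ : IntermediateField ℚ K)) :
    (w.1.embedding x).im ≠ 0 := by
  intro him
  have hsimple := IntermediateField.isSimpleOrder_of_finrank_prime ℚ K (by rw [h3]; norm_num)
  rcases hsimple.eq_bot_or_eq_top (IntermediateField.adjoin ℚ {x}) with h | h
  · exact hx (h ▸ IntermediateField.mem_adjoin_simple_self ℚ x)
  have hmem (y : K) : w.1.embedding y = conj (w.1.embedding y) := by
    have hy : y ∈ IntermediateField.adjoin ℚ {x} := h ▸ IntermediateField.mem_top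
    induction hy using IntermediateField.adjoin_induction with
    | mem z hz => rw [Set.mem_singleton_iff.1 hz]; exact (Complex.conj_eq_iff_im.2 him).symm
    | algebraMap q => simp
    | add a b _ _ ha hb => rw [map_add, map_add, ← ha, ← hb]
    | inv a _ ha => rw [map_inv₀, map_inv₀, ← ha]
    | mul a b _ _ ha hb => rw [map_mul, map_mul, ← ha, ← hb]
  refine isComplex_iff.1 w.2 (ComplexEmbedding.isReal_iff.2 ?_)
  ext y
  exact (hmem y).symm

lemma unit_eq_one_or_of_mem_bot (v : {w : InfinitePlace K // w.IsReal})
    (w : {w : InfinitePlace K // w.IsComplex}) [Subsingleton {w : InfinitePlace K // w.IsReal}]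
    [Subsingleton {w : InfinitePlace K // w.IsComplex}] (u : (𝓞 K)ˣ)
    (hu : ((u : 𝓞 K) : K) ∈ (⊥ : IntermediateField ℚ K)) : u = 1 ∨ u = -1 := by
  obtain ⟨q, hq⟩ := IntermediateField.mem_bot.1 hu
  have hN := real_mul_complex_sq_eq_absNorm v w (u : 𝓞 K)
  rw [Ideal.span_singleton_eq_top.2 u.isUnit, Ideal.absNorm_top, Nat.cast_one, ← hq] at hN
  have e (w' : InfinitePlace K) : w' (algebraMap ℚ K q) = |(q : ℝ)| := by
    rw [← norm_embedding_eq, eq_ratCast, map_ratCast, ← Complex.ofReal_ratCast, Complex.norm_real,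
      Real.norm_eq_abs]
  rw [e, e, ← pow_succ', pow_eq_one_iff_of_nonneg (abs_nonneg _) (by norm_num)] at hN
  have hinj : Function.Injective (algebraMap (𝓞 K) K) := RingOfIntegers.coe_injective
  rcases eq_or_eq_neg_of_abs_eq hN with h | h
  · left
    ext
    rw [← hq, show q = 1 by exact_mod_cast h]
    simp
  · right
    ext
    rw [← hq, show q = -1 by exact_mod_cast h]
    simp

/-- A lower bound for the logarithm of a nontrivial unit of a complex cubic field. -/
lemma log_le_abs_log_unit (h3 : finrank ℚ K = 3) (v : {w : InfinitePlace K // w.IsReal})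
    (w : {w : InfinitePlace K // w.IsComplex}) [Subsingleton {w : InfinitePlace K // w.IsReal}]
    [Subsingleton {w : InfinitePlace K // w.IsComplex}] (u : (𝓞 K)ˣ) (h1 : u ≠ 1) (h2 : u ≠ -1)
    (hD : 28 < |(discr K : ℝ)|) :
    1 / 3 * Real.log ((|(discr K : ℝ)| - 28) / 4) ≤ |Real.log (v.1 (u : K))| := by
  have hbot : ((u : 𝓞 K) : K) ∉ (⊥ : IntermediateField ℚ K) := fun h ↦
    (unit_eq_one_or_of_mem_bot v w u h).elim h1 h2
  have hle := abs_discr_le_of_im_ne_zero h3 v w u (im_embedding_ne_zero h3 w hbot)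
  have hN := real_mul_complex_sq_eq_absNorm v w (u : 𝓞 K)
  rw [Ideal.span_singleton_eq_top.2 u.isUnit, Ideal.absNorm_top, Nat.cast_one,
    ← norm_embedding_eq w.1, Complex.sq_norm, Complex.normSq_apply, ← norm_embedding_of_isReal v.2,
    Real.norm_eq_abs, ← sq, ← sq] at hN
  have hle2 := hle.trans (disc_polynomial_le hN)
  rw [← Real.norm_eq_abs (embedding_of_isReal _ _), norm_embedding_of_isReal v.2] at hle2
  set r := v.1 ((u : 𝓞 K) : K)
  have hr : 0 < r := (pos_iff (w := v.1)).2 (by simp)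
  have hlog3 : Real.log (r ^ 3) = 3 * Real.log r := by rw [Real.log_pow]; norm_num
  set L := |Real.log r|
  have hexp : r ^ 3 + (r ^ 3)⁻¹ ≤ Real.exp (3 * L) + 1 := by
    have e1 : r ^ 3 = Real.exp (3 * Real.log r) := by rw [← hlog3, Real.exp_log (by positivity)]
    rw [e1, ← Real.exp_neg]
    rcases abs_cases (Real.log r) with ⟨h, h'⟩ | ⟨h, h'⟩
    · rw [show 3 * L = 3 * Real.log r by simp only [L]; rw [h]]
      gcongr
      exact Real.exp_le_one_iff.2 (by linarith)
    · rw [show 3 * L = -(3 * Real.log r) by simp only [L]; rw [h]; ring, add_comm]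
      gcongr
      exact Real.exp_le_one_iff.2 (by linarith)
  have : Real.log ((|(discr K : ℝ)| - 28) / 4) ≤ 3 * L := by
    rw [Real.log_le_iff_le_exp (by linarith)]
    linarith
  linarith

end

end

section

open NumberField NumberField.InfinitePlace Module Polynomial
open scoped Classical ComplexConjugate

lemma rat_cube_ne_prime {p : ℕ} (hp : p.Prime) (b : ℚ) : b ^ 3 ≠ p := by
  intro h
  have := Fact.mk hp
  have := congrArg (padicValRat p) h
  rw [padicValRat.pow, padicValRat.of_nat, padicValNat_self] at this
  push_cast at this
  omega

section

variable {K : Type*} [Field K] [NumberField K]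

lemma finrank_eq_three_of_cube_eq_prime {p : ℕ} (hp : p.Prime) {θ : K} (hθ : θ ^ 3 = (p : K))
    (hgen : Algebra.adjoin ℚ {θ} = ⊤) : finrank ℚ K = 3 := by
  have hirr : Irreducible (X ^ 3 - C (p : ℚ)) :=
    X_pow_sub_C_irreducible_of_prime Nat.prime_three (rat_cube_ne_prime hp)
  have hmin := minpoly.eq_of_irreducible_of_monic hirr (x := θ) (by simp [hθ])
    (monic_X_pow_sub_C _ (by norm_num))
  have := IntermediateField.adjoin.finrank (Algebra.IsIntegral.isIntegral (R := ℚ) θ)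
  rw [IntermediateField.adjoin_eq_top_of_algebra ℚ {θ} hgen, IntermediateField.finrank_top',
    ← hmin, natDegree_X_pow_sub_C] at this
  exact this

lemma ringHom_eq_of_adjoin_eq_top {L : Type*} [Field L] [Algebra ℚ L] {θ : K}
    (hgen : Algebra.adjoin ℚ {θ} = ⊤) {f g : K →+* L} (h : f θ = g θ) : f = g := by
  have : f.toRatAlgHom = g.toRatAlgHom := by
    refine AlgHom.ext_of_adjoin_eq_top hgen ?_
    rintro _ rfl
    exact h
  ext x
  exact congrArg (fun φ : K →ₐ[ℚ] L ↦ φ x) this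

lemma subsingleton_real_places {p : ℕ} {θ : K} (hθ : θ ^ 3 = (p : K))
    (hgen : Algebra.adjoin ℚ {θ} = ⊤) : Subsingleton {w : InfinitePlace K // w.IsReal} := by
  refine ⟨fun v w ↦ Subtype.ext ?_⟩
  have h : embedding_of_isReal v.2 θ = embedding_of_isReal w.2 θ := by
    have hodd : Odd 3 := by decide
    apply hodd.pow_injective
    simp only
    rw [← map_pow, ← map_pow, hθ, map_natCast, map_natCast]
  have h2 := ringHom_eq_of_adjoin_eq_top hgen h
  ext x
  rw [← norm_embedding_of_isReal v.2, ← norm_embedding_of_isReal w.2, h2]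

lemma card_places_of_cube_eq_prime {p : ℕ} (hp : p.Prime) {θ : K} (hθ : θ ^ 3 = (p : K))
    (hgen : Algebra.adjoin ℚ {θ} = ⊤) :
    Fintype.card {w : InfinitePlace K // w.IsReal} = 1 ∧
      Fintype.card {w : InfinitePlace K // w.IsComplex} = 1 := by
  have h1 := card_add_two_mul_card_eq_rank K
  rw [finrank_eq_three_of_cube_eq_prime hp hθ hgen] at h1
  have h2 := Fintype.card_le_one_iff_subsingleton.2 (subsingleton_real_places hθ hgen)
  change Fintype.card {w : InfinitePlace K // w.IsReal} + 2 *
    Fintype.card {w : InfinitePlace K // w.IsComplex} = 3 at h1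
  omega

lemma cube_root_embeddings {K : Type*} [Field K] (v : {w : InfinitePlace K // w.IsReal})
    (w : {w : InfinitePlace K // w.IsComplex}) {p : ℕ} {θ : K} (hθ : θ ^ 3 = (p : K))
    (him : (w.1.embedding θ).im ≠ 0) :
    (w.1.embedding θ).re = -embedding_of_isReal v.2 θ / 2 ∧
      (w.1.embedding θ).im ^ 2 = 3 / 4 * embedding_of_isReal v.2 θ ^ 2 := by
  have hr : embedding_of_isReal v.2 θ ^ 3 = p := by rw [← map_pow, hθ, map_natCast]
  have hz : w.1.embedding θ ^ 3 = p := by rw [← map_pow, hθ, map_natCast]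
  set r := embedding_of_isReal v.2 θ
  set z := w.1.embedding θ
  have hre : z.re ^ 3 - 3 * z.re * z.im ^ 2 = p := by
    have := congrArg Complex.re hz
    simp [pow_succ] at this
    linarith
  have hi : z.im * (3 * z.re ^ 2 - z.im ^ 2) = 0 := by
    have := congrArg Complex.im hz
    simp [pow_succ] at this
    linarith
  have hi2 : z.im ^ 2 = 3 * z.re ^ 2 := by
    have := (mul_eq_zero.1 hi).resolve_left him
    linarith
  have hodd : Odd 3 := by decide
  have h : -2 * z.re = r := by
    apply hodd.pow_injective
    simp only
    rw [hr, ← hre, hi2]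
    ring
  constructor
  · linarith
  · rw [hi2, ← h]; ring

lemma not_mem_bot_of_cube_eq_prime {p : ℕ} (hp : p.Prime) {θ : K} (hθ : θ ^ 3 = (p : K)) :
    θ ∉ (⊥ : IntermediateField ℚ K) := by
  intro h
  obtain ⟨q, rfl⟩ := IntermediateField.mem_bot.1 h
  refine rat_cube_ne_prime hp q ((algebraMap ℚ K).injective ?_)
  rw [map_pow, hθ, map_natCast]

lemma trace_cube_root (h3 : finrank ℚ K = 3) (v : {w : InfinitePlace K // w.IsReal})
    (w : {w : InfinitePlace K // w.IsComplex}) {p : ℕ} (hp : p.Prime) {θ : K}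
    (hθ : θ ^ 3 = (p : K)) :
    Algebra.trace ℚ K θ = 0 ∧ Algebra.trace ℚ K (θ ^ 2) = 0 := by
  have h := cube_root_embeddings v w hθ
    (im_embedding_ne_zero h3 w (not_mem_bot_of_cube_eq_prime hp hθ))
  have h1 := trace_eq_of_finrank_eq_three h3 v w θ
  have h2 := trace_eq_of_finrank_eq_three h3 v w (θ ^ 2)
  rw [map_pow (embedding_of_isReal v.2), map_pow w.1.embedding,
    sq (w.1.embedding θ), Complex.mul_re, ← sq, ← sq, h.1, h.2] at h2
  rw [h.1] at h1
  ring_nf at h1 h2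
  exact ⟨by exact_mod_cast h1, by exact_mod_cast h2⟩

lemma discr_cube_root (h3 : finrank ℚ K = 3) (v : {w : InfinitePlace K // w.IsReal})
    (w : {w : InfinitePlace K // w.IsComplex}) {p : ℕ} (hp : p.Prime) {θ : 𝓞 K}
    (hθ : θ ^ 3 = (p : 𝓞 K)) :
    Algebra.discr ℤ (fun i : Fin 3 ↦ θ ^ (i : ℕ)) = -27 * (p : ℤ) ^ 2 := by
  have hθ' : (θ : K) ^ 3 = (p : K) := by exact_mod_cast congrArg (algebraMap (𝓞 K) K) hθ
  have h := cube_root_embeddings v w hθ'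
    (im_embedding_ne_zero h3 w (not_mem_bot_of_cube_eq_prime hp hθ'))
  have hr : embedding_of_isReal v.2 (θ : K) ^ 3 = p := by rw [← map_pow, hθ', map_natCast]
  have hd := discr_pow_family_eq h3 v w θ
  rw [h.1, h.2] at hd
  have : (Algebra.discr ℤ (fun i : Fin 3 ↦ θ ^ (i : ℕ)) : ℝ) = -27 * (p : ℝ) ^ 2 := by
    rw [hd, ← hr]; ring
  exact_mod_cast this

lemma norm_cube_root (h3 : finrank ℚ K = 3) {p : ℕ} {θ : 𝓞 K} (hθ : θ ^ 3 = (p : 𝓞 K)) :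
    Algebra.norm ℤ θ = p := by
  have h := congrArg (Algebra.norm ℤ) hθ
  rw [map_pow, Algebra.norm_natCast, RingOfIntegers.rank, h3] at h
  have hodd : Odd 3 := by decide
  exact hodd.pow_injective h

lemma dvd_of_cube_root_dvd (h3 : finrank ℚ K = 3) {p : ℕ} (hp : p.Prime) {θ : 𝓞 K}
    (hθ : θ ^ 3 = (p : 𝓞 K)) {n : ℤ} (h : θ ∣ (n : 𝓞 K)) : (p : ℤ) ∣ n := by
  have := map_dvd (Algebra.norm ℤ) h
  rw [norm_cube_root h3 hθ, ← eq_intCast (algebraMap ℤ (𝓞 K)), Algebra.norm_algebraMap,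
    RingOfIntegers.rank, h3] at this
  exact (Nat.prime_iff_prime_int.1 hp).dvd_of_dvd_pow this

lemma dvd_coeffs (h3 : finrank ℚ K = 3) {p : ℕ} (hp : p.Prime) {θ : 𝓞 K}
    (hθ : θ ^ 3 = (p : 𝓞 K)) {a b c : ℤ}
    (h : (p : 𝓞 K) ∣ a + b * θ + c * θ ^ 2) : (p : ℤ) ∣ a ∧ (p : ℤ) ∣ b ∧ (p : ℤ) ∣ c := by
  have hθ0 : θ ≠ 0 := by
    rintro rfl
    rw [zero_pow (by norm_num)] at hθ
    exact hp.ne_zero (by exact_mod_cast hθ.symm)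
  obtain ⟨β, hβ⟩ := h
  rw [← hθ] at hβ
  have ha : (p : ℤ) ∣ a := dvd_of_cube_root_dvd h3 hp hθ
    ⟨θ ^ 2 * β - b - c * θ, by linear_combination hβ⟩
  obtain ⟨a', rfl⟩ := ha
  have hβ' : θ * (b + c * θ) = θ * (θ ^ 2 * (β - a')) := by
    push_cast at hβ
    rw [← hθ] at hβ
    linear_combination hβ
  have hβ2 := mul_left_cancel₀ hθ0 hβ'
  have hb : (p : ℤ) ∣ b := dvd_of_cube_root_dvd h3 hp hθ
    ⟨θ * (β - a') - c, by linear_combination hβ2⟩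
  obtain ⟨b', rfl⟩ := hb
  have hβ3 : θ * (c : 𝓞 K) = θ * (θ * (β - a' - θ * b')) := by
    push_cast at hβ2
    rw [← hθ] at hβ2
    linear_combination hβ2
  exact ⟨dvd_mul_right _ _, dvd_mul_right _ _,
    dvd_of_cube_root_dvd h3 hp hθ ⟨_, mul_left_cancel₀ hθ0 hβ3⟩⟩

/-- The discriminant of a pure cubic field of prime radicand; in the first case `1, θ, θ²` is an
integral basis. -/
lemma discr_pure_cubic (h3 : finrank ℚ K = 3) (v : {w : InfinitePlace K // w.IsReal})
    (w : {w : InfinitePlace K // w.IsComplex}) {p : ℕ} (hp : p.Prime) {θ : 𝓞 K}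
    (hθ : θ ^ 3 = (p : 𝓞 K)) :
    (discr K = -27 * (p : ℤ) ^ 2 ∧ Submodule.span ℤ (Set.range fun i : Fin 3 ↦ θ ^ (i : ℕ)) = ⊤) ∨
      discr K = -3 * (p : ℤ) ^ 2 := by
  have hcard : Fintype.card (Free.ChooseBasisIndex ℤ (𝓞 K)) = 3 := by
    rw [← finrank_eq_card_chooseBasisIndex, RingOfIntegers.rank, h3]
  let b := (RingOfIntegers.basis K).reindex (Fintype.equivFinOfCardEq hcard)
  set f : Fin 3 → 𝓞 K := fun i ↦ θ ^ (i : ℕ) with hf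
  have hfam : f = Matrix.vecMul b ((b.toMatrix f).map (algebraMap ℤ (𝓞 K))) := by
    ext i
    simp only [Matrix.vecMul, dotProduct, Matrix.map_apply, mul_comm (b _), ← Algebra.smul_def]
    rw [b.sum_toMatrix_smul_self]
  set m := (b.toMatrix f).det with hm
  have hdisc : m ^ 2 * discr K = -27 * (p : ℤ) ^ 2 := by
    rw [← discr_cube_root h3 v w hp hθ, ← discr_eq_discr K b, ← Algebra.discr_of_matrix_vecMul,
      ← hfam]
  have hpm : ¬ (p : ℤ) ∣ m := by
    intro hdvd
    have := Fact.mk hp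
    have hdet : ((b.toMatrix f).map (Int.castRingHom (ZMod p))).det = 0 := by
      rw [← RingHom.mapMatrix_apply, ← RingHom.map_det]
      exact (ZMod.intCast_zmod_eq_zero_iff_dvd m p).2 hdvd
    obtain ⟨x, hx0, hx⟩ := Matrix.exists_mulVec_eq_zero_iff.2 hdet
    choose y hy using fun i ↦ ZMod.intCast_surjective (x i)
    have hrow (j : Fin 3) : (p : ℤ) ∣ ∑ i, b.toMatrix f j i * y i := by
      rw [← ZMod.intCast_zmod_eq_zero_iff_dvd]
      have := congrFun hx j
      simp only [Matrix.mulVec, dotProduct, Matrix.map_apply, Pi.zero_apply, ← hy, eq_intCast] at this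
      exact_mod_cast this
    choose z hz using hrow
    have hsum : ∑ i, y i • f i = (p : 𝓞 K) * ∑ j, z j • b j := by
      calc ∑ i, y i • f i = ∑ i, y i • ∑ j, b.toMatrix f j i • b j := by
            simp_rw [b.sum_toMatrix_smul_self]
        _ = ∑ j, (∑ i, b.toMatrix f j i * y i) • b j := by
            simp_rw [Finset.smul_sum, Finset.sum_smul, smul_smul]
            rw [Finset.sum_comm]
            simp_rw [mul_comm]
        _ = _ := by
            simp_rw [hz, mul_smul]
            rw [Finset.mul_sum]
            simp
    have hdv : (p : 𝓞 K) ∣ y 0 + y 1 * θ + y 2 * θ ^ 2 := ⟨_, by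
      rw [← hsum, Fin.sum_univ_three]; simp [hf]⟩
    obtain ⟨h0, h1, h2⟩ := dvd_coeffs h3 hp hθ hdv
    apply hx0
    ext i
    rw [← hy i, Pi.zero_apply, ZMod.intCast_zmod_eq_zero_iff_dvd]
    fin_cases i
    exacts [h0, h1, h2]
  have hcop : IsCoprime (m ^ 2) ((p : ℤ) ^ 2) :=
    (((Nat.prime_iff_prime_int.1 hp).coprime_iff_not_dvd.2 hpm).symm).pow
  have h27 : m ^ 2 ∣ 27 := by
    refine hcop.dvd_of_dvd_mul_right ?_
    exact ⟨-discr K, by linear_combination hdisc⟩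
  have hle := Int.le_of_dvd (by norm_num) h27
  have hlt : |m| < 6 := by
    by_contra! h
    have : 6 ^ 2 ≤ |m| ^ 2 := by gcongr
    rw [sq_abs] at this
    omega
  rw [← sq_abs] at h27 hdisc
  have habs := abs_nonneg m
  by_cases h1 : |m| = 1
  · left
    refine ⟨by rw [h1] at hdisc; linarith, ?_⟩
    exact ((Module.Basis.is_basis_iff_det b (v := f)).2 (by
      rw [Module.Basis.det_apply, ← hm]; exact Int.isUnit_iff_abs_eq.2 h1)).2
  · right
    generalize |m| = k at *
    interval_cases k <;> omega

end

end

section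

open NumberField Module UniqueFactorizationMonoid Ideal
open scoped Classical

section

variable (K : Type*) [Field K] [NumberField K]

/-- The number of integral ideals of norm `n`. -/
noncomputable def idealCount (n : ℕ) : ℕ := Nat.card {I : Ideal (𝓞 K) // absNorm I = n}

instance (n : ℕ) : Finite {I : Ideal (𝓞 K) // absNorm I = n} :=
  (finite_setOfPred_absNorm_eq n).to_subtype

lemma idealCount_one : idealCount K 1 = 1 := by
  simp [idealCount, absNorm_eq_one_iff]

/-- The primes of `𝓞 K` containing the integer `q`. -/
noncomputable def primesAbove (q : ℕ) : Finset (Ideal (𝓞 K)) :=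
  (normalizedFactors (span {(q : 𝓞 K)})).toFinset

variable {K}

lemma span_natCast_ne_bot {q : ℕ} (hq : q ≠ 0) : span {(q : 𝓞 K)} ≠ ⊥ := by
  simpa using hq

lemma mem_primesAbove {q : ℕ} (hq : q ≠ 0) {P : Ideal (𝓞 K)} :
    P ∈ primesAbove K q ↔ P.IsPrime ∧ (q : 𝓞 K) ∈ P := by
  rw [primesAbove, Multiset.mem_toFinset, Ideal.mem_normalizedFactors_iff (span_natCast_ne_bot hq),
    span_singleton_le_iff_mem]

lemma prime_of_mem_primesAbove {q : ℕ} {P : Ideal (𝓞 K)} (hP : P ∈ primesAbove K q) :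
    Prime P := by
  rw [primesAbove, Multiset.mem_toFinset] at hP
  exact prime_of_normalized_factor P hP

lemma dvd_absNorm_of_mem_primesAbove {q : ℕ} (hq : q.Prime) {P : Ideal (𝓞 K)}
    (hP : P ∈ primesAbove K q) : q ∣ absNorm P := by
  have h := (mem_primesAbove hq.ne_zero).1 hP
  have hdvd : absNorm P ∣ q ^ finrank ℚ K := by
    rw [← RingOfIntegers.rank, ← absNorm_span_natCast]
    exact absNorm_dvd_absNorm_of_le ((span_singleton_le_iff_mem _).2 h.2)
  obtain ⟨f, -, hf⟩ := (Nat.dvd_prime_pow hq).1 hdvd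
  have hf0 : f ≠ 0 := by
    rintro rfl
    rw [pow_zero, absNorm_eq_one_iff] at hf
    exact h.1.ne_top hf
  rw [hf]
  exact dvd_pow_self q hf0

lemma le_absNorm_of_mem_primesAbove {q : ℕ} (hq : q.Prime) {P : Ideal (𝓞 K)}
    (hP : P ∈ primesAbove K q) : q ≤ absNorm P := by
  refine Nat.le_of_dvd (Nat.pos_of_ne_zero ?_) (dvd_absNorm_of_mem_primesAbove hq hP)
  exact absNorm_eq_zero_iff.not.2 (prime_of_mem_primesAbove hP).ne_zero

lemma prod_dvd_span_natCast {q : ℕ} {S : Finset (Ideal (𝓞 K))}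
    (hS : S ⊆ primesAbove K q) : ∏ P ∈ S, P ∣ span {(q : 𝓞 K)} := by
  refine Finset.prod_primes_dvd _ (fun P hP ↦ prime_of_mem_primesAbove (hS hP)) fun P hP ↦ ?_
  exact dvd_of_mem_normalizedFactors (Multiset.mem_toFinset.1 (hS hP))

lemma prod_absNorm_primesAbove_le {q : ℕ} (hq : q ≠ 0) :
    ∏ P ∈ primesAbove K q, absNorm P ≤ q ^ finrank ℚ K := by
  have h := map_dvd (absNorm (S := 𝓞 K)) (prod_dvd_span_natCast (subset_refl (primesAbove K q)))
  rw [map_prod, absNorm_span_natCast, RingOfIntegers.rank] at h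
  exact Nat.le_of_dvd (by positivity) h

lemma card_primesAbove_le {q : ℕ} (hq : q.Prime) : (primesAbove K q).card ≤ finrank ℚ K := by
  refine (Nat.pow_le_pow_iff_right hq.one_lt).1 (le_trans ?_
    (prod_absNorm_primesAbove_le hq.ne_zero))
  exact Finset.pow_card_le_prod _ _ _ fun P hP ↦ le_absNorm_of_mem_primesAbove hq hP

lemma card_erase_primesAbove_le {q : ℕ} (hq : q.Prime) {P : Ideal (𝓞 K)}
    (hP : P ∈ primesAbove K q) {f : ℕ} (hf : q ^ f ≤ absNorm P) :
    ((primesAbove K q).erase P).card + f ≤ finrank ℚ K := by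
  refine (Nat.pow_le_pow_iff_right hq.one_lt).1 (le_trans ?_
    (prod_absNorm_primesAbove_le hq.ne_zero))
  rw [← Finset.prod_erase_mul _ _ hP, pow_add]
  gcongr
  exact Finset.pow_card_le_prod _ _ _ fun Q hQ ↦
    le_absNorm_of_mem_primesAbove hq (Finset.mem_of_mem_erase hQ)

lemma eq_prod_primesAbove {q k : ℕ} (hq : q.Prime) {I : Ideal (𝓞 K)} (hI : absNorm I = q ^ k) :
    I = ∏ P ∈ primesAbove K q, P ^ (normalizedFactors I).count P := by
  have hI0 : I ≠ ⊥ := by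
    rintro rfl
    rw [absNorm_bot] at hI
    exact pow_ne_zero k hq.ne_zero hI.symm
  rw [← Finset.prod_multiset_count_of_subset]
  · exact (Ideal.prod_normalizedFactors_eq_self hI0).symm
  · intro P hP
    rw [Multiset.mem_toFinset] at hP
    have h := (Ideal.mem_normalizedFactors_iff hI0).1 hP
    refine (mem_primesAbove hq.ne_zero).2 ⟨h.1, ?_⟩
    have h2 := h.2 (absNorm_mem I)
    rw [hI] at h2
    exact h.1.mem_of_pow_mem k (by exact_mod_cast h2)

lemma factorization_absNorm_pos {q : ℕ} (hq : q.Prime) {P : Ideal (𝓞 K)}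
    (hP : P ∈ primesAbove K q) : 0 < (absNorm P).factorization q := by
  refine hq.factorization_pos_of_dvd ?_ (dvd_absNorm_of_mem_primesAbove hq hP)
  exact absNorm_eq_zero_iff.not.2 (prime_of_mem_primesAbove hP).ne_zero

lemma sum_count_mul_factorization {q k : ℕ} (hq : q.Prime) {I : Ideal (𝓞 K)}
    (hI : absNorm I = q ^ k) :
    ∑ P ∈ primesAbove K q, (normalizedFactors I).count P * (absNorm P).factorization q = k := by
  have h := congrArg absNorm (eq_prod_primesAbove hq hI)
  rw [hI, map_prod] at h
  have h2 := congrArg (fun n : ℕ ↦ n.factorization q) h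
  simp only [map_pow] at h2
  rw [hq.factorization_pow, Finsupp.single_eq_same, Nat.factorization_prod] at h2
  · rw [h2]
    simp [Finsupp.finsetSum_apply]
  · exact fun P hP ↦ pow_ne_zero _
      (absNorm_eq_zero_iff.not.2 (prime_of_mem_primesAbove hP).ne_zero)

lemma idealCount_prime_pow_le_multichoose {q : ℕ} (hq : q.Prime) (k : ℕ) :
    idealCount K (q ^ k) ≤ Nat.multichoose (primesAbove K q).card k := by
  rw [← Finset.card_finsuppAntidiag_nat_eq_multichoose, ← Fintype.card_coe,
    ← Nat.card_eq_fintype_card]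
  let e (I : Ideal (𝓞 K)) : Ideal (𝓞 K) →₀ ℕ := Finsupp.onFinset (primesAbove K q)
    (fun P ↦ if P ∈ primesAbove K q then
      (normalizedFactors I).count P * (absNorm P).factorization q else 0)
    (fun P hP ↦ by by_contra h; simp [h] at hP)
  have he (I : Ideal (𝓞 K)) {P : Ideal (𝓞 K)} (hP : P ∈ primesAbove K q) :
      e I P = (normalizedFactors I).count P * (absNorm P).factorization q := by
    simp [e, hP]
  refine Nat.card_le_card_of_injective (fun I ↦ ⟨e I.1, ?_⟩) ?_
  · rw [Finset.mem_finsuppAntidiag]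
    refine ⟨?_, Finsupp.support_onFinset_subset⟩
    rw [Finset.sum_congr rfl fun P hP ↦ he I.1 hP]
    exact sum_count_mul_factorization hq I.2
  · intro I J hIJ
    have h : e I.1 = e J.1 := congrArg Subtype.val hIJ
    refine Subtype.ext ?_
    rw [eq_prod_primesAbove hq I.2, eq_prod_primesAbove hq J.2]
    refine Finset.prod_congr rfl fun P hP ↦ ?_
    have h2 := DFunLike.congr_fun h P
    rw [he _ hP, he _ hP] at h2
    rw [Nat.eq_of_mul_eq_mul_right (factorization_absNorm_pos hq hP) h2]

lemma idealCount_prime_pow_le_half {q : ℕ} (hq : q.Prime) (k : ℕ) {P : Ideal (𝓞 K)}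
    (hP : P ∈ primesAbove K q) (hN : q ^ 2 ∣ absNorm P)
    (hcard : ((primesAbove K q).erase P).card ≤ 1) :
    idealCount K (q ^ k) ≤ k / 2 + 1 := by
  have hf : 2 ≤ (absNorm P).factorization q :=
    (hq.pow_dvd_iff_le_factorization
      (absNorm_eq_zero_iff.not.2 (prime_of_mem_primesAbove hP).ne_zero)).1 hN
  rw [← Nat.card_fin (k / 2 + 1)]
  refine Nat.card_le_card_of_injective (fun I ↦ ⟨(normalizedFactors I.1).count P, ?_⟩) ?_
  · have h := sum_count_mul_factorization hq I.2
    rw [← Finset.sum_erase_add _ _ hP] at h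
    have : (normalizedFactors I.1).count P * 2 ≤
      (normalizedFactors I.1).count P * (absNorm P).factorization q := by gcongr
    omega
  · intro I J hIJ
    have h : (normalizedFactors I.1).count P = (normalizedFactors J.1).count P :=
      congrArg Fin.val hIJ
    have hI := sum_count_mul_factorization hq I.2
    have hJ := sum_count_mul_factorization hq J.2
    rw [← Finset.sum_erase_add _ _ hP] at hI hJ
    refine Subtype.ext ?_
    rw [eq_prod_primesAbove hq I.2, eq_prod_primesAbove hq J.2, ← Finset.prod_erase_mul _ _ hP,
      ← Finset.prod_erase_mul _ _ hP, h]
    congr 1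
    rcases Finset.card_le_one_iff_subset_singleton.1 hcard with ⟨Q, hQ⟩
    rcases Finset.subset_singleton_iff.1 hQ with hQ | hQ
    · simp [hQ]
    · have hQ' : Q ∈ primesAbove K q := Finset.mem_of_mem_erase (hQ ▸ Finset.mem_singleton_self Q)
      rw [hQ, Finset.sum_singleton] at hI hJ
      rw [hQ, Finset.prod_singleton, Finset.prod_singleton]
      rw [h] at hI
      rw [Nat.eq_of_mul_eq_mul_right (factorization_absNorm_pos hq hQ')
        (Nat.add_right_cancel (hI.trans hJ.symm))]

lemma sup_mul_sup_eq_of_coprime {m n : ℕ} (h : m.Coprime n) {I : Ideal (𝓞 K)}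
    (hI : absNorm I = m * n) : (I ⊔ span {(m : 𝓞 K)}) * (I ⊔ span {(n : 𝓞 K)}) = I := by
  apply le_antisymm
  · rw [Ideal.mul_sup, Ideal.sup_mul, Ideal.sup_mul, span_singleton_mul_span_singleton]
    refine sup_le (sup_le Ideal.mul_le_left Ideal.mul_le_right) (sup_le ?_ ?_)
    · exact Ideal.mul_le_left
    · rw [span_singleton_le_iff_mem, ← Nat.cast_mul, ← hI]
      exact absNorm_mem I
  · have hc : span {(m : 𝓞 K)} ⊔ span {(n : 𝓞 K)} = ⊤ := by
      rw [← isCoprime_iff_sup_eq, isCoprime_span_singleton_iff]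
      exact h.cast
    calc I = I * (span {(m : 𝓞 K)} ⊔ span {(n : 𝓞 K)}) := by rw [hc, Ideal.mul_top]
      _ ≤ _ := by
        rw [Ideal.mul_sup]
        refine sup_le ?_ ?_
        · rw [mul_comm I]
          exact Ideal.mul_mono le_sup_right le_sup_left
        · exact Ideal.mul_mono le_sup_left le_sup_right

lemma absNorm_sup_dvd {m n : ℕ} (h : m.Coprime n) {I : Ideal (𝓞 K)}
    (hI : absNorm I = m * n) : absNorm (I ⊔ span {(m : 𝓞 K)}) ∣ m := by
  have h1 : absNorm (I ⊔ span {(m : 𝓞 K)}) ∣ m * n := hI ▸ absNorm_dvd_absNorm_of_le le_sup_left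
  have h2 : absNorm (I ⊔ span {(m : 𝓞 K)}) ∣ m ^ finrank ℤ (𝓞 K) := by
    rw [← absNorm_span_natCast]
    exact absNorm_dvd_absNorm_of_le le_sup_right
  exact (Nat.Coprime.of_dvd_left h2 (h.pow_left _)).dvd_of_dvd_mul_right h1

lemma absNorm_sup_eq {m n : ℕ} (hm : m ≠ 0) (hn : n ≠ 0) (h : m.Coprime n) {I : Ideal (𝓞 K)}
    (hI : absNorm I = m * n) :
    absNorm (I ⊔ span {(m : 𝓞 K)}) = m ∧ absNorm (I ⊔ span {(n : 𝓞 K)}) = n := by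
  have h1 := absNorm_sup_dvd h hI
  have h2 := absNorm_sup_dvd h.symm (hI.trans (mul_comm m n))
  have h3 := congrArg absNorm (sup_mul_sup_eq_of_coprime h hI)
  rw [map_mul, hI] at h3
  have h1' := Nat.le_of_dvd (Nat.pos_of_ne_zero hm) h1
  have h2' := Nat.le_of_dvd (Nat.pos_of_ne_zero hn) h2
  constructor <;> nlinarith [Nat.pos_of_ne_zero hm, Nat.pos_of_ne_zero hn]

lemma idealCount_mul_le {m n : ℕ} (hm : m ≠ 0) (hn : n ≠ 0) (h : m.Coprime n) :
    idealCount K (m * n) ≤ idealCount K m * idealCount K n := by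
  rw [idealCount, idealCount, idealCount, ← Nat.card_prod]
  refine Nat.card_le_card_of_injective
    (fun I ↦ (⟨I.1 ⊔ span {(m : 𝓞 K)}, (absNorm_sup_eq hm hn h I.2).1⟩,
      ⟨I.1 ⊔ span {(n : 𝓞 K)}, (absNorm_sup_eq hm hn h I.2).2⟩)) ?_
  intro I J hIJ
  have h1 := congrArg (fun x ↦ x.1.1) hIJ
  have h2 := congrArg (fun x ↦ x.2.1) hIJ
  simp only at h1 h2
  refine Subtype.ext ?_
  rw [← sup_mul_sup_eq_of_coprime h I.2, ← sup_mul_sup_eq_of_coprime h J.2, h1, h2]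

lemma idealCount_le_of_isMultiplicative {g : ArithmeticFunction ℤ} (hg : g.IsMultiplicative)
    (h : ∀ q k : ℕ, q.Prime → 0 < k → (idealCount K (q ^ k) : ℤ) ≤ g (q ^ k)) {n : ℕ}
    (hn : n ≠ 0) : (idealCount K n : ℤ) ≤ g n := by
  induction n using Nat.recOnPosPrimePosCoprime with
  | prime_pow q k hq hk => exact h q k hq hk
  | zero => exact absurd rfl hn
  | one => rw [idealCount_one, hg.map_one]; rfl
  | coprime a b ha hb hab iha ihb =>
    have ha0 : a ≠ 0 := by omega
    have hb0 : b ≠ 0 := by omega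
    rw [hg.map_mul_of_coprime hab]
    have h1 := iha ha0
    have h2 := ihb hb0
    have h3 := idealCount_mul_le (K := K) ha0 hb0 hab
    zify at h3
    exact h3.trans (mul_le_mul h1 h2 (by positivity) (le_trans (by positivity) h1))

end

end

section

open NumberField Module UniqueFactorizationMonoid Ideal
open scoped Classical

section

variable {K : Type*} [Field K] [NumberField K]

lemma absNorm_eq_or_sq_dvd {q : ℕ} (hq : q.Prime) {P : Ideal (𝓞 K)}
    (hP : P ∈ primesAbove K q) : absNorm P = q ∨ q ^ 2 ∣ absNorm P := by
  have hdvd : absNorm P ∣ q ^ finrank ℤ (𝓞 K) := by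
    rw [← absNorm_span_natCast]
    exact absNorm_dvd_absNorm_of_le
      ((span_singleton_le_iff_mem _).2 ((mem_primesAbove hq.ne_zero).1 hP).2)
  have h1 := dvd_absNorm_of_mem_primesAbove hq hP
  obtain ⟨f, -, hf⟩ := (Nat.dvd_prime_pow hq).1 hdvd
  rw [hf] at h1 ⊢
  rcases f with _ | _ | f
  · exact absurd (Nat.dvd_one.1 h1) hq.one_lt.ne'
  · simp
  · exact Or.inr (pow_dvd_pow _ (by omega))

lemma isMaximal_of_mem_primesAbove {q : ℕ} (hq : q.Prime) {P : Ideal (𝓞 K)}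
    (hP : P ∈ primesAbove K q) : P.IsMaximal :=
  ((mem_primesAbove hq.ne_zero).1 hP).1.isMaximal (prime_of_mem_primesAbove hP).ne_zero

lemma pow_quotient_eq {q : ℕ} (hq : q.Prime) {P : Ideal (𝓞 K)}
    (hP : P ∈ primesAbove K q) (hN : absNorm P = q) (x : 𝓞 K ⧸ P) : x ^ q = x := by
  have := isMaximal_of_mem_primesAbove hq hP
  let := Ideal.Quotient.field P
  have hcard : Nat.card (𝓞 K ⧸ P) = q := by
    rw [← hN, absNorm_apply, Submodule.cardQuot_apply]
  have : Finite (𝓞 K ⧸ P) := Nat.finite_of_card_ne_zero (hcard ▸ hq.ne_zero)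
  have := Fintype.ofFinite (𝓞 K ⧸ P)
  have h := FiniteField.pow_card x
  rwa [← Nat.card_eq_fintype_card, hcard] at h

lemma intCast_mem_iff {q : ℕ} (hq : q.Prime) {P : Ideal (𝓞 K)} (hP : P ∈ primesAbove K q)
    (n : ℤ) : (n : 𝓞 K) ∈ P ↔ (q : ℤ) ∣ n := by
  have hP' := (mem_primesAbove hq.ne_zero).1 hP
  constructor
  · intro h
    by_contra hn
    obtain ⟨a, b, hab⟩ := (Nat.prime_iff_prime_int.1 hq).coprime_iff_not_dvd.2 hn
    refine hP'.1.ne_top ((Ideal.eq_top_iff_one _).2 ?_)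
    have := congrArg (Int.cast : ℤ → 𝓞 K) hab
    push_cast at this
    rw [← this]
    exact P.add_mem (P.mul_mem_left _ hP'.2) (P.mul_mem_left _ h)
  · rintro ⟨m, rfl⟩
    push_cast
    exact P.mul_mem_right _ hP'.2

lemma cube_root_sub_mem {q : ℕ} (hq : q.Prime) (hq3 : q % 3 = 2) {P : Ideal (𝓞 K)}
    (hP : P ∈ primesAbove K q) (hN : absNorm P = q) {p : ℕ} {θ : 𝓞 K}
    (hθ : θ ^ 3 = (p : 𝓞 K)) : θ - (p : 𝓞 K) ^ ((2 * q - 1) / 3) ∈ P := by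
  rw [← Ideal.Quotient.eq, ← hθ, ← pow_mul,
    show 3 * ((2 * q - 1) / 3) = q + (q - 1) by omega, pow_add, map_mul, map_pow, map_pow,
    pow_quotient_eq hq hP hN, mul_pow_sub_one hq.ne_zero, pow_quotient_eq hq hP hN]

lemma natCast_dvd_of_forall_mem {q : ℕ} (hq : q.Prime) (hq3 : q ≠ 3) {θ : 𝓞 K} {r : ℤ}
    (hr : ¬ (q : ℤ) ∣ r) (hdvd : (q : 𝓞 K) ∣ θ ^ 3 - r ^ 3)
    (h : ∀ P ∈ primesAbove K q, θ - r ∈ P) : (q : 𝓞 K) ∣ θ - r := by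
  have hc : IsCoprime (q : 𝓞 K) (θ ^ 2 + r * θ + r ^ 2) := by
    rw [← isCoprime_span_singleton_iff, isCoprime_iff_sup_eq]
    by_contra htop
    obtain ⟨P, hPm, hP⟩ := Ideal.exists_le_maximal _ htop
    rw [sup_le_iff, span_singleton_le_iff_mem, span_singleton_le_iff_mem] at hP
    have hPq : P ∈ primesAbove K q := (mem_primesAbove hq.ne_zero).2 ⟨hPm.isPrime, hP.1⟩
    have h3 : ((3 * r ^ 2 : ℤ) : 𝓞 K) ∈ P := by
      have : ((3 * r ^ 2 : ℤ) : 𝓞 K) =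
          (θ ^ 2 + r * θ + r ^ 2) - (θ - r) * (θ + 2 * r) := by push_cast; ring
      rw [this]
      exact P.sub_mem hP.2 (P.mul_mem_right _ (h P hPq))
    rw [intCast_mem_iff hq hPq] at h3
    have hqp := Nat.prime_iff_prime_int.1 hq
    rcases hqp.dvd_or_dvd h3 with h3 | h3
    · have : q ∣ 3 := by exact_mod_cast h3
      exact hq3 ((Nat.prime_dvd_prime_iff_eq hq Nat.prime_three).1 this)
    · exact hr (hqp.dvd_of_dvd_pow h3)
  refine hc.dvd_of_dvd_mul_right ?_
  convert hdvd using 1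
  ring

variable (h3 : finrank ℚ K = 3) (v : {w : InfinitePlace K // w.IsReal})
  (w : {w : InfinitePlace K // w.IsComplex}) {p : ℕ} (hp : p.Prime) {θ : 𝓞 K}
  (hθ : θ ^ 3 = (p : 𝓞 K))

include h3 v w hp hθ

lemma trace_int_cube_root :
    Algebra.trace ℤ (𝓞 K) θ = 0 ∧ Algebra.trace ℤ (𝓞 K) (θ ^ 2) = 0 := by
  have hθ' : (θ : K) ^ 3 = (p : K) := by exact_mod_cast congrArg (algebraMap (𝓞 K) K) hθ
  have h := trace_cube_root h3 v w hp hθ'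
  constructor
  · have h1 := Algebra.coe_trace_int θ
    rw [h.1] at h1
    exact_mod_cast h1
  · have h1 := Algebra.coe_trace_int (θ ^ 2)
    rw [show ((θ ^ 2 : 𝓞 K) : K) = (θ : K) ^ 2 by push_cast; rfl, h.2] at h1
    exact_mod_cast h1

lemma exists_sq_dvd_absNorm {q : ℕ} (hq : q.Prime) (hq3 : q % 3 = 2) (hqp : q ≠ p) :
    ∃ P ∈ primesAbove K q, q ^ 2 ∣ absNorm P := by
  by_contra! hcon
  have hN (P : Ideal (𝓞 K)) (hP : P ∈ primesAbove K q) : absNorm P = q :=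
    (absNorm_eq_or_sq_dvd hq hP).resolve_right (hcon P hP)
  set r : ℤ := (p : ℤ) ^ ((2 * q - 1) / 3) with hr
  have hrp : ¬ (q : ℤ) ∣ r := by
    intro h
    have := (Nat.prime_iff_prime_int.1 hq).dvd_of_dvd_pow h
    exact hqp ((Nat.prime_dvd_prime_iff_eq hq hp).1 (by exact_mod_cast this))
  have hdvd : (q : ℤ) ∣ p - r ^ 3 := by
    have := Fact.mk hq
    rw [← ZMod.intCast_zmod_eq_zero_iff_dvd, hr, ← pow_mul,
      show (2 * q - 1) / 3 * 3 = q + (q - 1) by omega, pow_add]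
    push_cast
    rw [ZMod.pow_card, mul_pow_sub_one hq.ne_zero, ZMod.pow_card, sub_self]
  have hdvd' : (q : 𝓞 K) ∣ θ ^ 3 - r ^ 3 := by
    rw [hθ]
    have := map_dvd (Int.castRingHom (𝓞 K)) hdvd
    simpa using this
  obtain ⟨x, hx⟩ := natCast_dvd_of_forall_mem hq (by omega) hrp hdvd' fun P hP ↦ by
    have := cube_root_sub_mem hq hq3 hP (hN P hP) hθ
    rw [hr]
    push_cast
    exact this
  have htr := congrArg (Algebra.trace ℤ (𝓞 K)) hx
  rw [map_sub, (trace_int_cube_root h3 v w hp hθ).1, ← eq_intCast (algebraMap ℤ (𝓞 K)),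
    Algebra.trace_algebraMap, RingOfIntegers.rank, h3, ← nsmul_eq_mul, map_nsmul] at htr
  simp only [nsmul_eq_mul] at htr
  have h3r : (q : ℤ) ∣ 3 * r := ⟨-Algebra.trace ℤ (𝓞 K) x, by push_cast at htr; linarith⟩
  rcases (Nat.prime_iff_prime_int.1 hq).dvd_or_dvd h3r with h | h
  · have := (Nat.prime_dvd_prime_iff_eq hq Nat.prime_three).1 (by exact_mod_cast h)
    omega
  · exact hrp h

omit v w in
lemma card_primesAbove_self_le : (primesAbove K p).card ≤ 1 := by
  rw [Finset.card_le_one_iff_subset_singleton]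
  have hprime : (span {θ}).IsPrime := by
    refine Ideal.isPrime_of_irreducible_absNorm ?_
    rw [absNorm_span_singleton, norm_cube_root h3 hθ]
    simpa using hp.prime.irreducible
  have hne : span {θ} ≠ ⊥ := by
    rw [Ne, span_singleton_eq_bot]
    rintro rfl
    rw [zero_pow (by norm_num)] at hθ
    exact hp.ne_zero (by exact_mod_cast hθ.symm)
  refine ⟨span {θ}, fun P hP ↦ Finset.mem_singleton.2 ?_⟩
  obtain ⟨h1, h2⟩ := (mem_primesAbove hp.ne_zero).1 hP
  refine ((hprime.isMaximal hne).eq_of_le h1.ne_top ?_).symm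
  rw [span_singleton_le_iff_mem]
  rw [← hθ] at h2
  exact h1.mem_of_pow_mem 3 h2

omit h3 v w hp in
lemma cube_root_sub_natCast_mem_of_three {P : Ideal (𝓞 K)} (hP : P ∈ primesAbove K 3) :
    θ - p ∈ P := by
  obtain ⟨h1, h2⟩ := (mem_primesAbove (by norm_num)).1 hP
  refine h1.mem_of_pow_mem 3 ?_
  have hdvd : (3 : ℤ) ∣ p - p ^ 3 := by
    rw [Int.dvd_iff_emod_eq_zero, Int.sub_emod, pow_succ, pow_two, Int.mul_emod,
      Int.mul_emod (p : ℤ) p]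
    have h3 : (p : ℤ) % 3 = 0 ∨ (p : ℤ) % 3 = 1 ∨ (p : ℤ) % 3 = 2 := by omega
    rcases h3 with h | h | h <;> rw [h] <;> norm_num
  obtain ⟨m, hm⟩ := hdvd
  have hm' := congrArg (Int.cast : ℤ → 𝓞 K) hm
  push_cast at hm' h2
  have : (θ - p) ^ 3 = 3 * (m - p * θ ^ 2 + p ^ 2 * θ) := by
    linear_combination hθ + hm'
  rw [this]
  exact P.mul_mem_right _ h2

omit h3 v w hp in
lemma card_primesAbove_three_le_one
    (hspan : Submodule.span ℤ (Set.range fun i : Fin 3 ↦ θ ^ (i : ℕ)) = ⊤) :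
    (primesAbove K 3).card ≤ 1 := by
  rw [Finset.card_le_one_iff]
  have hle {P Q : Ideal (𝓞 K)} (hP : P ∈ primesAbove K 3) (hQ : Q ∈ primesAbove K 3) :
      P ≤ Q := by
    intro x hx
    have hxs : x ∈ Submodule.span ℤ (Set.range fun i : Fin 3 ↦ θ ^ (i : ℕ)) := hspan ▸ trivial
    obtain ⟨c, rfl⟩ := (Submodule.mem_span_range_iff_exists_fun ℤ).1 hxs
    rw [Fin.sum_univ_three] at hx ⊢
    have key : c 0 • θ ^ ((0 : Fin 3) : ℕ) + c 1 • θ ^ ((1 : Fin 3) : ℕ) +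
        c 2 • θ ^ ((2 : Fin 3) : ℕ) = (θ - p) * (c 1 + c 2 * (θ + p)) +
          ((c 0 + c 1 * p + c 2 * p ^ 2 : ℤ) : 𝓞 K) := by
      simp
      ring
    rw [key] at hx ⊢
    have hP1 := cube_root_sub_natCast_mem_of_three hθ hP
    have hQ1 := cube_root_sub_natCast_mem_of_three hθ hQ
    rw [P.add_mem_iff_right (P.mul_mem_right _ hP1), intCast_mem_iff Nat.prime_three hP] at hx
    rw [Q.add_mem_iff_right (Q.mul_mem_right _ hQ1), intCast_mem_iff Nat.prime_three hQ]
    exact hx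
  exact fun {P Q} hP hQ ↦ le_antisymm (hle hP hQ) (hle hQ hP)

lemma card_primesAbove_three_le_two (hp3 : p ≠ 3) : (primesAbove K 3).card ≤ 2 := by
  by_contra! hcard
  have hdvd := prod_dvd_span_natCast (subset_refl (primesAbove K 3))
  obtain ⟨J, hJ⟩ := hdvd
  have hJN := congrArg absNorm hJ
  rw [absNorm_span_natCast, RingOfIntegers.rank, h3, map_mul, map_prod] at hJN
  have hge : 3 ^ 3 ≤ ∏ P ∈ primesAbove K 3, absNorm P :=
    (Nat.pow_le_pow_right (by norm_num) hcard).trans (Finset.pow_card_le_prod _ _ _ fun P hP ↦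
      le_absNorm_of_mem_primesAbove Nat.prime_three hP)
  have hJ1 : absNorm J = 1 := by
    have hJ0 : absNorm J ≠ 0 := fun h ↦ by rw [h] at hJN; norm_num at hJN
    have : 1 ≤ absNorm J := Nat.one_le_iff_ne_zero.2 hJ0
    nlinarith
  rw [absNorm_eq_one_iff] at hJ1
  rw [hJ1, Ideal.mul_top] at hJ
  have hmem : span {θ - (p : 𝓞 K)} ≤ span {((3 : ℕ) : 𝓞 K)} := by
    rw [hJ, ← Ideal.dvd_iff_le]
    refine Finset.prod_primes_dvd _ (fun P hP ↦ prime_of_mem_primesAbove hP) fun P hP ↦ ?_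
    rw [Ideal.dvd_iff_le, span_singleton_le_iff_mem]
    exact cube_root_sub_natCast_mem_of_three hθ hP
  obtain ⟨γ, hγ⟩ := span_singleton_le_span_singleton.1 hmem
  have htr := congrArg (Algebra.trace ℤ (𝓞 K)) (congrArg (· ^ 2) hγ)
  have h0 := trace_int_cube_root h3 v w hp hθ
  have e1 : (θ - (p : 𝓞 K)) ^ 2 = θ ^ 2 - (2 * p) • θ + algebraMap ℤ (𝓞 K) (p ^ 2) := by
    simp; ring
  have e2 : (((3 : ℕ) : 𝓞 K) * γ) ^ 2 = 9 • γ ^ 2 := by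
    simp; ring
  simp only [e1, e2] at htr
  rw [map_add, map_sub, map_nsmul, map_nsmul, h0.1, h0.2, Algebra.trace_algebraMap,
    RingOfIntegers.rank, h3] at htr
  simp only [nsmul_eq_mul] at htr
  push_cast at htr
  have : (3 : ℤ) ∣ p ^ 2 := ⟨Algebra.trace ℤ (𝓞 K) (γ ^ 2), by linarith⟩
  have := Int.prime_three.dvd_of_dvd_pow this
  exact hp3 ((Nat.prime_dvd_prime_iff_eq Nat.prime_three hp).1 (by exact_mod_cast this)).symm

end

end

section

open NumberField Module UniqueFactorizationMonoid Ideal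
open scoped Classical ArithmeticFunction ArithmeticFunction.zeta

section

/-- The nontrivial Dirichlet character modulo `3`. -/
def chiThree : ArithmeticFunction ℤ :=
  ⟨fun n ↦ if n % 3 = 1 then 1 else if n % 3 = 2 then -1 else 0, rfl⟩

/-- The indicator function of the integers prime to `3`. -/
def coprimeThree : ArithmeticFunction ℤ := ⟨fun n ↦ if n % 3 = 0 then 0 else 1, rfl⟩

lemma chiThree_apply (n : ℕ) :
    chiThree n = if n % 3 = 1 then 1 else if n % 3 = 2 then -1 else 0 := rfl

lemma coprimeThree_apply (n : ℕ) : coprimeThree n = if n % 3 = 0 then 0 else 1 := rfl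

lemma chiThree_mul (m n : ℕ) : chiThree (m * n) = chiThree m * chiThree n := by
  simp only [chiThree_apply, Nat.mul_mod m n]
  have hm : m % 3 = 0 ∨ m % 3 = 1 ∨ m % 3 = 2 := by omega
  have hn : n % 3 = 0 ∨ n % 3 = 1 ∨ n % 3 = 2 := by omega
  rcases hm with hm | hm | hm <;> rcases hn with hn | hn | hn <;> simp [hm, hn]

lemma coprimeThree_mul (m n : ℕ) :
    coprimeThree (m * n) = coprimeThree m * coprimeThree n := by
  simp only [coprimeThree_apply, Nat.mul_mod m n]
  have hm : m % 3 = 0 ∨ m % 3 = 1 ∨ m % 3 = 2 := by omega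
  have hn : n % 3 = 0 ∨ n % 3 = 1 ∨ n % 3 = 2 := by omega
  rcases hm with hm | hm | hm <;> rcases hn with hn | hn | hn <;> simp [hm, hn]

lemma isMultiplicative_chiThree : chiThree.IsMultiplicative :=
  ⟨rfl, fun _ ↦ chiThree_mul _ _⟩

lemma isMultiplicative_coprimeThree : coprimeThree.IsMultiplicative :=
  ⟨rfl, fun _ ↦ coprimeThree_mul _ _⟩

lemma isMultiplicative_intCast_zeta : (ζ : ArithmeticFunction ℤ).IsMultiplicative :=
  ArithmeticFunction.isMultiplicative_zeta.natCast

lemma chiThree_pow (q k : ℕ) : chiThree (q ^ k) = chiThree q ^ k := by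
  induction k with
  | zero => simp only [pow_zero]; rfl
  | succ k ih => rw [pow_succ, chiThree_mul, ih, pow_succ]

lemma coprimeThree_pow (q k : ℕ) : coprimeThree (q ^ k) = coprimeThree q ^ k := by
  induction k with
  | zero => simp only [pow_zero]; rfl
  | succ k ih => rw [pow_succ, coprimeThree_mul, ih, pow_succ]

lemma ArithmeticFunction.mul_prime_pow {R : Type*} [Semiring R] (f g : ArithmeticFunction R)
    {q : ℕ} (hq : q.Prime) (k : ℕ) :
    (f * g) (q ^ k) = ∑ i ∈ Finset.range (k + 1), f (q ^ i) * g (q ^ (k - i)) := by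
  rw [ArithmeticFunction.mul_apply, Nat.sum_divisorsAntidiagonal fun x y ↦ f x * g y,
    Nat.sum_divisors_prime_pow hq]
  refine Finset.sum_congr rfl fun i hi ↦ ?_
  rw [Nat.pow_div (by simpa [Nat.lt_succ_iff] using hi) hq.pos]

variable {f : ArithmeticFunction ℤ}

lemma chiThree_mul_prime_pow (hf : ∀ n, n % 3 ≠ 0 → f n = 1) {q : ℕ} (hq : q.Prime)
    (hq3 : q % 3 ≠ 0) (k : ℕ) :
    (chiThree * f) (q ^ k) = ∑ i ∈ Finset.range (k + 1), chiThree q ^ i := by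
  rw [ArithmeticFunction.mul_prime_pow _ _ hq]
  refine Finset.sum_congr rfl fun i hi ↦ ?_
  rw [chiThree_pow, hf, mul_one]
  intro h
  have : 3 ∣ q := Nat.prime_three.dvd_of_dvd_pow (Nat.dvd_of_mod_eq_zero h)
  omega

lemma chiThree_mul_prime_pow_of_one (hf : ∀ n, n % 3 ≠ 0 → f n = 1) {q : ℕ} (hq : q.Prime)
    (hq3 : q % 3 = 1) (k : ℕ) : (chiThree * f) (q ^ k) = k + 1 := by
  rw [chiThree_mul_prime_pow hf hq (by omega), chiThree_apply, if_pos hq3]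
  simp

lemma chiThree_mul_prime_pow_of_two (hf : ∀ n, n % 3 ≠ 0 → f n = 1) {q : ℕ} (hq : q.Prime)
    (hq3 : q % 3 = 2) (k : ℕ) : (chiThree * f) (q ^ k) = 1 - (k % 2 : ℕ) := by
  rw [chiThree_mul_prime_pow hf hq (by omega), chiThree_apply, if_neg (by omega), if_pos hq3]
  induction k with
  | zero => simp
  | succ k ih =>
    rw [Finset.sum_range_succ, ih]
    rcases Nat.even_or_odd k with h | h
    · rw [h.add_one.neg_one_pow]
      obtain ⟨j, rfl⟩ := h
      omega
    · rw [h.add_one.neg_one_pow]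
      obtain ⟨j, rfl⟩ := h
      omega

lemma chiThree_mul_three_pow (k : ℕ) : (chiThree * f) (3 ^ k) = f (3 ^ k) := by
  rw [ArithmeticFunction.mul_prime_pow _ _ Nat.prime_three, Finset.sum_range_succ']
  simp [chiThree_pow, show chiThree 3 = 0 from rfl, show chiThree 1 = 1 from rfl]

lemma chiThree_mul_nonneg (hm : f.IsMultiplicative) (hf : ∀ n, n % 3 ≠ 0 → f n = 1)
    (hf0 : ∀ n, 0 ≤ f n) (n : ℕ) : 0 ≤ (chiThree * f) n := by
  induction n using Nat.recOnPosPrimePosCoprime with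
  | prime_pow q k hq hk =>
    have h : q % 3 = 0 ∨ q % 3 = 1 ∨ q % 3 = 2 := by omega
    rcases h with h | h | h
    · obtain rfl := (Nat.prime_dvd_prime_iff_eq Nat.prime_three hq).1 (Nat.dvd_of_mod_eq_zero h)
      rw [chiThree_mul_three_pow]
      exact hf0 _
    · rw [chiThree_mul_prime_pow_of_one hf hq h]
      positivity
    · rw [chiThree_mul_prime_pow_of_two hf hq h]
      omega
  | zero => simp
  | one => simp [(isMultiplicative_chiThree.mul hm).map_one]
  | coprime a b ha hb hab iha ihb =>
    rw [(isMultiplicative_chiThree.mul hm).map_mul_of_coprime hab]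
    exact mul_nonneg iha ihb

lemma chiThree_mul_zeta_prime_pow {q : ℕ} (hq : q.Prime) (k : ℕ) :
    (chiThree * f * (ζ : ArithmeticFunction ℤ)) (q ^ k) =
      ∑ i ∈ Finset.range (k + 1), (chiThree * f) (q ^ i) := by
  rw [ArithmeticFunction.coe_mul_zeta_apply, Nat.sum_divisors_prime_pow hq]

lemma Nat.multichoose_le_multichoose {m n : ℕ} (h : m ≤ n) (k : ℕ) :
    m.multichoose k ≤ n.multichoose k := by
  induction n, h using Nat.le_induction with
  | base => rfl
  | succ n _ ih =>
    refine ih.trans ?_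
    cases k with
    | zero => simp
    | succ k => rw [Nat.multichoose_succ_succ]; omega

lemma sum_range_add_one_eq_multichoose (k : ℕ) :
    ∑ i ∈ Finset.range (k + 1), ((i : ℤ) + 1) = Nat.multichoose 3 k := by
  induction k with
  | zero => simp
  | succ k ih =>
    rw [Finset.sum_range_succ, ih, Nat.multichoose_succ_succ, Nat.multichoose_two]
    push_cast
    ring

lemma sum_range_parity (k : ℕ) :
    ∑ i ∈ Finset.range (k + 1), (1 - ((i % 2 : ℕ) : ℤ)) = k / 2 + 1 := by
  induction k with
  | zero => simp
  | succ k ih =>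
    rw [Finset.sum_range_succ, ih]
    omega

variable {K : Type*} [Field K] [NumberField K]

lemma idealCount_le_of_three (h3 : finrank ℚ K = 3) (v : {w : InfinitePlace K // w.IsReal})
    (w : {w : InfinitePlace K // w.IsComplex}) {p : ℕ} (hp : p.Prime) {θ : 𝓞 K}
    (hθ : θ ^ 3 = (p : 𝓞 K)) (hm : f.IsMultiplicative) (hf : ∀ n, n % 3 ≠ 0 → f n = 1)
    (hthree : ∀ k, 0 < k → (idealCount K (3 ^ k) : ℤ) ≤
      ∑ i ∈ Finset.range (k + 1), f (3 ^ i)) {n : ℕ} (hn : n ≠ 0) :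
    (idealCount K n : ℤ) ≤ (chiThree * f * (ζ : ArithmeticFunction ℤ)) n := by
  refine idealCount_le_of_isMultiplicative
    ((isMultiplicative_chiThree.mul hm).mul isMultiplicative_intCast_zeta) ?_ hn
  intro q k hq hk
  rw [chiThree_mul_zeta_prime_pow hq]
  have h : q % 3 = 0 ∨ q % 3 = 1 ∨ q % 3 = 2 := by omega
  rcases h with h | h | h
  · obtain rfl := (Nat.prime_dvd_prime_iff_eq Nat.prime_three hq).1 (Nat.dvd_of_mod_eq_zero h)
    simp_rw [chiThree_mul_three_pow]
    exact hthree k hk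
  · simp_rw [chiThree_mul_prime_pow_of_one hf hq h]
    rw [sum_range_add_one_eq_multichoose]
    exact_mod_cast (idealCount_prime_pow_le_multichoose hq k).trans
      (Nat.multichoose_le_multichoose (h3 ▸ card_primesAbove_le hq) k)
  · simp_rw [chiThree_mul_prime_pow_of_two hf hq h]
    rw [sum_range_parity]
    by_cases hqp : q = p
    · subst hqp
      have := (idealCount_prime_pow_le_multichoose hq k).trans
        (Nat.multichoose_le_multichoose (card_primesAbove_self_le h3 hp hθ) k)
      rw [Nat.multichoose_one] at this
      omega
    · obtain ⟨P, hP, hN⟩ := exists_sq_dvd_absNorm h3 v w hp hθ hq h hqp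
      have hN0 : absNorm P ≠ 0 :=
        absNorm_eq_zero_iff.not.2 (prime_of_mem_primesAbove hP).ne_zero
      have hc := card_erase_primesAbove_le hq hP (Nat.le_of_dvd (Nat.pos_of_ne_zero hN0) hN)
      have := idealCount_prime_pow_le_half hq k hP hN (by omega)
      omega

lemma idealCount_le_zeta (h3 : finrank ℚ K = 3) (v : {w : InfinitePlace K // w.IsReal})
    (w : {w : InfinitePlace K // w.IsComplex}) {p : ℕ} (hp : p.Prime) (hp3 : p ≠ 3) {θ : 𝓞 K}
    (hθ : θ ^ 3 = (p : 𝓞 K)) {n : ℕ} (hn : n ≠ 0) :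
    (idealCount K n : ℤ) ≤
      (chiThree * (ζ : ArithmeticFunction ℤ) * (ζ : ArithmeticFunction ℤ)) n := by
  refine idealCount_le_of_three h3 v w hp hθ isMultiplicative_intCast_zeta ?_ ?_ hn
  · intro n hn
    have : n ≠ 0 := by rintro rfl; simp at hn
    simp [this]
  · intro k _
    have := (idealCount_prime_pow_le_multichoose Nat.prime_three k).trans
      (Nat.multichoose_le_multichoose (card_primesAbove_three_le_two h3 v w hp hθ hp3) k)
    rw [Nat.multichoose_two] at this
    simp
    exact_mod_cast this

lemma idealCount_le_coprimeThree (h3 : finrank ℚ K = 3) (v : {w : InfinitePlace K // w.IsReal})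
    (w : {w : InfinitePlace K // w.IsComplex}) {p : ℕ} (hp : p.Prime) {θ : 𝓞 K}
    (hθ : θ ^ 3 = (p : 𝓞 K))
    (hspan : Submodule.span ℤ (Set.range fun i : Fin 3 ↦ θ ^ (i : ℕ)) = ⊤) {n : ℕ}
    (hn : n ≠ 0) :
    (idealCount K n : ℤ) ≤ (chiThree * coprimeThree * (ζ : ArithmeticFunction ℤ)) n := by
  refine idealCount_le_of_three h3 v w hp hθ isMultiplicative_coprimeThree ?_ ?_ hn
  · intro n hn
    rw [coprimeThree_apply, if_neg hn]
  · intro k _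
    have := (idealCount_prime_pow_le_multichoose Nat.prime_three k).trans
      (Nat.multichoose_le_multichoose (card_primesAbove_three_le_one hθ hspan) k)
    rw [Nat.multichoose_one] at this
    rw [Finset.sum_range_succ']
    simp [coprimeThree_pow, show coprimeThree 3 = 0 from rfl, show coprimeThree 1 = 1 from rfl]
    exact this

end

section

lemma sum_chiThree_mul_le {F : ℕ → ℤ} (hF : ∀ m n, 0 < m → m ≤ n → F n ≤ F m) {J K : ℕ}
    (hJK : J ≤ K) :
    ∑ e ∈ Finset.range (3 * K + 2), chiThree e * F e ≤
      ∑ e ∈ Finset.range (3 * J + 2), chiThree e * F e := by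
  induction K, hJK using Nat.le_induction with
  | base => rfl
  | succ K _ ih =>
    refine le_trans ?_ ih
    rw [show 3 * (K + 1) + 2 = 3 * K + 2 + 1 + 1 + 1 by ring, Finset.sum_range_succ,
      Finset.sum_range_succ, Finset.sum_range_succ]
    have h0 : chiThree (3 * K + 2) = -1 := by
      rw [chiThree_apply, if_neg (by omega), if_pos (by omega)]
    have h1 : chiThree (3 * K + 2 + 1) = 0 := by
      rw [chiThree_apply, if_neg (by omega), if_neg (by omega)]
    have h2 : chiThree (3 * K + 2 + 1 + 1) = 1 := by
      rw [chiThree_apply, if_pos (by omega)]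
    rw [h0, h1, h2]
    have := hF (3 * K + 2) (3 * K + 2 + 1 + 1) (by omega) (by omega)
    linarith

lemma sum_chiThree_mul_arith_le {f : ArithmeticFunction ℤ} (hf0 : ∀ n, 0 ≤ f n) (J v : ℕ) :
    ∑ d ∈ Finset.Ioc 0 v, (chiThree * f) d ≤
      ∑ e ∈ Finset.range (3 * J + 2), chiThree e * ∑ m ∈ Finset.Ioc 0 (v / e), f m := by
  rw [ArithmeticFunction.sum_Ioc_mul_eq_sum_sum]
  refine le_trans (le_of_eq ?_) (sum_chiThree_mul_le (J := J) (K := J + v) ?_ (by omega))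
  · refine Finset.sum_subset ?_ ?_
    · intro e he
      simp only [Finset.mem_Ioc, Finset.mem_range] at he ⊢
      omega
    · intro e _ he
      simp only [Finset.mem_Ioc, not_and_or, not_lt, not_le] at he
      rcases he with he | he
      · obtain rfl : e = 0 := by omega
        simp
      · rw [Nat.div_eq_of_lt he]
        simp
  · intro m n hm hmn
    refine Finset.sum_le_sum_of_subset_of_nonneg ?_ fun i _ _ ↦ hf0 i
    exact Finset.Ioc_subset_Ioc_right (Nat.div_le_div_left hmn hm)

lemma sum_coprimeThree (n : ℕ) :
    ∑ m ∈ Finset.Ioc 0 n, coprimeThree m = (n : ℤ) - n / 3 := by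
  induction n with
  | zero => simp
  | succ n ih =>
    rw [Finset.sum_Ioc_succ_top (by omega), ih, coprimeThree_apply]
    split_ifs <;> push_cast <;> omega

lemma sum_chiThree_mul_zeta_le (v : ℕ) :
    ∑ d ∈ Finset.Ioc 0 v, (chiThree * (ζ : ArithmeticFunction ℤ)) d ≤ v := by
  refine (sum_chiThree_mul_arith_le (fun n ↦ ?_) 0 v).trans ?_
  · rw [ArithmeticFunction.natCoe_apply]
    positivity
  · simp only [ArithmeticFunction.natCoe_apply, ← Nat.cast_sum, ArithmeticFunction.sum_Ioc_zeta]
    simp [Finset.sum_range_succ, chiThree_apply]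

lemma sum_chiThree_mul_coprimeThree_le (J v : ℕ) :
    ∑ d ∈ Finset.Ioc 0 v, (chiThree * coprimeThree) d ≤
      ∑ e ∈ Finset.range (3 * J + 2), chiThree e * (((v / e : ℕ) : ℤ) - (v / e : ℕ) / 3) := by
  simp_rw [← sum_coprimeThree]
  refine sum_chiThree_mul_arith_le (fun n ↦ ?_) J v
  rw [coprimeThree_apply]
  split_ifs <;> norm_num

lemma two_mul_sum_chiThree_mul_coprimeThree_le {v : ℕ} (hv : 8 ≤ v) :
    2 * ∑ d ∈ Finset.Ioc 0 v, (chiThree * coprimeThree) d ≤ v := by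
  by_cases h : v < 88
  · have h1 := sum_chiThree_mul_coprimeThree_le 7 v
    have key : ∀ v : ℕ, v < 88 → 8 ≤ v →
        2 * ∑ e ∈ Finset.range (3 * 7 + 2), chiThree e * (((v / e : ℕ) : ℤ) - (v / e : ℕ) / 3)
          ≤ v := by decide +kernel
    have := key v h hv
    omega
  · have h1 := sum_chiThree_mul_coprimeThree_le 2 v
    generalize ∑ d ∈ Finset.Ioc 0 v, (chiThree * coprimeThree) d = s at h1 ⊢
    simp [Finset.sum_range_succ, chiThree_apply] at h1
    omega

lemma sum_chiThree_mul_coprimeThree_small (v : ℕ) :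
    (v ≤ 3 → ∑ d ∈ Finset.Ioc 0 v, (chiThree * coprimeThree) d ≤ 1) ∧
    (v ≤ 6 → ∑ d ∈ Finset.Ioc 0 v, (chiThree * coprimeThree) d ≤ 2) ∧
    (v ≤ 7 → ∑ d ∈ Finset.Ioc 0 v, (chiThree * coprimeThree) d ≤ 4) := by
  have key : ∀ v : ℕ, v < 8 →
      (v ≤ 3 → ∑ e ∈ Finset.range (3 * 2 + 2), chiThree e * (((v / e : ℕ) : ℤ) - (v / e : ℕ) / 3)
        ≤ 1) ∧
      (v ≤ 6 → ∑ e ∈ Finset.range (3 * 2 + 2), chiThree e * (((v / e : ℕ) : ℤ) - (v / e : ℕ) / 3)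
        ≤ 2) ∧
      (v ≤ 7 → ∑ e ∈ Finset.range (3 * 2 + 2), chiThree e * (((v / e : ℕ) : ℤ) - (v / e : ℕ) / 3)
        ≤ 4) := by decide +kernel
  have h1 := sum_chiThree_mul_coprimeThree_le 2 v
  refine ⟨fun h ↦ h1.trans ((key v (by omega)).1 h), fun h ↦ h1.trans ((key v (by omega)).2.1 h),
    fun h ↦ h1.trans ((key v (by omega)).2.2 h)⟩

end

end

section

open scoped ArithmeticFunction ArithmeticFunction.zeta
open Finset

section

lemma sum_Ioc_sum_divisorsAntidiagonal {M : Type*} [AddCommMonoid M] (F : ℕ → ℕ → M) (N : ℕ) :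
    ∑ n ∈ Ioc 0 N, ∑ x ∈ n.divisorsAntidiagonal, F x.1 x.2 =
      ∑ d ∈ Ioc 0 N, ∑ m ∈ Ioc 0 (N / d), F d m := by
  trans ∑ n ∈ Ioc 0 N, ∑ x ∈ Ioc 0 N ×ˢ Ioc 0 N with x.1 * x.2 = n, F x.1 x.2
  · refine sum_congr rfl fun n hn ↦ ?_
    simp only [mem_Ioc] at hn
    rw [Nat.divisorsAntidiagonal_eq_prod_filter_of_le hn.1.ne' hn.2]
  · trans ∑ x ∈ Ioc 0 N ×ˢ Ioc 0 N with x.1 * x.2 ≤ N, F x.1 x.2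
    · simp_rw [sum_filter]
      rw [sum_comm]
      exact sum_congr rfl fun _ _ ↦ (by simp_all)
    · rw [sum_filter, sum_product]
      refine sum_congr rfl fun n hn ↦ ?_
      rw [← sum_filter]
      congr 1
      ext m
      simp only [mem_filter, mem_Ioc, and_assoc] at hn ⊢
      rw [Nat.le_div_iff_mul_le hn.1, mul_comm m]
      constructor
      · rintro ⟨h1, -, h2⟩
        exact ⟨h1, h2⟩
      · rintro ⟨h1, h2⟩
        exact ⟨h1, (Nat.le_mul_of_pos_left m hn.1).trans h2, h2⟩

lemma sum_Ioc_natCast (M : ℕ) : ∑ m ∈ Ioc 0 M, (m : ℝ) = M * (M + 1) / 2 := by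
  induction M with
  | zero => simp
  | succ M ih => rw [sum_Ioc_succ_top (by omega), ih]; push_cast; ring

lemma sum_one_sub_div_le {y : ℝ} (hy : 1 ≤ y) :
    ∑ m ∈ Ioc 0 ⌊y⌋₊, (1 - m / y) ≤ (y - 4 / 5) / 2 := by
  have hM : (1 : ℝ) ≤ ⌊y⌋₊ := by exact_mod_cast (Nat.one_le_floor_iff y).2 hy
  rw [sum_sub_distrib, ← sum_div, sum_Ioc_natCast]
  simp only [sum_const, Nat.card_Ioc, nsmul_eq_mul]
  set M := ⌊y⌋₊
  rw [← sub_nonneg]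
  have : (y - 4 / 5) / 2 - (((M - 0 : ℕ) : ℝ) * 1 - (M : ℝ) * (M + 1) / 2 / y) =
      ((y - M - 2 / 5) ^ 2 + (M - 4 / 5) / 5) / (2 * y) := by
    field_simp
    simp
    ring
  rw [this]
  apply div_nonneg <;> nlinarith [sq_nonneg (y - M - 2 / 5)]

lemma sum_mul_zeta_mul_le {b : ArithmeticFunction ℤ} (hb : ∀ n, 0 ≤ b n) {Y : ℝ} (hY : 0 < Y) :
    ∑ n ∈ Ioc 0 ⌊Y⌋₊, ((b * (ζ : ArithmeticFunction ℤ)) n : ℝ) * (1 - n / Y) ≤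
      Y / 2 * ∑ d ∈ Ioc 0 ⌊Y⌋₊, (b d : ℝ) * (1 / d - 1 / (5 / 4 * Y)) := by
  have h1 : ∑ n ∈ Ioc 0 ⌊Y⌋₊, ((b * (ζ : ArithmeticFunction ℤ)) n : ℝ) * (1 - n / Y) =
      ∑ n ∈ Ioc 0 ⌊Y⌋₊, ∑ x ∈ n.divisorsAntidiagonal,
        (b x.1 : ℝ) * (1 - (x.1 * x.2 : ℕ) / Y) := by
    refine sum_congr rfl fun n hn ↦ ?_
    rw [ArithmeticFunction.coe_mul_zeta_apply, ← Nat.sum_divisorsAntidiagonal fun x _ ↦ b x,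
      Int.cast_sum, sum_mul]
    refine sum_congr rfl fun x hx ↦ ?_
    rw [(Nat.mem_divisorsAntidiagonal.1 hx).1]
  rw [h1, sum_Ioc_sum_divisorsAntidiagonal fun d m ↦ (b d : ℝ) * (1 - (d * m : ℕ) / Y), mul_sum]
  refine sum_le_sum fun d hd ↦ ?_
  rw [mem_Ioc] at hd
  have hd0 : (0 : ℝ) < d := by exact_mod_cast hd.1
  have hdY : (d : ℝ) ≤ Y := (Nat.le_floor_iff hY.le).1 hd.2
  have hyd : 1 ≤ Y / d := (one_le_div hd0).2 hdY
  have h2 := sum_one_sub_div_le hyd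
  rw [Nat.floor_div_natCast] at h2
  rw [← mul_sum]
  have h3 : (0 : ℝ) ≤ b d := by exact_mod_cast hb d
  calc (b d : ℝ) * ∑ m ∈ Ioc 0 (⌊Y⌋₊ / d), (1 - ((d * m : ℕ) : ℝ) / Y)
      = b d * ∑ m ∈ Ioc 0 (⌊Y⌋₊ / d), (1 - m / (Y / d)) := by
        congr 1
        refine sum_congr rfl fun m _ ↦ ?_
        push_cast
        field_simp
    _ ≤ b d * ((Y / d - 4 / 5) / 2) := by gcongr
    _ = _ := by field_simp

lemma sum_mul_le_sum_mul_of_partial_sums {b c w : ℕ → ℝ}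
    (h : ∀ v, ∑ d ∈ Ioc 0 v, b d ≤ ∑ d ∈ Ioc 0 v, c d)
    (hw : ∀ d, 0 < d → w (d + 1) ≤ w d) {N : ℕ} (hN : 0 ≤ w N) :
    ∑ d ∈ Ioc 0 N, b d * w d ≤ ∑ d ∈ Ioc 0 N, c d * w d := by
  have key : (∑ d ∈ Ioc 0 N, c d - ∑ d ∈ Ioc 0 N, b d) * w N ≤
      ∑ d ∈ Ioc 0 N, c d * w d - ∑ d ∈ Ioc 0 N, b d * w d := by
    clear hN
    induction N with
    | zero => simp
    | succ N ih =>
      simp only [sum_Ioc_succ_top (Nat.zero_le N)]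
      rcases Nat.eq_zero_or_pos N with rfl | hpos
      · simp
        linarith
      · have := mul_le_mul_of_nonneg_left (hw N hpos) (sub_nonneg.2 (h N))
        linarith
  have := mul_nonneg (sub_nonneg.2 (h N)) hN
  linarith

lemma log_add_one_sub_div_le {x z : ℝ} (hx : 0 < x) (hz : 0 < z) :
    Real.log x + 1 - x / z ≤ Real.log z := by
  have := Real.one_sub_inv_le_log_of_pos (div_pos hz hx)
  rw [inv_div, Real.log_div hz.ne' hx.ne'] at this
  linarith

lemma one_div_sub_antitone (u : ℝ) (d : ℕ) (hd : 0 < d) :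
    1 / ((d + 1 : ℕ) : ℝ) - u ≤ 1 / (d : ℝ) - u := by
  gcongr
  simp

lemma one_div_sub_nonneg {Y : ℝ} (hY : 0 < Y) (hN : 0 < ⌊Y⌋₊) :
    0 ≤ 1 / ((⌊Y⌋₊ : ℕ) : ℝ) - 1 / (5 / 4 * Y) := by
  rw [sub_nonneg]
  have := Nat.floor_le hY.le
  have : (0 : ℝ) < ⌊Y⌋₊ := by exact_mod_cast hN
  gcongr
  linarith

lemma sum_chiThree_mul_zeta_mul_zeta_le {Y t : ℝ} (hY : 0 < Y) (ht0 : 0 ≤ t)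
    (ht : Real.log (5 / 4 * Y) ≤ t) :
    ∑ n ∈ Ioc 0 ⌊Y⌋₊, ((chiThree * (ζ : ArithmeticFunction ℤ) * (ζ : ArithmeticFunction ℤ)) n : ℝ)
      * (1 - n / Y) ≤ Y / 2 * t := by
  refine (sum_mul_zeta_mul_le (chiThree_mul_nonneg isMultiplicative_intCast_zeta ?_ ?_) hY).trans ?_
  · intro n hn
    have : n ≠ 0 := by rintro rfl; simp at hn
    simp [this]
  · intro n
    rw [ArithmeticFunction.natCoe_apply]
    positivity
  gcongr
  rcases Nat.eq_zero_or_pos ⌊Y⌋₊ with h0 | hpos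
  · rw [h0]; simpa using ht0
  refine (sum_mul_le_sum_mul_of_partial_sums (c := fun _ ↦ 1) (w := fun d ↦ 1 / d - 1 / (5 / 4 * Y))
    ?_ (one_div_sub_antitone _) (one_div_sub_nonneg hY hpos)).trans ?_
  · intro v
    have := sum_chiThree_mul_zeta_le v
    simp only [sum_const, Nat.card_Ioc, nsmul_eq_mul, mul_one, tsub_zero]
    exact_mod_cast this
  · have h1 := harmonic_le_one_add_log ⌊Y⌋₊
    have hpos' : (0 : ℝ) < ⌊Y⌋₊ := by exact_mod_cast hpos
    have h2 := log_add_one_sub_div_le hpos' (by positivity : 0 < 5 / 4 * Y)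
    have h3 : ∑ d ∈ Ioc 0 ⌊Y⌋₊, (1 : ℝ) * (1 / d - 1 / (5 / 4 * Y)) =
        harmonic ⌊Y⌋₊ - ⌊Y⌋₊ / (5 / 4 * Y) := by
      rw [harmonic_eq_sum_Icc]
      simp [← Finset.Icc_add_one_left_eq_Ioc]
      ring
    rw [h3]
    linarith

/-- A majorant, in the sense of partial sums, of the coefficients of `chiThree * coprimeThree`. -/
noncomputable def coprimeThreeMajorant (d : ℕ) : ℝ :=
  if d = 1 then 1 else if d = 4 then 1 else if d = 7 then 2 else if d ≤ 8 then 0 else 1 / 2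

lemma sum_coprimeThreeMajorant {v : ℕ} (hv : 8 ≤ v) :
    ∑ d ∈ Ioc 0 v, coprimeThreeMajorant d = v / 2 := by
  induction v, hv using Nat.le_induction with
  | base => norm_num [sum_Ioc_succ_top, coprimeThreeMajorant]
  | succ v hv ih =>
    rw [sum_Ioc_succ_top (by omega), ih, coprimeThreeMajorant, if_neg (by omega),
      if_neg (by omega), if_neg (by omega), if_neg (by omega)]
    push_cast
    ring

lemma sum_chiThree_mul_coprimeThree_le_majorant (v : ℕ) :
    ∑ d ∈ Ioc 0 v, ((chiThree * coprimeThree) d : ℝ) ≤ ∑ d ∈ Ioc 0 v, coprimeThreeMajorant d := by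
  by_cases hv : 8 ≤ v
  · rw [sum_coprimeThreeMajorant hv]
    have h : ((2 * ∑ d ∈ Ioc 0 v, (chiThree * coprimeThree) d : ℤ) : ℝ) ≤ (v : ℤ) := by
      exact_mod_cast two_mul_sum_chiThree_mul_coprimeThree_le hv
    push_cast at h
    linarith
  · obtain ⟨h1, h2, h3⟩ := sum_chiThree_mul_coprimeThree_small v
    rcases Nat.eq_zero_or_pos v with rfl | hpos
    · simp
    rw [← Int.cast_sum]
    generalize ∑ d ∈ Ioc 0 v, (chiThree * coprimeThree) d = s at *
    have hle (B : ℤ) (h : s ≤ B) : (s : ℝ) ≤ B := by exact_mod_cast h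
    have hv' : v < 8 := by omega
    interval_cases v
    iterate 3
      refine (hle 1 (h1 (by norm_num))).trans ?_
      norm_num [sum_Ioc_succ_top, coprimeThreeMajorant]
    iterate 3
      refine (hle 2 (h2 (by norm_num))).trans ?_
      norm_num [sum_Ioc_succ_top, coprimeThreeMajorant]
    refine (hle 4 (h3 (by norm_num))).trans ?_
    norm_num [sum_Ioc_succ_top, coprimeThreeMajorant]

lemma sum_coprimeThreeMajorant_mul_le {N : ℕ} (hN : 8 ≤ N) (u : ℝ) :
    ∑ d ∈ Ioc 0 N, coprimeThreeMajorant d * (1 / d - u) ≤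
      43 / 28 - 4 * u + 1 / 2 * (Real.log N - Real.log 8 - (N - 8) * u) := by
  induction N, hN using Nat.le_induction with
  | base =>
    norm_num [sum_Ioc_succ_top, coprimeThreeMajorant]
    linarith
  | succ N hN ih =>
    rw [sum_Ioc_succ_top (by omega), coprimeThreeMajorant, if_neg (by omega),
      if_neg (by omega), if_neg (by omega), if_neg (by omega)]
    have hpos : (0 : ℝ) < N := by exact_mod_cast (by omega : 0 < N)
    have h := log_add_one_sub_div_le hpos (by positivity : 0 < (N : ℝ) + 1)
    have h2 : 1 - (N : ℝ) / (N + 1) = 1 / (N + 1) := by field_simp; ring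
    push_cast
    linarith

lemma sum_chiThree_mul_coprimeThree_mul_zeta_le {Y t : ℝ} (hY : 0 < Y) (ht0 : 0 ≤ t)
    (ht : Real.log (5 / 4 * Y) - Real.log 8 ≤ t) :
    ∑ n ∈ Ioc 0 ⌊Y⌋₊, ((chiThree * coprimeThree * (ζ : ArithmeticFunction ℤ)) n : ℝ)
      * (1 - n / Y) ≤ Y / 2 * (29 / 28 + 1 / 2 * t) := by
  refine (sum_mul_zeta_mul_le (chiThree_mul_nonneg isMultiplicative_coprimeThree ?_ ?_) hY).trans ?_
  · intro n hn
    rw [coprimeThree_apply, if_neg hn]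
  · intro n
    rw [coprimeThree_apply]
    split_ifs <;> norm_num
  gcongr
  rcases Nat.eq_zero_or_pos ⌊Y⌋₊ with h0 | hpos
  · rw [h0]
    simp
    positivity
  refine (sum_mul_le_sum_mul_of_partial_sums (w := fun d ↦ 1 / d - 1 / (5 / 4 * Y))
    sum_chiThree_mul_coprimeThree_le_majorant (one_div_sub_antitone _)
    (one_div_sub_nonneg hY hpos)).trans ?_
  have hZ : 0 < 5 / 4 * Y := by positivity
  generalize 5 / 4 * Y = Z at *
  generalize ⌊Y⌋₊ = N at *
  by_cases hN : 8 ≤ N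
  · have h1 := sum_coprimeThreeMajorant_mul_le hN (1 / Z)
    have hpos' : (0 : ℝ) < N := by exact_mod_cast hpos
    have h2 := log_add_one_sub_div_le hpos' hZ
    rw [div_eq_mul_one_div] at h2
    linarith
  · have h2 := log_add_one_sub_div_le (by norm_num : (0 : ℝ) < 8) hZ
    rw [div_eq_mul_one_div] at h2
    have hu : 0 < 1 / Z := by positivity
    generalize 1 / Z = u at *
    have hN' : N < 8 := by omega
    interval_cases N <;> norm_num [sum_Ioc_succ_top, coprimeThreeMajorant] <;> linarith

end

end

section

open MeasureTheory NumberField Module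
open scoped Classical ENNReal nonZeroDivisors

section

variable {K : Type*} [Field K] [NumberField K]

lemma tsum_absNorm_le_sum_idealCount (f : ℕ → ℝ≥0∞) {N : ℕ} (hf : ∀ n, N < n → f n = 0) :
    ∑' I : (Ideal (𝓞 K))⁰, f (Ideal.absNorm (I : Ideal (𝓞 K))) ≤
      ∑ n ∈ Finset.Ioc 0 N, idealCount K n * f n := by
  rw [← (Equiv.sigmaFiberEquiv
    fun I : (Ideal (𝓞 K))⁰ ↦ Ideal.absNorm (I : Ideal (𝓞 K))).tsum_eq, ENNReal.tsum_sigma']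
  have hinj (n : ℕ) : Function.Injective
      fun I : {I : (Ideal (𝓞 K))⁰ // Ideal.absNorm (I : Ideal (𝓞 K)) = n} ↦
        (⟨I.1.1, I.2⟩ : {I : Ideal (𝓞 K) // Ideal.absNorm I = n}) := fun I J h ↦
    Subtype.ext (Subtype.ext (by simpa using h))
  have (n : ℕ) : ∑' I : {I : (Ideal (𝓞 K))⁰ // Ideal.absNorm (I : Ideal (𝓞 K)) = n},
      f (Ideal.absNorm (Equiv.sigmaFiberEquiv
        (fun I : (Ideal (𝓞 K))⁰ ↦ Ideal.absNorm (I : Ideal (𝓞 K))) ⟨n, I⟩ : Ideal (𝓞 K))) ≤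
      if n ∈ Finset.Ioc 0 N then idealCount K n * f n else 0 := by
    have := Finite.of_injective _ (hinj n)
    have := Fintype.ofFinite {I : (Ideal (𝓞 K))⁰ // Ideal.absNorm (I : Ideal (𝓞 K)) = n}
    rw [tsum_fintype]
    split_ifs with h
    · calc _ = ∑ I : {I : (Ideal (𝓞 K))⁰ // Ideal.absNorm (I : Ideal (𝓞 K)) = n}, f n :=
            Finset.sum_congr rfl fun I _ ↦ congrArg f I.2
        _ = Nat.card {I : (Ideal (𝓞 K))⁰ // Ideal.absNorm (I : Ideal (𝓞 K)) = n} * f n := by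
            simp
        _ ≤ _ := by
            gcongr
            exact Nat.card_le_card_of_injective _ (hinj n)
    · refine le_of_eq (Finset.sum_eq_zero fun I _ ↦ ?_)
      refine (congrArg f I.2).trans (hf n ?_)
      have h0 : n ≠ 0 := by
        rintro rfl
        exact Ideal.absNorm_ne_zero_of_nonZeroDivisors I.1 I.2
      simp only [Finset.mem_Ioc] at h
      omega
  refine (ENNReal.tsum_le_tsum this).trans (le_of_eq ?_)
  rw [tsum_eq_sum (s := Finset.Ioc 0 N) fun n hn ↦ if_neg hn]
  exact Finset.sum_congr rfl fun n hn ↦ if_pos hn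

lemma tsum_idealWeight_le {g : ℕ → ℤ} (hg : ∀ n, n ≠ 0 → (idealCount K n : ℤ) ≤ g n) {A τ B : ℝ}
    (hA : 0 < A)
    (hB : ∑ n ∈ Finset.Ioc 0 ⌊A * Real.exp τ⌋₊, (g n : ℝ) * (1 - n / (A * Real.exp τ)) ≤ B) :
    ∑' I : (Ideal (𝓞 K))⁰, idealWeight A I τ ≤
      ENNReal.ofReal B * ENNReal.ofReal (Real.exp (-Real.exp τ)) := by
  have hY : 0 < A * Real.exp τ := by positivity
  unfold idealWeight
  rw [ENNReal.tsum_mul_right]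
  generalize A * Real.exp τ = Y at *
  gcongr
  refine (tsum_absNorm_le_sum_idealCount (fun n : ℕ ↦ ENNReal.ofReal (1 - n / Y))
    (N := ⌊Y⌋₊) fun n hn ↦ ?_).trans ?_
  · rw [ENNReal.ofReal_eq_zero, sub_nonpos, one_le_div hY]
    exact ((Nat.floor_lt hY.le).1 hn).le
  refine le_trans ?_ (ENNReal.ofReal_le_ofReal hB)
  have hw {n : ℕ} (hn : n ∈ Finset.Ioc 0 ⌊Y⌋₊) : 0 ≤ 1 - n / Y := by
    rw [sub_nonneg, div_le_one hY]
    exact (Nat.le_floor_iff hY.le).1 (Finset.mem_Ioc.1 hn).2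
  have hgn {n : ℕ} (hn : n ∈ Finset.Ioc 0 ⌊Y⌋₊) : (idealCount K n : ℝ) ≤ g n := by
    exact_mod_cast hg n (Finset.mem_Ioc.1 hn).1.ne'
  rw [ENNReal.ofReal_sum_of_nonneg fun n hn ↦
    mul_nonneg ((Nat.cast_nonneg _).trans (hgn hn)) (hw hn)]
  refine Finset.sum_le_sum fun n hn ↦ ?_
  rw [← ENNReal.ofReal_natCast, ← ENNReal.ofReal_mul (Nat.cast_nonneg _)]
  exact ENNReal.ofReal_le_ofReal (mul_le_mul_of_nonneg_right (hgn hn) (hw hn))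

end

lemma lintegral_exp_mul_linear {a b : ℝ} (ha : 0 ≤ a) (hb : 0 ≤ b) :
    ∫⁻ τ : ℝ, ENNReal.ofReal (Real.exp τ * (a + b * Real.exp τ)) *
      ENNReal.ofReal (Real.exp (-Real.exp τ)) = ENNReal.ofReal (a + b) := by
  have h1 := lintegral_image_eq_lintegral_abs_deriv_mul MeasurableSet.univ
    (fun x _ ↦ (Real.hasDerivAt_exp x).hasDerivWithinAt) Real.exp_injective.injOn
    (fun x ↦ ENNReal.ofReal ((a + b * x) * Real.exp (-x)))
  rw [Set.image_univ, Real.range_exp, setLIntegral_univ] at h1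
  have h2 : ∫⁻ τ : ℝ, ENNReal.ofReal (Real.exp τ * (a + b * Real.exp τ)) *
      ENNReal.ofReal (Real.exp (-Real.exp τ)) =
      ∫⁻ x in Set.Ioi (0 : ℝ), ENNReal.ofReal ((a + b * x) * Real.exp (-x)) := by
    rw [h1]
    refine lintegral_congr fun τ ↦ ?_
    have := Real.exp_pos τ
    rw [abs_of_pos this, ← ENNReal.ofReal_mul (by positivity), ← ENNReal.ofReal_mul (by positivity),
      mul_assoc]
  have hi1 := Real.GammaIntegral_convergent (s := 1) one_pos
  have hi2 := Real.GammaIntegral_convergent (s := 2) two_pos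
  have hg1 := Real.Gamma_eq_integral (s := 1) one_pos
  have hg2 := Real.Gamma_eq_integral (s := 2) two_pos
  rw [Real.Gamma_one] at hg1
  rw [Real.Gamma_two] at hg2
  have he : (fun x : ℝ ↦ (a + b * x) * Real.exp (-x)) =
      fun x ↦ a * (Real.exp (-x) * x ^ ((1 : ℝ) - 1)) + b * (Real.exp (-x) * x ^ ((2 : ℝ) - 1)) := by
    ext x
    norm_num
    ring
  rw [h2, ← ofReal_integral_eq_lintegral_ofReal]
  · rw [he, integral_add (hi1.const_mul a) (hi2.const_mul b), integral_const_mul,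
      integral_const_mul, ← hg1, ← hg2]
    simp
  · rw [he]
    exact (hi1.const_mul a).add (hi2.const_mul b)
  · refine (ae_restrict_mem measurableSet_Ioi).mono fun x hx ↦ ?_
    have : (0 : ℝ) < x := hx
    simp only [Pi.zero_apply]
    positivity

section

variable {K : Type*} [Field K] [NumberField K]

lemma two_mul_lintegral_tsum_idealWeight_le {g : ℕ → ℤ}
    (hg : ∀ n, n ≠ 0 → (idealCount K n : ℤ) ≤ g n) {A V E s : ℝ} (hA : 0 < A) (hV : 0 < V)
    (hE : 0 ≤ E) (hs : 0 ≤ s)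
    (hsum : ∀ Y t : ℝ, 0 < Y → 0 ≤ t → Real.log (5 / 4 * Y) - Real.log V ≤ t →
      ∑ n ∈ Finset.Ioc 0 ⌊Y⌋₊, (g n : ℝ) * (1 - n / Y) ≤ Y / 2 * (E + s * t))
    (hlog : 1 ≤ Real.log (5 * A / (4 * V))) :
    2 * ∫⁻ τ : ℝ, ∑' I : (Ideal (𝓞 K))⁰, idealWeight A I τ ≤
      ENNReal.ofReal (A * (E + s * Real.log (5 * A / (4 * V)))) := by
  set L := Real.log (5 * A / (4 * V)) with hL
  have hpt (τ : ℝ) : ∑' I : (Ideal (𝓞 K))⁰, idealWeight A I τ ≤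
      ENNReal.ofReal (Real.exp τ * (A / 2 * (E + s * (L - 1)) + A / 2 * s * Real.exp τ)) *
        ENNReal.ofReal (Real.exp (-Real.exp τ)) := by
    refine tsum_idealWeight_le hg hA ?_
    refine (hsum (A * Real.exp τ) (Real.exp τ + L - 1) (by positivity) ?_ ?_).trans (le_of_eq ?_)
    · have := Real.exp_pos τ
      linarith
    · have h1 : Real.log (5 / 4 * (A * Real.exp τ)) - Real.log V = L + τ := by
        rw [← Real.log_div (by positivity) hV.ne', hL, ← Real.log_exp τ,
          ← Real.log_mul (by positivity) (by positivity), Real.log_exp]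
        congr 1
        field_simp
      have := Real.add_one_le_exp τ
      linarith
    · ring
  calc _ ≤ 2 * ∫⁻ τ : ℝ,
        ENNReal.ofReal (Real.exp τ * (A / 2 * (E + s * (L - 1)) + A / 2 * s * Real.exp τ)) *
          ENNReal.ofReal (Real.exp (-Real.exp τ)) := by
        gcongr with τ
        exact hpt τ
    _ = ENNReal.ofReal (2 * (A / 2 * (E + s * (L - 1)) + A / 2 * s)) := by
        have : 0 ≤ L - 1 := by linarith
        rw [lintegral_exp_mul_linear (by positivity) (by positivity),
          ENNReal.ofReal_mul (by norm_num)]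
        simp
    _ = _ := by congr 1; ring

open NumberField.InfinitePlace in
theorem classNumber_mul_log_le [Subsingleton {w : InfinitePlace K // w.IsReal}]
    [Subsingleton {w : InfinitePlace K // w.IsComplex}] (h3 : finrank ℚ K = 3)
    (v : {w : InfinitePlace K // w.IsReal}) (w : {w : InfinitePlace K // w.IsComplex})
    (hD : 32 ≤ |(discr K : ℝ)|) {g : ℕ → ℤ}
    (hg : ∀ n, n ≠ 0 → (idealCount K n : ℤ) ≤ g n) {A V E s : ℝ} (hA : 0 < A) (hV : 0 < V)
    (hE : 0 ≤ E) (hs : 0 ≤ s)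
    (hsum : ∀ Y t : ℝ, 0 < Y → 0 ≤ t → Real.log (5 / 4 * Y) - Real.log V ≤ t →
      ∑ n ∈ Finset.Ioc 0 ⌊Y⌋₊, (g n : ℝ) * (1 - n / Y) ≤ Y / 2 * (E + s * t))
    (hlog : 1 ≤ Real.log (5 * A / (4 * V))) :
    classNumber K * (2 * Real.pi * A / √|(discr K : ℝ)| - 1) *
        Real.log ((|(discr K : ℝ)| - 28) / 4) ≤
      3 * A * (E + s * Real.log (5 * A / (4 * V))) := by
  set R := 1 / 3 * Real.log ((|(discr K : ℝ)| - 28) / 4) with hR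
  have hR0 : 0 ≤ R := by
    have : 0 ≤ Real.log ((|(discr K : ℝ)| - 28) / 4) := Real.log_nonneg (by linarith)
    positivity
  have h := (classNumber_mul_le v w (R := R) hA fun u h1 h2 ↦
    log_le_abs_log_unit h3 v w u h1 h2 (by linarith)).trans
    (add_le_add_right (two_mul_lintegral_tsum_idealWeight_le hg hA hV hE hs hsum hlog) _)
  have hL : 0 ≤ Real.log (5 * A / (4 * V)) := by linarith
  rw [← ENNReal.ofReal_natCast, ← ENNReal.ofReal_mul (by positivity),
    ← ENNReal.ofReal_mul (by positivity), ← ENNReal.ofReal_mul (by positivity),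
    ← ENNReal.ofReal_add (by positivity) (by positivity),
    ENNReal.ofReal_le_ofReal_iff (by positivity)] at h
  have : Real.log ((|(discr K : ℝ)| - 28) / 4) = 3 * R := by rw [hR]; ring
  rw [this]
  linarith

end

end

section

open NumberField NumberField.InfinitePlace Module

lemma natCast_le_mul_log {m n : ℕ} {x : ℝ} (hx : 0 < x) (h : (2.7182818286 : ℝ) ^ m ≤ x ^ n) :
    (m : ℝ) ≤ n * Real.log x := by
  rw [← Real.log_pow, Real.le_log_iff_exp_le (by positivity), ← Real.exp_one_pow]
  exact (pow_le_pow_left₀ (Real.exp_pos 1).le Real.exp_one_lt_d9.le m).trans h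

lemma mul_log_le_natCast {m n : ℕ} {x : ℝ} (hx : 0 < x) (h : x ^ n ≤ (2.7182818283 : ℝ) ^ m) :
    (n : ℝ) * Real.log x ≤ m := by
  rw [← Real.log_pow, Real.log_le_iff_le_exp (by positivity), ← Real.exp_one_pow]
  exact h.trans (pow_le_pow_left₀ (by norm_num) Real.exp_one_gt_d9.le m)

lemma lt_of_mul_mul_le {h p k l M κ ℓ : ℝ} (hp : 0 < p) (hκ : 0 < κ) (hk : κ ≤ k) (hℓ : 0 < ℓ)
    (hl : ℓ ≤ l) (hle : h * k * l ≤ M) (hM : M < p * κ * ℓ) : h < p := by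
  by_contra! hph
  refine absurd (hle.trans_lt hM) (not_lt.2 ?_)
  have hh : 0 < h := hp.trans_le hph
  have hk0 : 0 < k := hκ.trans_le hk
  gcongr

lemma le_two_pi_mul_div_sqrt {D A σ κ : ℝ} {p : ℕ} (hp : 0 < p) (hσ : 0 < σ)
    (hD : D ≤ (σ * p) ^ 2) (hD0 : 0 < D) (hA : (κ + 1) * (σ * p) ≤ 6.283 * A) (hA0 : 0 < A) :
    κ ≤ 2 * Real.pi * A / √D - 1 := by
  have hp' : (0 : ℝ) < p := by exact_mod_cast hp
  have hsqrt : √D ≤ σ * p := Real.sqrt_le_iff.2 ⟨by positivity, hD⟩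
  have hs0 : 0 < √D := Real.sqrt_pos.2 hD0
  have h1 : 6.283 * A / (σ * p) ≤ 2 * Real.pi * A / √D := by
    gcongr
    linarith [Real.pi_gt_d4]
  have h2 : κ + 1 ≤ 6.283 * A / (σ * p) := (le_div_iff₀ (by positivity)).2 hA
  linarith

section

variable {K : Type*} [Field K] [NumberField K]
  [Subsingleton {w : InfinitePlace K // w.IsReal}]
  [Subsingleton {w : InfinitePlace K // w.IsComplex}] (h3 : finrank ℚ K = 3)
  (v : {w : InfinitePlace K // w.IsReal}) (w : {w : InfinitePlace K // w.IsComplex})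
  {p : ℕ} (hp : p.Prime) (hp5 : 5 ≤ p) {θ : 𝓞 K} (hθ : θ ^ 3 = (p : 𝓞 K))

include h3 v w hp hp5 hθ

lemma classNumber_lt_of_discr_eq_neg_twentyseven (hD : discr K = -27 * (p : ℤ) ^ 2)
    (hspan : Submodule.span ℤ (Set.range fun i : Fin 3 ↦ θ ^ (i : ℕ)) = ⊤) :
    classNumber K < p := by
  have hp5' : (5 : ℝ) ≤ p := by exact_mod_cast hp5
  have hsq : (25 : ℝ) ≤ (p : ℝ) ^ 2 := by nlinarith
  have hDR : |(discr K : ℝ)| = 27 * (p : ℝ) ^ 2 := by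
    rw [hD]; push_cast
    rw [abs_of_nonpos (by nlinarith)]; ring
  have hL : 1 ≤ Real.log (9 * p / 16) := by
    have := natCast_le_mul_log (m := 1) (n := 1) (x := 9 * p / 16) (by positivity)
      (by norm_num; linarith)
    simpa using this
  have h := classNumber_mul_log_le h3 v w (by rw [hDR]; linarith)
    (fun n hn ↦ idealCount_le_coprimeThree h3 v w hp hθ hspan hn) (A := 18 / 5 * p) (V := 8)
    (E := 29 / 28) (s := 1 / 2) (by positivity) (by norm_num) (by norm_num) (by norm_num)
    (fun Y t hY ht0 ht ↦ sum_chiThree_mul_coprimeThree_mul_zeta_le hY ht0 ht)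
    (by convert hL using 2; ring)
  rw [hDR, show 5 * (18 / 5 * (p : ℝ)) / (4 * 8) = 9 * p / 16 by ring] at h
  have hlog : 3 + 2 * Real.log (9 * p / 16) ≤ Real.log ((27 * (p : ℝ) ^ 2 - 28) / 4) := by
    have h1 := natCast_le_mul_log (m := 3) (n := 1) (x := 647 / 100 * (256 / 81)) (by norm_num)
      (by norm_num)
    have h2 : Real.log (647 / 100 * (256 / 81)) + 2 * Real.log (9 * p / 16) =
        Real.log (647 / 100 * (p : ℝ) ^ 2) := by
      rw [← Real.log_rpow (by positivity), ← Real.log_mul (by norm_num) (by positivity), Real.rpow_two]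
      congr 1
      ring
    have h3 : Real.log (647 / 100 * (p : ℝ) ^ 2) ≤ Real.log ((27 * (p : ℝ) ^ 2 - 28) / 4) :=
      Real.log_le_log (by positivity) (by linarith)
    norm_num at h1
    linarith
  have hk := le_two_pi_mul_div_sqrt (D := 27 * (p : ℝ) ^ 2) (A := 18 / 5 * p) (σ := 5.1962)
    (κ := 3.352) (p := p) (by omega) (by norm_num) (by ring_nf; linarith) (by positivity)
    (by linarith) (by positivity)
  generalize Real.log (9 * p / 16) = L at *
  have := lt_of_mul_mul_le (p := p) (by positivity) (by norm_num) hk (by positivity) hlog h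
    (by nlinarith)
  exact_mod_cast this

lemma classNumber_lt_of_discr_eq_neg_three (hD : discr K = -3 * (p : ℤ) ^ 2) :
    classNumber K < p := by
  have hp5' : (5 : ℝ) ≤ p := by exact_mod_cast hp5
  have hsq : (25 : ℝ) ≤ (p : ℝ) ^ 2 := by nlinarith
  have hDR : |(discr K : ℝ)| = 3 * (p : ℝ) ^ 2 := by
    rw [hD]; push_cast
    rw [abs_of_nonpos (by nlinarith)]; ring
  have hL : 5 / 3 ≤ Real.log (5 * p / 4) := by
    have h1 := natCast_le_mul_log (m := 5) (n := 3) (x := 25 / 4) (by norm_num) (by norm_num)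
    have h2 : Real.log (25 / 4) ≤ Real.log (5 * p / 4) :=
      Real.log_le_log (by norm_num) (by linarith)
    norm_num at h1
    linarith
  have h := classNumber_mul_log_le h3 v w (by rw [hDR]; linarith)
    (fun n hn ↦ idealCount_le_zeta h3 v w hp (by linarith) hθ hn) (A := p) (V := 1)
    (E := 0) (s := 1) (by positivity) (by norm_num) (by norm_num) (by norm_num)
    (fun Y t hY ht0 ht ↦ by
      simpa using sum_chiThree_mul_zeta_mul_zeta_le hY ht0 (by simpa using ht))
    (by rw [mul_one]; linarith)
  rw [hDR, mul_one] at h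
  have hlog : -(4 / 3) + 2 * Real.log (5 * p / 4) ≤ Real.log ((3 * (p : ℝ) ^ 2 - 28) / 4) := by
    have h1 := mul_log_le_natCast (m := 4) (n := 3) (x := 625 / (47 * 4)) (by norm_num)
      (by norm_num)
    rw [← inv_div, Real.log_inv] at h1
    push_cast at h1
    have h2 : Real.log (47 * 4 / 625) + 2 * Real.log (5 * p / 4) =
        Real.log (47 / 100 * (p : ℝ) ^ 2) := by
      rw [← Real.log_rpow (by positivity), ← Real.log_mul (by norm_num) (by positivity), Real.rpow_two]
      congr 1
      ring
    have h3 : Real.log (47 / 100 * (p : ℝ) ^ 2) ≤ Real.log ((3 * (p : ℝ) ^ 2 - 28) / 4) :=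
      Real.log_le_log (by positivity) (by linarith)
    linarith
  have hk := le_two_pi_mul_div_sqrt (D := 3 * (p : ℝ) ^ 2) (A := p) (σ := 1.7321)
    (κ := 2.627) (p := p) (by omega) (by norm_num) (by ring_nf; linarith) (by positivity)
    (by linarith) (by positivity)
  generalize Real.log (5 * p / 4) = L at *
  have := lt_of_mul_mul_le (p := p) (by positivity) (by norm_num) hk (by linarith) hlog h
    (by nlinarith)
  exact_mod_cast this

end

end

section

open NumberField NumberField.InfinitePlace Module Ideal

section

variable {K : Type*} [Field K] [NumberField K]

lemma eq_span_singleton_of_absNorm_eq {I : Ideal (𝓞 K)} {α : 𝓞 K} (hα : α ∈ I)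
    (h0 : absNorm I ≠ 0) (h : absNorm (span {α}) = absNorm I) : I = span {α} := by
  obtain ⟨J, hJ⟩ := dvd_iff_le.2 ((span_singleton_le_iff_mem I).2 hα)
  rw [hJ, map_mul] at h
  have : J = ⊤ := absNorm_eq_one_iff.1 (mul_left_cancel₀ h0 (by rw [h, mul_one]))
  rw [hJ, this, mul_top]

lemma eq_span_singleton_of_prime_absNorm {I : Ideal (𝓞 K)} (hI : I ≠ ⊤) {α : 𝓞 K} (hα : α ∈ I)
    (h : (absNorm (span {α})).Prime) : I = span {α} := by
  have hle := (span_singleton_le_iff_mem I).2 hα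
  refine eq_span_singleton_of_absNorm_eq hα ?_ ?_
  · intro h0
    rw [absNorm_eq_zero_iff] at h0
    rw [h0, le_bot_iff] at hle
    rw [hle, absNorm_bot] at h
    exact Nat.not_prime_zero h
  · exact (((Nat.dvd_prime h).1 (absNorm_dvd_absNorm_of_le hle)).resolve_left
      (absNorm_eq_one_iff.not.2 hI)).symm

lemma mem_or_sub_one_mem_of_absNorm_eq_two {I : Ideal (𝓞 K)} (h : absNorm I = 2) (α : 𝓞 K) :
    α ∈ I ∨ α - 1 ∈ I := by
  by_contra! hα
  rw [absNorm_apply, Submodule.cardQuot_apply] at h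
  have : Finite (𝓞 K ⧸ I) := Nat.finite_of_card_ne_zero (by rw [h]; norm_num)
  have := Fintype.ofFinite (𝓞 K ⧸ I)
  classical
  have hne : (1 : 𝓞 K) ∉ I := fun h1 ↦ hα.1 (by simpa using I.mul_mem_left α h1)
  have hcard := Finset.card_le_univ {(0 : 𝓞 K ⧸ I), 1, Ideal.Quotient.mk I α}
  rw [← Nat.card_eq_fintype_card, h, Finset.card_eq_three.2 ⟨_, _, _, ?_, ?_, ?_, rfl⟩] at hcard
  · omega
  · rw [ne_comm, Ne, ← map_one (Ideal.Quotient.mk I), Ideal.Quotient.eq_zero_iff_mem]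
    exact hne
  · rw [ne_comm, Ne, Ideal.Quotient.eq_zero_iff_mem]
    exact hα.1
  · rw [ne_comm, Ne, ← map_one (Ideal.Quotient.mk I), Ideal.Quotient.eq]
    exact hα.2

lemma classNumber_eq_one_of_forall_prime (h3 : finrank ℚ K = 3)
    (hw : nrComplexPlaces K = 1) {B : ℕ}
    (hB : (2 / 7 : ℝ) ^ 2 * |(discr K : ℝ)| < B ^ 2)
    (h : ∀ I : Ideal (𝓞 K), I.IsPrime → absNorm I ≠ 0 → absNorm I < B → ∃ α, I = span {α}) :
    classNumber K = 1 := by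
  rw [classNumber_eq_one_iff]
  refine RingOfIntegers.isPrincipalIdealRing_of_isPrincipal_of_norm_le_of_isPrime
    fun I hI hIM ↦ ⟨h I hI (absNorm_ne_zero_of_nonZeroDivisors I) ?_⟩
  rw [hw, h3] at hIM
  have hpi : 4 / Real.pi * (6 / 27) ≤ 2 / 7 := by
    rw [div_mul_eq_mul_div, div_le_iff₀ Real.pi_pos]
    linarith [Real.pi_gt_d4]
  have hsqrt : 2 / 7 * √|(discr K : ℝ)| < B := by
    refine lt_of_pow_lt_pow_left₀ 2 (Nat.cast_nonneg B) ?_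
    rwa [mul_pow, Real.sq_sqrt (abs_nonneg _)]
  have h1 := mul_le_mul_of_nonneg_right hpi (Real.sqrt_nonneg |(discr K : ℝ)|)
  norm_num [Nat.factorial] at hIM h1
  have : (absNorm (I : Ideal (𝓞 K)) : ℝ) < B := by linarith
  exact_mod_cast this

variable (h3 : finrank ℚ K = 3)
  (v : {w : InfinitePlace K // w.IsReal}) (w : {w : InfinitePlace K // w.IsComplex})
  {p : ℕ} (hp : p.Prime) {θ : 𝓞 K}

include h3 in
lemma absNorm_span_cube_root (hθ : θ ^ 3 = (p : 𝓞 K)) : absNorm (span {θ}) = p := by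
  rw [absNorm_span_singleton, norm_cube_root h3 hθ, Int.natAbs_natCast]

include h3 v w hp

lemma absNorm_span_cube_root_sub_one [Subsingleton {w : InfinitePlace K // w.IsReal}]
    [Subsingleton {w : InfinitePlace K // w.IsComplex}]
    (hθ : θ ^ 3 = (p : 𝓞 K)) :
    (absNorm (span {θ - 1}) : ℝ) = p - 1 := by
  have hθ' : (θ : K) ^ 3 = (p : K) := by exact_mod_cast congrArg (algebraMap (𝓞 K) K) hθ
  obtain ⟨h1, h2⟩ := cube_root_embeddings v w hθ'
    (im_embedding_ne_zero h3 w (not_mem_bot_of_cube_eq_prime hp hθ'))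
  have hr : embedding_of_isReal v.2 (θ : K) ^ 3 = p := by rw [← map_pow, hθ', map_natCast]
  rw [← real_mul_complex_sq_eq_absNorm v w, ← norm_embedding_of_isReal v.2, ← norm_embedding_eq w.1,
    ← Complex.normSq_eq_norm_sq, Complex.normSq_apply, Real.norm_eq_abs]
  push_cast
  simp only [map_sub, map_one, Complex.sub_re, Complex.sub_im, Complex.one_re, Complex.one_im,
    sub_zero]
  rw [← sq (w.1.embedding (θ : K)).im, h1, h2]
  generalize embedding_of_isReal v.2 (θ : K) = r at *
  have hp1 : (1 : ℝ) ≤ p := by exact_mod_cast hp.one_lt.le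
  have hr1 : 1 ≤ r := by
    by_contra! hlt
    nlinarith [sq_nonneg (r + 1), sq_nonneg r]
  rw [abs_of_nonneg (by linarith), ← hr]
  ring

lemma abs_discr_le_of_cube_root (hθ : θ ^ 3 = (p : 𝓞 K)) :
    |(discr K : ℝ)| ≤ 27 * (p : ℝ) ^ 2 := by
  rcases discr_pure_cubic h3 v w hp hθ with h | h
  · rw [h.1]
    push_cast
    rw [abs_of_nonpos] <;> nlinarith [sq_nonneg (p : ℝ)]
  · rw [h]
    push_cast
    rw [abs_of_nonpos] <;> nlinarith [sq_nonneg (p : ℝ)]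

lemma classNumber_eq_one_of_two (hw : nrComplexPlaces K = 1)
    (hp2 : p = 2) (hθ : θ ^ 3 = (p : 𝓞 K)) : classNumber K = 1 := by
  have hD := abs_discr_le_of_cube_root h3 v w hp hθ
  have hN := absNorm_span_cube_root h3 hθ
  subst hp2
  refine classNumber_eq_one_of_forall_prime h3 hw (B := 3) (by norm_num at hD ⊢; linarith) ?_
  intro I hI h0 hlt
  have h1 := absNorm_eq_one_iff.not.2 hI.ne_top
  have h2 : absNorm I = 2 := by omega
  have hmem := absNorm_mem I
  rw [h2, ← hθ] at hmem
  exact ⟨θ, eq_span_singleton_of_prime_absNorm hI.ne_top (hI.mem_of_pow_mem _ hmem) (hN ▸ hp)⟩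

lemma classNumber_eq_one_of_three [Subsingleton {w : InfinitePlace K // w.IsReal}]
    [Subsingleton {w : InfinitePlace K // w.IsComplex}]
    (hw : nrComplexPlaces K = 1)
    (hp3 : p = 3) (hθ : θ ^ 3 = (p : 𝓞 K)) : classNumber K = 1 := by
  have hD := abs_discr_le_of_cube_root h3 v w hp hθ
  have hN := absNorm_span_cube_root h3 hθ
  have hN1 := absNorm_span_cube_root_sub_one h3 v w hp hθ
  subst hp3
  have hN1' : absNorm (span {θ - 1}) = 2 := by
    rify
    rw [hN1]
    norm_num
  have hprod : (θ - 1) * (θ ^ 2 + θ + 1) = 2 := by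
    push_cast at hθ
    linear_combination hθ
  refine classNumber_eq_one_of_forall_prime h3 hw (B := 5) (by norm_num at hD ⊢; linarith) ?_
  intro I hI h0 hlt
  have h1 := absNorm_eq_one_iff.not.2 hI.ne_top
  have hmem := absNorm_mem I
  by_cases hI3 : absNorm I = 3
  · rw [hI3, ← hθ] at hmem
    exact ⟨θ, eq_span_singleton_of_prime_absNorm hI.ne_top (hI.mem_of_pow_mem _ hmem) (hN ▸ hp)⟩
  have h24 : absNorm I = 2 ∨ absNorm I = 4 := by omega
  have hmem2 : (2 : 𝓞 K) ∈ I := by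
    rcases h24 with h | h
    · simpa [h] using hmem
    · rw [h] at hmem
      refine hI.mem_of_pow_mem 2 ?_
      convert hmem using 1
      norm_num
  by_cases hθ1 : θ - 1 ∈ I
  · exact ⟨_, eq_span_singleton_of_prime_absNorm hI.ne_top hθ1 (hN1' ▸ Nat.prime_two)⟩
  have hq : θ ^ 2 + θ + 1 ∈ I := (hI.mem_or_mem (hprod ▸ hmem2)).resolve_left hθ1
  refine ⟨_, eq_span_singleton_of_absNorm_eq hq h0 ?_⟩
  have hI4 : absNorm I = 4 := by
    refine h24.resolve_left fun h ↦ ?_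
    have hθI := (mem_or_sub_one_mem_of_absNorm_eq_two h θ).resolve_right hθ1
    refine hI.ne_top ((eq_top_iff_one I).2 ?_)
    have := I.sub_mem hq (I.mul_mem_left (θ + 1) hθI)
    ring_nf at this
    exact this
  have h8 := congrArg (fun α ↦ absNorm (span {α})) hprod
  simp only [← span_singleton_mul_span_singleton, map_mul, hN1'] at h8
  have h2 := absNorm_span_natCast (S := 𝓞 K) 2
  rw [RingOfIntegers.rank, h3] at h2
  push_cast at h2
  omega

end

open scoped Classical in
theorem classNumber_lt_of_cube_eq_prime {p : ℕ} (hp : p.Prime) {K : Type*} [Field K]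
    [NumberField K] {θ : K} (hθ : θ ^ 3 = (p : K)) (hgen : Algebra.adjoin ℚ {θ} = ⊤) :
    classNumber K < p := by
  have h3 := finrank_eq_three_of_cube_eq_prime hp hθ hgen
  obtain ⟨hr, hc⟩ := card_places_of_cube_eq_prime hp hθ hgen
  have := Fintype.card_le_one_iff_subsingleton.1 hr.le
  have := Fintype.card_le_one_iff_subsingleton.1 hc.le
  obtain ⟨v⟩ := Fintype.card_pos_iff.1 (hr ▸ one_pos)
  obtain ⟨w⟩ := Fintype.card_pos_iff.1 (hc ▸ one_pos)
  have hθZ : IsIntegral ℤ θ :=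
    IsIntegral.of_pow (n := 3) (by norm_num) (hθ ▸ isIntegral_natCast p)
  obtain ⟨θ, rfl⟩ : ∃ α : 𝓞 K, (α : K) = θ := ⟨⟨θ, hθZ⟩, rfl⟩
  replace hθ : θ ^ 3 = (p : 𝓞 K) := by
    apply RingOfIntegers.coe_injective
    simpa using hθ
  have hc' : nrComplexPlaces K = 1 := by
    rw [nrComplexPlaces]
    convert hc
  have h2 := hp.two_le
  rcases lt_or_ge p 5 with h5 | h5
  · have h4 : p ≠ 4 := by
      rintro rfl
      norm_num at hp
    have h23 : p = 2 ∨ p = 3 := by omega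
    have : classNumber K = 1 := h23.elim
      (fun h ↦ classNumber_eq_one_of_two h3 v w hp hc' h hθ)
      (fun h ↦ classNumber_eq_one_of_three h3 v w hp hc' h hθ)
    omega
  · rcases discr_pure_cubic h3 v w hp hθ with h | h
    · exact classNumber_lt_of_discr_eq_neg_twentyseven h3 v w hp h5 hθ h.1 h.2
    · exact classNumber_lt_of_discr_eq_neg_three h3 v w hp h5 hθ h

end

/-- **Lemma 3.4 (1)**: the class number of `ℚ(p^{1/3})` is smaller than `p`,
for every prime `p`.  Here `ℚ(p^{1/3})` is formalized as any number field `K`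
generated over `ℚ` by an element `θ` with `θ³ = p`. -/
theorem class_number_lt
    (p : ℕ) (hp : p.Prime)
    (K : Type) [Field K] [NumberField K]
    (θ : K) (hθ : θ ^ 3 = (p : K)) (hgen : Algebra.adjoin ℚ {θ} = ⊤) :
    NumberField.classNumber K < p :=
  classNumber_lt_of_cube_eq_prime hp hθ hgen
end
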